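/- Let G be a finite connected cubic (3-regular) non-bipartite vertex-transitive graph of even order. Then G is 2-extendable if and only if G has girth at least 4 and G is not isomorphic to Z_{4n}(1,4n−1,2n) for any n ≥ 2, not isomorphic to Z_{4n+2}(2,4n,2n+1) for any n ≥ 2, and not isomorphic to the Petersen graph. -/

import Mathlib

open SimpleGraph

/-- A simple graph is vertex-transitive if any vertex can be mapped to any other
by a graph automorphism. -/
def IsVertexTransitive {V : Type*} (G : SimpleGraph V) : Prop :=
  ∀ x y : V, ∃ φ : G ≃g G, φ x = y

/-- A graph `G` with at least `2*n+2` vertices is `n`-extendable if it has a matching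
of size `n` and every matching of size `n` extends to a perfect matching. -/
def IsNExtendable {V : Type*} [Fintype V] (G : SimpleGraph V) (n : ℕ) : Prop :=
  2 * n + 2 ≤ Fintype.card V ∧
    (∃ M : G.Subgraph, M.IsMatching ∧ M.edgeSet.ncard = n) ∧
    ∀ M : G.Subgraph, M.IsMatching → M.edgeSet.ncard = n →
      ∃ P : G.Subgraph, P.IsPerfectMatching ∧ M.edgeSet ⊆ P.edgeSet

/-- The generalized Petersen graph `GP(n,k)`, with outer vertices `Sum.inl i` and
inner vertices `Sum.inr i`, `i ∈ ZMod n`. -/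
def genPetersen (n k : ℕ) : SimpleGraph (ZMod n ⊕ ZMod n) :=
  SimpleGraph.fromRel fun p q =>
    (∃ i : ZMod n, p = Sum.inl i ∧ q = Sum.inl (i + 1)) ∨
    (∃ i : ZMod n, p = Sum.inl i ∧ q = Sum.inr i) ∨
    (∃ i : ZMod n, p = Sum.inr i ∧ q = Sum.inr (i + (k : ZMod n)))

/-- The circulant graph on `ZMod m` with connection set `{a, b, c}` (as residues). -/
def circThree (m : ℕ) (a b c : ℕ) : SimpleGraph (ZMod m) :=
  SimpleGraph.circulantGraph {(a : ZMod m), (b : ZMod m), (c : ZMod m)}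

section P
open Finset
set_option linter.all false

section P1
variable {V : Type*} [Fintype V] [DecidableEq V] (G : SimpleGraph V) [DecidableRel G.Adj]
abbrev Cub : Prop := ∀ v, (G.neighborFinset v).card = 3
structure CVT : Prop where
  conn : G.Connected
  cub : ∀ v, (G.neighborFinset v).card = 3
  vt : IsVertexTransitive G
def dd (X : Finset V) : ℕ := ∑ u, ∑ v, if (G.Adj u v ∧ u ∈ X ∧ v ∉ X) then 1 else 0
variable {G}
lemma dd_compl (X : Finset V) : dd G Xᶜ = dd G X := by
  unfold dd
  rw [sum_comm]
  refine sum_congr rfl fun u _ => sum_congr rfl fun v _ => ?_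
  simp only [mem_compl, not_not]
  congr 1
  rw [G.adj_comm]
  simp only [eq_iff_iff]; tauto
lemma dd_submod (X Y : Finset V) : dd G (X ∩ Y) + dd G (X ∪ Y) ≤ dd G X + dd G Y := by
  unfold dd
  simp only [← sum_add_distrib]
  refine sum_le_sum fun u _ => sum_le_sum fun v _ => ?_
  simp only [mem_inter, mem_union]
  by_cases aa : u ∈ X <;> by_cases af : u ∈ Y <;> by_cases ah : v ∈ X <;> by_cases ag : v ∈ Y <;>
    by_cases h : G.Adj u v <;> simp [*]
lemma dd_posimod (X Y : Finset V) : dd G (X \ Y) + dd G (Y \ X) ≤ dd G X + dd G Y := by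
  have h := dd_submod (G := G) X Yᶜ
  rw [dd_compl Y, show X ∩ Yᶜ = X \ Y by ext; simp, show X ∪ Yᶜ = (Y \ X)ᶜ by ext; simp; tauto,
    dd_compl] at h
  exact h
lemma dd_eq_sum (X : Finset V) : dd G X = ∑ u ∈ X, (G.neighborFinset u \ X).card := by
  unfold dd
  rw [← sum_subset (subset_univ X)]
  · refine sum_congr rfl fun u hu => ?_
    rw [card_eq_sum_ones, ← sum_filter]
    refine sum_congr ?_ fun _ _ => rfl
    ext v; simp [hu]
  · intro u _ hu
    simp [hu]
lemma card_nbr_split (u : V) (X : Finset V) :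
    (G.neighborFinset u \ X).card + (G.neighborFinset u ∩ X).card = (G.neighborFinset u).card :=
  card_sdiff_add_card_inter _ _
lemma dd_insert (hc : Cub G) {a : V} {X : Finset V} (ha : a ∉ X) :
    dd G (insert a X) + 2 * (G.neighborFinset a ∩ X).card = dd G X + 3 := by
  rw [dd_eq_sum, dd_eq_sum, sum_insert ha]
  have aa : G.neighborFinset a \ insert a X = G.neighborFinset a \ X := by
    ext v; simp only [mem_sdiff, mem_neighborFinset, mem_insert]
    constructor
    · tauto
    · rintro ⟨h, h'⟩; refine ⟨h, ?_⟩; rintro (rfl | af)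
      · exact G.loopless.irrefl _ h
      · exact h' af
  rw [aa]
  have af := card_nbr_split (G := G) a X
  rw [hc] at af
  have ah : ∑ u ∈ X, (G.neighborFinset u \ X).card =
      ∑ u ∈ X, (G.neighborFinset u \ insert a X).card + (G.neighborFinset a ∩ X).card := by
    have : (G.neighborFinset a ∩ X).card = ∑ u ∈ X, if G.Adj a u then 1 else 0 := by
      rw [← card_filter]; congr 1; ext; simp; tauto
    rw [this, ← sum_add_distrib]
    refine sum_congr rfl fun u hu => ?_
    by_cases h : G.Adj a u
    · have : G.neighborFinset u \ X = insert a (G.neighborFinset u \ insert a X) := by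
        ext v; simp only [mem_sdiff, mem_neighborFinset, mem_insert]
        by_cases hv : v = a
        · subst hv; simp [h.symm, ha]
        · simp [hv]
      rw [this, card_insert_of_notMem (by simp)]; simp [h]
    · simp only [h, if_false, add_zero]
      congr 1
      ext v; simp only [mem_sdiff, mem_neighborFinset, mem_insert]
      by_cases hv : v = a
      · subst hv; have h' : ¬ G.Adj u v := fun h' => h h'.symm
        simp [h']
      · simp [hv]
  omega
lemma dd_empty : dd G (∅ : Finset V) = 0 := by simp [dd]
lemma dd_parity (hc : Cub G) (X : Finset V) :
    dd G X % 2 = X.card % 2 := by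
  induction X using Finset.induction_on with
  | empty => simp [dd_empty]
  | insert a X ha ih =>
    have := dd_insert hc ha
    rw [card_insert_of_notMem ha]; omega
lemma dd_ge (hc : Cub G) (X : Finset V) :
    3 * X.card ≤ dd G X + X.card * (X.card - 1) := by
  rw [dd_eq_sum]
  have : ∑ u ∈ X, 3 ≤ ∑ u ∈ X, ((G.neighborFinset u \ X).card + (X.card - 1)) := by
    refine sum_le_sum fun u hu => ?_
    have aa := card_nbr_split (G := G) u X
    have af : (G.neighborFinset u ∩ X).card ≤ (X.erase u).card := by
      apply card_le_card
      intro v; simp only [mem_inter, mem_neighborFinset, mem_erase]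
      rintro ⟨h, h'⟩; exact ⟨h.ne', h'⟩
    rw [card_erase_of_mem hu] at af
    rw [hc] at aa; omega
  rw [sum_add_distrib] at this
  simp only [sum_const, smul_eq_mul] at this
  omega
lemma dd_image (φ : G ≃g G) (X : Finset V) : dd G (X.image φ) = dd G X := by
  unfold dd
  rw [← Equiv.sum_comp φ.toEquiv]
  refine sum_congr rfl fun u _ => ?_
  rw [← Equiv.sum_comp φ.toEquiv]
  refine sum_congr rfl fun v _ => ?_
  have h : ∀ w, (φ.toEquiv w ∈ X.image φ) ↔ w ∈ X := by
    intro w; simp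
  simp only [h]
  have : G.Adj (φ.toEquiv u) (φ.toEquiv v) ↔ G.Adj u v := φ.map_adj_iff
  simp only [this]
lemma card_image_aut (φ : G ≃g G) (X : Finset V) : (X.image φ).card = X.card :=
  card_image_of_injective _ φ.injective
lemma dd_zero (hconn : G.Connected) {X : Finset V} (h : dd G X = 0) : X = ∅ ∨ X = univ := by
  by_contra! hne
  obtain ⟨aa, af⟩ := hne
  obtain ⟨a, ha⟩ := aa
  obtain ⟨b, hb⟩ : ∃ b, b ∉ X := by
    by_contra! h'; exact af (eq_univ_iff_forall.2 h')
  unfold dd at h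
  have ah : ∀ u v, G.Adj u v → u ∈ X → v ∈ X := by
    intro u v huv hu
    by_contra hv
    rw [sum_eq_zero_iff] at h
    have := h u (mem_univ _)
    rw [sum_eq_zero_iff] at this
    have := this v (mem_univ _)
    simp [huv, hu, hv] at this
  obtain ⟨w⟩ := hconn.preconnected a b
  have : ∀ {a b : V}, G.Walk a b → a ∈ X → b ∈ X := by
    intro a b w
    induction w with
    | nil => exact id
    | cons hh _ ih => exact fun h => ih (ah _ _ hh h)
  exact hb (this w ha)
lemma block_lemma (h : CVT G) {X : Finset V}
    (hb : ∀ φ : G ≃g G, X.image φ = X ∨ Disjoint X (X.image φ)) :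
    ∃ t, dd G X = X.card * t := by
  rcases X.eq_empty_or_nonempty with rfl | ⟨a, ha⟩
  · exact ⟨0, by simp [dd_empty]⟩
  refine ⟨(G.neighborFinset a \ X).card, ?_⟩
  rw [dd_eq_sum, sum_const_nat]
  intro u hu
  obtain ⟨φ, hφ⟩ := h.vt a u
  have hX : X.image φ = X := by
    refine (hb φ).resolve_right fun hd => ?_
    exact (Finset.disjoint_left.1 hd hu) (mem_image.2 ⟨a, ha, hφ⟩)
  have : G.neighborFinset u \ X = (G.neighborFinset a \ X).image φ := by
    rw [image_sdiff _ _ φ.injective, hX]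
    congr 1
    ext v
    simp only [mem_neighborFinset, mem_image]
    constructor
    · intro hv
      refine ⟨φ.symm v, ?_, by simp⟩
      rw [← φ.map_adj_iff]; simpa [hφ] using hv
    · rintro ⟨w, hw, rfl⟩
      rw [← hφ]; exact φ.map_adj_iff.2 hw
  rw [this, card_image_aut]
variable (G) in
def TF : Prop := ∀ a b c, G.Adj a b → G.Adj b c → G.Adj c a → False
variable (G) in
def F4 : Prop := ∀ a b c d, G.Adj a b → G.Adj b c → G.Adj c d → G.Adj d a → a ≠ c → b ≠ d → False
variable (G) in
def F5 : Prop := ∀ a b c d e, G.Adj a b → G.Adj b c → G.Adj c d → G.Adj d e → G.Adj e a → False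
lemma exists_core (hc : Cub G) (Y : Finset V) (hne : Y.Nonempty)
    (hd : dd G Y ≤ Y.card) : ∃ Z ⊆ Y, Z.Nonempty ∧ dd G Z ≤ Z.card ∧
      ∀ v ∈ Z, 2 ≤ (G.neighborFinset v ∩ Z).card := by
  induction hn : Y.card using Nat.strong_induction_on generalizing Y with
  | _ n ih =>
  by_cases hall : ∀ v ∈ Y, 2 ≤ (G.neighborFinset v ∩ Y).card
  · exact ⟨Y, subset_rfl, hne, hd, hall⟩
  push Not at hall
  obtain ⟨v, hv, hlt⟩ := hall
  have aa := dd_insert hc (notMem_erase v Y)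
  rw [insert_erase hv] at aa
  have af : (G.neighborFinset v ∩ Y.erase v).card ≤ (G.neighborFinset v ∩ Y).card :=
    card_le_card (inter_subset_inter_left (erase_subset _ _))
  have ah := card_erase_add_one hv
  have hne' : (Y.erase v).Nonempty := by
    rw [nonempty_iff_ne_empty]
    intro am
    rw [am] at aa ah
    simp [dd_empty] at aa ah; omega
  obtain ⟨Z, hZ, hZ'⟩ := ih (Y.erase v).card (by omega) (Y.erase v) hne' (by omega) rfl
  exact ⟨Z, hZ.trans (erase_subset _ _), hZ'⟩
lemma exists_other {Z : Finset V} {v a : V} (h : 2 ≤ (G.neighborFinset v ∩ Z).card) :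
    ∃ b ∈ Z, b ≠ a ∧ G.Adj v b := by
  have : 0 < ((G.neighborFinset v ∩ Z).erase a).card := by
    have := pred_card_le_card_erase (a := a) (s := G.neighborFinset v ∩ Z)
    omega
  obtain ⟨b, hb⟩ := card_pos.1 this
  simp at hb
  exact ⟨b, hb.2.2, hb.1, hb.2.1⟩
lemma short_cycle (hc : Cub G) (Y : Finset V) (hne : Y.Nonempty)
    (hd : dd G Y ≤ Y.card) (aj : Y.card ≤ 5) (htf : TF G) (ag : 4 ≤ Y.card → F4 G)
    (h5' : 5 ≤ Y.card → F5 G) : False := by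
  obtain ⟨Z, hZY, ⟨v, hv⟩, hdZ, hZ⟩ := exists_core hc Y hne hd
  have hcard := card_le_card hZY
  obtain ⟨a, haZ, -, hva⟩ := exists_other (a := v) (hZ v hv)
  obtain ⟨b, hbZ, hba, hvb⟩ := exists_other (a := a) (hZ v hv)
  obtain ⟨c, hcZ, hcv, hac⟩ := exists_other (a := v) (hZ a haZ)
  obtain ⟨d, hdZ, hdv, hbd⟩ := exists_other (a := v) (hZ b hbZ)
  have hav := hva.ne
  have hbv := hvb.ne
  have hac' := hac.ne
  have hbd' := hbd.ne
  have hcb : c ≠ b := fun h => htf v a b hva (h ▸ hac) hvb.symm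
  have hda : d ≠ a := fun h => htf v b a hvb (h ▸ hbd) hva.symm
  have hc4 : 4 ≤ Y.card := by
    have : ({v, a, b, c} : Finset V) ⊆ Z := by
      intro x; simp; rintro (rfl | rfl | rfl | rfl) <;> assumption
    have := card_le_card this
    rw [card_insert_of_notMem (by simp; tauto), card_insert_of_notMem (by simp; tauto),
     card_insert_of_notMem (by simp; tauto)] at this
    simp at this; omega
  have fc := ag hc4
  have hcd : c ≠ d := fun h => fc v a c b hva hac (h ▸ hbd.symm) hvb.symm hcv.symm hba.symm
  have hsub : ({v, a, b, c, d} : Finset V) ⊆ Z := by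
    intro x; simp; rintro (rfl | rfl | rfl | rfl | rfl) <;> assumption
  have hc5 : ({v, a, b, c, d} : Finset V).card = 5 := by
    rw [card_insert_of_notMem (by simp; tauto), card_insert_of_notMem (by simp; tauto),
     card_insert_of_notMem (by simp; tauto), card_insert_of_notMem (by simp; tauto)]
    simp
  have hZeq := eq_of_subset_of_card_le hsub (by omega)
  have := card_le_card hsub
  have fe := h5' (by omega)
  obtain ⟨e, heZ, hea, hce⟩ := exists_other (a := a) (hZ c hcZ)
  rw [← hZeq] at heZ
  simp at heZ
  rcases heZ with rfl | rfl | rfl | rfl | rfl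
  · exact htf e a c hva hac hce
  · exact hea rfl
  · exact fc v a c e hva hac hce hvb.symm hcv.symm hba.symm
  · exact hce.ne rfl
  · exact fe v a c e b hva hac hce hbd.symm hvb.symm
lemma cross {X Y : Finset V} {k : ℕ} (hX : dd G X = k) (hY : dd G Y = k) (hXY : X.card = Y.card)
    (hn : 2 * X.card ≤ Fintype.card V) :
    (dd G (X ∩ Y) ≤ k ∨ (dd G (X ∪ Y)ᶜ < k ∧ (X ∩ Y).card ≤ (X ∪ Y)ᶜ.card)) ∧
    (dd G (X \ Y) ≤ k ∨ dd G (Y \ X) ≤ k) ∧ (X \ Y).card = (Y \ X).card ∧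
    (X \ Y).card + (X ∩ Y).card = X.card := by
  have aa := dd_submod (G := G) X Y
  have af := dd_posimod (G := G) X Y
  have ah := card_union_add_card_inter X Y
  have ag := card_sdiff_add_card_inter X Y
  have aj := card_sdiff_add_card_inter Y X
  rw [inter_comm] at aj
  have an := card_compl_add_card (X ∪ Y)
  rw [dd_compl]
  refine ⟨?_, by omega, by omega, ag⟩
  by_cases h : dd G (X ∩ Y) ≤ k
  · exact Or.inl h
  · right; constructor <;> omega
lemma cut_core (h : CVT G) {k : ℕ} (hk1 : 1 ≤ k) (hk5 : k ≤ 5)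
    (IH : ∀ X, dd G X < k → X.card ≤ dd G X - 2 ∨ Xᶜ.card ≤ dd G X - 2)
    (hnc : ¬ ∃ Y : Finset V, Y.card = k ∧ dd G Y = k ∧ 3 ≤ k) (X : Finset V) (hX : dd G X = k) :
    X.card ≤ k - 2 ∨ Xᶜ.card ≤ k - 2 := by
  by_contra hbad
  have hex : ∃ m, ∃ X : Finset V, X.card = m ∧ dd G X = k ∧ k - 2 < X.card ∧ k - 2 < Xᶜ.card :=
    ⟨_, X, rfl, hX, by omega, by omega⟩
  classical
  obtain ⟨X, hXm, hX, hX1, hX2⟩ := Nat.find_spec hex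
  have hmin : ∀ Z : Finset V, dd G Z = k → Z.card < X.card → Z.card ≤ k - 2 ∨ Zᶜ.card ≤ k - 2 := by
    intro Z hZ hlt
    by_contra hcon
    exact Nat.find_min hex (hXm ▸ hlt) ⟨Z, rfl, hZ, by omega, by omega⟩
  have hhalf : X.card ≤ Xᶜ.card := by
    by_contra hcon
    have := hmin Xᶜ (by rw [dd_compl, hX]) (by omega)
    rw [compl_compl] at this; omega
  have hcc := card_compl_add_card X
  have hpar := dd_parity h.cub X
  have hge := dd_ge h.cub X
  have hsmall : ∀ Z : Finset V, dd G Z ≤ k → Z.card < X.card → Z.card ≤ k - 2 := by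
    intro Z hZ hlt
    have := card_compl_add_card Z
    rcases hZ.lt_or_eq with hZ | hZ
    · have := IH Z hZ; omega
    · have := hmin Z hZ hlt; omega
  have hcase : X.card = k := by
    by_cases hb : ∀ φ : G ≃g G, X.image φ = X ∨ Disjoint X (X.image φ)
    · obtain ⟨t, ht⟩ := block_lemma h hb
      rw [hX] at ht
      have : X.card ≤ k := Nat.le_of_dvd hk1 ⟨t, ht⟩
      have : t ≤ k := Nat.le_of_dvd hk1 ⟨X.card, by rw [ht]; ring⟩
      interval_cases k <;> interval_cases hh : X.card <;> omega
    · push Not at hb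
      obtain ⟨φ, aa, af⟩ := hb
      set Y := X.image φ with hY
      have hYc : Y.card = X.card := card_image_aut φ X
      obtain ⟨ca, cb, ch, cg⟩ := cross hX (by rw [hY, dd_image, hX] : dd G Y = k) hYc.symm (by omega)
      have hi : 0 < (X ∩ Y).card := by
        rw [card_pos]; exact not_disjoint_iff_nonempty_inter.1 af
      have hs : 0 < (X \ Y).card := by
        rw [card_pos, sdiff_nonempty]
        intro hsub; exact aa (eq_of_subset_of_card_le hsub (by omega)).symm
      have hs' : (X \ Y).card ≤ k - 2 := by
        rcases cb with cb | cb
        · exact hsmall _ cb (by omega)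
        · rw [ch]; exact hsmall _ cb (by omega)
      have hi' : (X ∩ Y).card ≤ k - 2 := by
        rcases ca with ca | ⟨ca, ci⟩
        · exact hsmall _ ca (by omega)
        · have := card_le_card (subset_union_left : X ⊆ X ∪ Y)
          have := IH _ ca
          rw [compl_compl] at this; omega
      omega
  apply hnc
  refine ⟨X, hcase, hX, ?_⟩
  rw [hcase, hX] at hge
  by_contra hlt
  interval_cases k <;> omega
lemma cut0 (h : CVT G) (X : Finset V) (hX : dd G X = 0) :
    X.card ≤ dd G X - 2 ∨ Xᶜ.card ≤ dd G X - 2 := by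
  rcases dd_zero h.conn hX with rfl | rfl <;> simp
lemma cut_step (h : CVT G) {k : ℕ} (hk1 : 1 ≤ k) (hk5 : k ≤ 5)
    (IH : ∀ X, dd G X < k → X.card ≤ dd G X - 2 ∨ Xᶜ.card ≤ dd G X - 2)
    (hnc : ¬ ∃ Y : Finset V, Y.card = k ∧ dd G Y = k ∧ 3 ≤ k) :
    ∀ X, dd G X < k + 1 → X.card ≤ dd G X - 2 ∨ Xᶜ.card ≤ dd G X - 2 := by
  intro X hX
  rcases (Nat.lt_succ_iff.1 hX).lt_or_eq with aa | aa
  · exact IH X aa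
  · have := cut_core h hk1 hk5 IH hnc X aa
    rwa [← aa] at this
lemma cut2 (h : CVT G) : ∀ X, dd G X < 3 → X.card ≤ dd G X - 2 ∨ Xᶜ.card ≤ dd G X - 2 := by
  apply cut_step h (by norm_num) (by norm_num)
  · apply cut_step h (by norm_num) (by norm_num)
    · intro X hX; exact cut0 h X (by omega)
    · rintro ⟨_, _, _, h⟩; omega
  · rintro ⟨_, _, _, h⟩; omega
lemma cut3 (h : CVT G) (htf : TF G) :
    ∀ X, dd G X < 4 → X.card ≤ dd G X - 2 ∨ Xᶜ.card ≤ dd G X - 2 := by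
  apply cut_step h (by norm_num) (by norm_num) (cut2 h)
  rintro ⟨Y, aa, af, ah⟩
  exact short_cycle h.cub Y (by rw [← card_pos]; omega) (by omega) (by omega) htf
    (by omega) (by omega)
lemma cut4 (h : CVT G) (htf : TF G) (ag : F4 G) :
    ∀ X, dd G X < 5 → X.card ≤ dd G X - 2 ∨ Xᶜ.card ≤ dd G X - 2 := by
  apply cut_step h (by norm_num) (by norm_num) (cut3 h htf)
  rintro ⟨Y, aa, af, ah⟩
  exact short_cycle h.cub Y (by rw [← card_pos]; omega) (by omega) (by omega) htf
    (fun _ => ag) (by omega)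
end P1

section P2a
variable {V : Type*} {G : SimpleGraph V}
lemma pm_of_invol (m : V → V) (hm : ∀ v, m (m v) = v) (ha : ∀ v, G.Adj v (m v)) :
    ∃ P : G.Subgraph, P.IsPerfectMatching ∧ ∀ u v, P.Adj u v ↔ m u = v := by
  refine ⟨⟨Set.univ, fun u v => m u = v, ?_, ?_, ?_⟩, ?_, ?_⟩
  · rintro u v rfl; exact ha u
  · intros; trivial
  · constructor
    rintro u v rfl; exact hm u
  · rw [Subgraph.isPerfectMatching_iff]
    intro v; exact ⟨m v, rfl, fun w hw => Eq.symm (show m v = w from hw)⟩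
  · intros; rfl
lemma invol_of_pm {P : G.Subgraph} (hP : P.IsPerfectMatching) :
    ∃ m : V → V, (∀ v, m (m v) = v) ∧ (∀ v, G.Adj v (m v)) ∧ ∀ u v, P.Adj u v ↔ m u = v := by
  rw [Subgraph.isPerfectMatching_iff] at hP
  choose m hm hu using hP
  have key : ∀ u v, P.Adj u v ↔ m u = v := fun u v => ⟨fun h => (hu u v h).symm, fun h => h ▸ hm u⟩
  refine ⟨m, fun v => ?_, fun v => (hm v).adj_sub, key⟩
  exact (key _ _).1 (hm v).symm
lemma two_matching {a b c d : V} (hab : G.Adj a b) (hcd : G.Adj c d) (aa : a ≠ c) (af : a ≠ d)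
    (ah : b ≠ c) (ag : b ≠ d) : ∃ M : G.Subgraph, M.IsMatching ∧ M.edgeSet = {s(a,b), s(c,d)} := by
  refine ⟨G.subgraphOfAdj hab ⊔ G.subgraphOfAdj hcd, ?_, ?_⟩
  · apply Subgraph.IsMatching.sup (Subgraph.IsMatching.subgraphOfAdj hab)
      (Subgraph.IsMatching.subgraphOfAdj hcd)
    rw [support_subgraphOfAdj, support_subgraphOfAdj]
    rw [Set.disjoint_left]
    rintro x (rfl | rfl) (hx | hx) <;> simp_all
  · rw [Subgraph.edgeSet_sup, edgeSet_subgraphOfAdj, edgeSet_subgraphOfAdj]; rfl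
lemma matching_two {M : G.Subgraph} (hM : M.IsMatching) (af : M.edgeSet.ncard = 2) :
    ∃ a b c d, G.Adj a b ∧ G.Adj c d ∧ a ≠ c ∧ a ≠ d ∧ b ≠ c ∧ b ≠ d ∧
      M.edgeSet = {s(a,b), s(c,d)} := by
  rw [Set.ncard_eq_two] at af
  obtain ⟨e, f, hef, h⟩ := af
  induction e using Sym2.ind with | _ a b =>
  induction f using Sym2.ind with | _ c d =>
  have hab : M.Adj a b := by rw [← Subgraph.mem_edgeSet, h]; simp
  have hcd : M.Adj c d := by rw [← Subgraph.mem_edgeSet, h]; simp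
  refine ⟨a, b, c, d, hab.adj_sub, hcd.adj_sub, ?_, ?_, ?_, ?_, h⟩
  · rintro rfl; exact hef (by rw [hM.eq_of_adj_left hab hcd])
  · rintro rfl; exact hef (by rw [hM.eq_of_adj_left hab hcd.symm, Sym2.eq_swap])
  · rintro rfl; exact hef (by rw [hM.eq_of_adj_left hab.symm hcd, Sym2.eq_swap])
  · rintro rfl; exact hef (by rw [hM.eq_of_adj_left hab.symm hcd.symm])
variable [Fintype V]
lemma ext_iff : IsNExtendable G 2 ↔ 6 ≤ Fintype.card V ∧
    (∃ a b c d, G.Adj a b ∧ G.Adj c d ∧ a ≠ c ∧ a ≠ d ∧ b ≠ c ∧ b ≠ d) ∧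
    ∀ a b c d, G.Adj a b → G.Adj c d → a ≠ c → a ≠ d → b ≠ c → b ≠ d →
      ∃ m : V → V, (∀ v, m (m v) = v) ∧ (∀ v, G.Adj v (m v)) ∧ m a = b ∧ m c = d := by
  have hnc : ∀ {a b c d : V}, a ≠ c → a ≠ d → ({s(a,b), s(c,d)} : Set (Sym2 V)).ncard = 2 := by
    intro a b c d aa af
    rw [Set.ncard_pair]; simp only [ne_eq, Sym2.eq_iff]; tauto
  constructor
  · rintro ⟨an, ⟨M, hM, hM2⟩, h⟩
    refine ⟨an, ?_, ?_⟩
    · obtain ⟨a, b, c, d, h⟩ := matching_two hM hM2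
      exact ⟨a, b, c, d, by tauto⟩
    · intro a b c d hab hcd aa af ah ag
      obtain ⟨M, hM, hM2⟩ := two_matching hab hcd aa af ah ag
      obtain ⟨P, hP, hMP⟩ := h M hM (by rw [hM2]; exact hnc aa af)
      obtain ⟨m, ma, mb, md⟩ := invol_of_pm hP
      refine ⟨m, ma, mb, ?_, ?_⟩
      · rw [← md, ← Subgraph.mem_edgeSet]; apply hMP; rw [hM2]; simp
      · rw [← md, ← Subgraph.mem_edgeSet]; apply hMP; rw [hM2]; simp
  · rintro ⟨an, ⟨a, b, c, d, hab, hcd, aa, af, ah, ag⟩, h⟩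
    refine ⟨an, ?_, ?_⟩
    · obtain ⟨M, hM, hM2⟩ := two_matching hab hcd aa af ah ag
      exact ⟨M, hM, by rw [hM2]; exact hnc aa af⟩
    · intro M hM hM2
      obtain ⟨a, b, c, d, hab, hcd, aa, af, ah, ag, he⟩ := matching_two hM hM2
      obtain ⟨m, ma, mb, md, me⟩ := h a b c d hab hcd aa af ah ag
      obtain ⟨P, hP, hP2⟩ := pm_of_invol m ma mb
      refine ⟨P, hP, ?_⟩
      rw [he]
      rintro e (rfl | rfl)
      · rw [Subgraph.mem_edgeSet, hP2, md]
      · rw [Subgraph.mem_edgeSet, hP2, me]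
lemma not_ext_of_weight (x : V → ℤ) (hx : ∀ u v, G.Adj u v → 0 ≤ x u + x v) (hs : ∑ v, x v < 4)
    {a b c d : V} (hab : G.Adj a b) (hcd : G.Adj c d) (aa : a ≠ c) (af : a ≠ d)
    (ah : b ≠ c) (ag : b ≠ d) (ha : x a = 1) (hb : x b = 1) (hc : x c = 1) (hd : x d = 1) :
    ¬ IsNExtendable G 2 := by
  classical
  rw [ext_iff]
  rintro ⟨-, -, h⟩
  obtain ⟨m, ma, mb, md, me⟩ := h a b c d hab hcd aa af ah ag
  have ea : ∑ v, x (m v) = ∑ v, x v := Equiv.sum_comp (Function.Involutive.toPerm m ma) x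
  have eb : ∑ v ∈ ({a, b, c, d} : Finset V), (x v + x (m v)) ≤ ∑ v, (x v + x (m v)) := by
    apply sum_le_sum_of_subset_of_nonneg (subset_univ _)
    intro v _ _; exact hx _ _ (mb v)
  rw [sum_add_distrib (s := univ), ea] at eb
  have := hab.ne
  have := hcd.ne
  have mg : m b = a := by rw [← md, ma]
  have mh : m d = c := by rw [← me, ma]
  rw [sum_insert (by simp; tauto), sum_insert (by simp; tauto),
    sum_insert (by simp; tauto), sum_singleton, md, me, mg, mh, ha, hb, hc, hd] at eb
  omega
lemma ext_iso {W : Type*} [Fintype W] {H : SimpleGraph W} (f : G ≃g H) (h : IsNExtendable G 2) :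
    IsNExtendable H 2 := by
  rw [ext_iff] at h ⊢
  obtain ⟨an, ⟨a, b, c, d, hab, hcd, aa, af, ah, ag⟩, h⟩ := h
  refine ⟨by rw [← Fintype.card_congr f.toEquiv]; exact an,
    ⟨f a, f b, f c, f d, f.map_adj_iff.2 hab, f.map_adj_iff.2 hcd, f.injective.ne aa,
      f.injective.ne af, f.injective.ne ah, f.injective.ne ag⟩, ?_⟩
  intro a b c d hab hcd aa af ah ag
  obtain ⟨m, ma, mb, md, me⟩ := h (f.symm a) (f.symm b) (f.symm c) (f.symm d)
    (f.symm.map_adj_iff.2 hab) (f.symm.map_adj_iff.2 hcd) (f.symm.injective.ne aa)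
      (f.symm.injective.ne af) (f.symm.injective.ne ah) (f.symm.injective.ne ag)
  refine ⟨fun v => f (m (f.symm v)), by intro v; simp [ma], ?_, by simp [md], by simp [me]⟩
  intro v
  have := f.map_adj_iff.2 (mb (f.symm v))
  simpa using this
end P2a
section P2b
variable {V : Type*} [Fintype V] [DecidableEq V] {G : SimpleGraph V} [DecidableRel G.Adj]
lemma tutte_out (heven : Even (Fintype.card V)) {a b c d : V} (hab : G.Adj a b) (hcd : G.Adj c d)
    (aa : a ≠ c) (af : a ≠ d) (ah : b ≠ c) (ag : b ≠ d)
    (hno : ¬ ∃ m : V → V, (∀ v, m (m v) = v) ∧ (∀ v, G.Adj v (m v)) ∧ m a = b ∧ m c = d) :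
    ∃ (S : Finset V) (K : Finset (Finset V)), a ∈ S ∧ b ∈ S ∧ c ∈ S ∧ d ∈ S ∧ S.card ≤ K.card + 2 ∧
      (∀ X ∈ K, Odd X.card ∧ Disjoint X S ∧ ∀ u ∈ X, ∀ v, G.Adj u v → v ∈ X ∨ v ∈ S) ∧
      (∀ X ∈ K, ∀ Y ∈ K, X ≠ Y → Disjoint X Y) := by
  classical
  set Q : Finset V := {a, b, c, d} with hQ
  have hQc : Q.card = 4 := by
    have := hab.ne
    have := hcd.ne
    rw [hQ, card_insert_of_notMem (by simp; tauto), card_insert_of_notMem (by simp; tauto),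
     card_insert_of_notMem (by simp; tauto)]
    simp
  let T := {v : V // v ∉ Q}
  let G' : SimpleGraph T := G.comap Subtype.val
  have hnopm : ¬ ∃ M : G'.Subgraph, M.IsPerfectMatching := by
    rintro ⟨M, hM⟩
    obtain ⟨m, ma, mb, -⟩ := invol_of_pm hM
    apply hno
    refine ⟨fun v => if v = a then b else if v = b then a else if v = c then d else
      if v = d then c else if h : v ∉ Q then (m ⟨v, h⟩).1 else v, ?_, ?_, ?_, ?_⟩
    · intro v
      have := hab.ne
      have := hcd.ne
      by_cases ea : v = a
      · subst ea; simp [*]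
      by_cases eb : v = b
      · subst eb; simp [*]
      by_cases ec : v = c
      · subst ec; simp [*, ne_comm.1 aa, ne_comm.1 af, ne_comm.1 ah, ne_comm.1 ag]
      by_cases ed : v = d
      · subst ed; simp [*, ne_comm.1 aa, ne_comm.1 af, ne_comm.1 ah, ne_comm.1 ag]
      have hv : v ∉ Q := by simp [hQ, *]
      have hm := (m ⟨v, hv⟩).2
      have hm' := hm
      simp only [hQ, mem_insert, mem_singleton, not_or] at hm
      simp only [ea, eb, ec, ed, hv, if_false, dif_pos, not_false_eq_true, hm, hm']
      simp [ma]
    · intro v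
      have := hab.ne
      have := hcd.ne
      by_cases ea : v = a
      · subst ea; simp [*]
      by_cases eb : v = b
      · subst eb; simp [*, hab.symm]
      by_cases ec : v = c
      · subst ec; simp [*, ne_comm.1 aa, ne_comm.1 af, ne_comm.1 ah, ne_comm.1 ag]
      by_cases ed : v = d
      · subst ed; simp [*, ne_comm.1 aa, ne_comm.1 af, ne_comm.1 ah, ne_comm.1 ag, hcd.symm]
      have hv : v ∉ Q := by simp [hQ, *]
      simp only [ea, eb, ec, ed, hv, if_false, dif_pos, not_false_eq_true]
      exact mb ⟨v, hv⟩
    · simp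
    · simp [aa.symm, ah.symm]
  rw [SimpleGraph.tutte] at hnopm
  push Not at hnopm
  obtain ⟨u, hu⟩ := hnopm
  unfold SimpleGraph.IsTutteViolator at hu
  set D := ((⊤ : G'.Subgraph).deleteVerts u) with hD
  let S : Finset V := univ.filter fun v => v ∈ Q ∨ ∃ h : v ∉ Q, (⟨v, h⟩ : T) ∈ u
  have hSc : S.card = u.ncard + 4 := by
    have : S = Q ∪ (u.toFinset.image Subtype.val) := by
      ext v; simp [S]
    rw [this, card_union_of_disjoint, card_image_of_injective _ Subtype.val_injective,
      Set.ncard_eq_toFinset_card', hQc, add_comm]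
    rw [Finset.disjoint_left]
    intro v hv; simp [hv]
  let j : D.verts → V := fun t => t.1.1
  have hj : Function.Injective j := fun s t h => Subtype.ext (Subtype.ext h)
  have hjS : ∀ t, j t ∉ S := by
    rintro ⟨⟨v, hv⟩, ht⟩
    simp [hD, Subgraph.deleteVerts] at ht
    simp [S, j, hv, ht]
  have hjS' : ∀ v, v ∉ S → ∃ t, j t = v := by
    intro v hv
    simp only [S, mem_filter, mem_univ, true_and, not_or, not_exists] at hv
    refine ⟨⟨⟨v, hv.1⟩, ?_⟩, rfl⟩
    simp [hD, Subgraph.deleteVerts, hv.2 hv.1]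
  have hjadj : ∀ s t, D.coe.Adj s t ↔ G.Adj (j s) (j t) := by
    intro s t
    have hs := s.2
    have ht := t.2
    simp [hD, Subgraph.deleteVerts] at hs ht
    simp [hD, Subgraph.deleteVerts, j, hs, ht, G']
  have hcardT : Fintype.card D.verts + S.card = Fintype.card V := by
    have : (univ.image j) = Sᶜ := by
      ext v; simp only [mem_image, mem_univ, true_and, mem_compl]
      exact ⟨by rintro ⟨t, rfl⟩; exact hjS t, hjS' v⟩
    rw [← card_compl_add_card S, ← this, card_image_of_injective _ hj, card_univ]
  have hodd := D.coe.odd_ncard_oddComponents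
  let fK : D.coe.ConnectedComponent → Finset V := fun C => univ.filter fun v => ∃ t ∈ C.supp, j t = v
  have hfinj : Function.Injective fK := by
    intro C C' h
    induction C using ConnectedComponent.ind with | _ t =>
    have : j t ∈ fK (D.coe.connectedComponentMk t) := by
      simp only [fK, mem_filter, mem_univ, true_and]; exact ⟨t, rfl, rfl⟩
    rw [h] at this
    simp only [fK, mem_filter, mem_univ, true_and] at this
    obtain ⟨t', ht', e⟩ := this
    rw [hj e] at ht'
    exact ht'
  have hdisj : ∀ C C', C ≠ C' → Disjoint (fK C) (fK C') := by
    intro C C' hne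
    rw [Finset.disjoint_left]
    intro v hv hv'
    simp only [fK, mem_filter, mem_univ, true_and] at hv hv'
    obtain ⟨t, ht, e⟩ := hv
    obtain ⟨t', ht', e'⟩ := hv'
    have := hj (e.trans e'.symm)
    subst this
    exact hne (ht.symm.trans ht')
  refine ⟨S, D.coe.oddComponents.toFinite.toFinset.image fK, ?_, ?_, ?_, ?_, ?_, ?_, ?_⟩
  · simp [S, hQ]
  · simp [S, hQ]
  · simp [S, hQ]
  · simp [S, hQ]
  · rw [card_image_of_injective _ hfinj, ← Set.ncard_eq_toFinset_card]
    rw [Nat.card_eq_fintype_card] at hodd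
    rw [Nat.odd_iff, Nat.odd_iff] at hodd
    rw [Nat.even_iff] at heven
    omega
  · intro X hX
    simp only [mem_image, Set.Finite.mem_toFinset] at hX
    obtain ⟨C, hC, rfl⟩ := hX
    refine ⟨?_, ?_, ?_⟩
    · have : (fK C).card = C.supp.ncard := by
        rw [Set.ncard_eq_toFinset_card', ← card_image_of_injective _ hj]
        congr 1; ext v; simp [fK]
      rw [this]; exact hC
    · rw [Finset.disjoint_left]
      intro v hv
      simp only [fK, mem_filter, mem_univ, true_and] at hv
      obtain ⟨t, -, rfl⟩ := hv
      exact hjS t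
    · intro u hu v huv
      by_cases hv : v ∈ S
      · exact Or.inr hv
      left
      simp only [fK, mem_filter, mem_univ, true_and] at hu ⊢
      obtain ⟨t, ht, rfl⟩ := hu
      obtain ⟨s, rfl⟩ := hjS' v hv
      refine ⟨s, ?_, rfl⟩
      rw [ConnectedComponent.mem_supp_iff] at ht ⊢
      rw [← ht]
      exact ConnectedComponent.sound ((hjadj _ _).2 huv).symm.reachable
  · intro X hX Y hY hne
    simp only [mem_image, Set.Finite.mem_toFinset] at hX hY
    obtain ⟨C, hC, rfl⟩ := hX
    obtain ⟨C', hC', rfl⟩ := hY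
    exact hdisj _ _ (fun h => hne (by rw [h]))
end P2b

section P3
variable {V : Type*} [Fintype V] [DecidableEq V] {G : SimpleGraph V} [DecidableRel G.Adj]
variable (G) in
structure CaseA (x : V → ℤ) : Prop where
  pm : ∀ v, x v = 1 ∨ x v = -1
  edge : ∀ u v, G.Adj u v → 0 ≤ x u + x v
  sum : ∑ v, x v = 2
variable (G) in
structure CaseB (x : V → ℤ) (H : Finset V) (a b c d : V) : Prop where
  memH : ∀ v, v ∈ H ↔ x v = 0
  pm : ∀ v, x v = 1 ∨ x v = -1 ∨ x v = 0
  edge : ∀ u v, G.Adj u v → 0 ≤ x u + x v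
  sum : ∑ v, x v = 3
  dH : dd G H = 5
  cardH : 3 ≤ H.card
  oddH : Odd H.card
  hab : G.Adj a b
  hcd : G.Adj c d
  xa : x a = 1
  xb : x b = 1
  xc : x c = 1
  xd : x d = 1
  ac : a ≠ c
  ad : a ≠ d
  bc : b ≠ c
  bd : b ≠ d
  only : ∀ u v, G.Adj u v → x u = 1 → x v = 1 →
    (u = a ∧ v = b) ∨ (u = b ∧ v = a) ∨ (u = c ∧ v = d) ∨ (u = d ∧ v = c)
lemma dd_closed {S X : Finset V} (hd : Disjoint X S)
    (hcl : ∀ u ∈ X, ∀ v, G.Adj u v → v ∈ X ∨ v ∈ S) :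
    dd G X = ∑ u ∈ X, (G.neighborFinset u ∩ S).card := by
  rw [dd_eq_sum]
  refine sum_congr rfl fun u hu => ?_
  congr 1
  ext v
  simp only [mem_sdiff, mem_inter, mem_neighborFinset]
  constructor
  · rintro ⟨h, h'⟩; exact ⟨h, (hcl u hu v h).resolve_left h'⟩
  · rintro ⟨h, h'⟩; exact ⟨h, fun af => Finset.disjoint_left.1 hd af h'⟩
lemma dd_singleton (hc : Cub G) (v : V) : dd G {v} = 3 := by
  have := dd_insert hc (notMem_empty v)
  simp [dd_empty] at this
  exact this
set_option maxHeartbeats 1000000 in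
lemma caseAB (h : CVT G) (htf : TF G) (heven : Even (Fintype.card V)) {a b c d : V}
    (hab : G.Adj a b) (hcd : G.Adj c d)
    (aa : a ≠ c) (af : a ≠ d) (ah : b ≠ c) (ag : b ≠ d)
    (hno : ¬ ∃ m : V → V, (∀ v, m (m v) = v) ∧ (∀ v, G.Adj v (m v)) ∧ m a = b ∧ m c = d) :
    (∃ x, CaseA G x) ∨ ∃ x H, CaseB G x H a b c d := by
  obtain ⟨S, K, ha, hb, hc, hd, hcard, hK, hdis⟩ := tutte_out heven hab hcd aa af ah ag hno
  set U : Finset V := K.biUnion id with hU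
  set R : Finset V := (S ∪ U)ᶜ with hR
  have hUS : Disjoint S U := by
    rw [disjoint_right]
    intro v hv
    simp only [hU, mem_biUnion, id] at hv
    obtain ⟨X, hX, hv⟩ := hv
    exact Finset.disjoint_left.1 (hK X hX).2.1 hv
  have hRS : Disjoint R S := by
    rw [Finset.disjoint_left]; intro v hv; simp [hR] at hv; tauto
  have hRU : Disjoint U R := by
    rw [disjoint_right]; intro v hv; simp only [hR, mem_compl, mem_union] at hv; tauto
  have hRcl : ∀ u ∈ R, ∀ v, G.Adj u v → v ∈ R ∨ v ∈ S := by
    intro u hu v huv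
    by_contra hcon
    push Not at hcon
    have hvU : v ∈ U := by
      have := hcon.1
      simp only [hR, mem_compl, mem_union, not_not] at this; tauto
    simp only [hU, mem_biUnion, id] at hvU
    obtain ⟨X, hX, hv⟩ := hvU
    rcases (hK X hX).2.2 v hv u huv.symm with aj | aj
    · have : u ∈ U := by simp only [hU, mem_biUnion, id]; exact ⟨X, hX, aj⟩
      simp only [hR, mem_compl, mem_union] at hu; tauto
    · exact Finset.disjoint_left.1 hRS hu aj
  have hUR : Sᶜ = U ∪ R := by
    ext v; simp only [hR, mem_compl, mem_union]
    have := @Finset.disjoint_left _ S U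
    by_cases hv : v ∈ S
    · have := this.1 hUS hv; tauto
    · tauto
  have hScl : ∀ u ∈ Sᶜ, ∀ v, G.Adj u v → v ∈ Sᶜ ∨ v ∈ S := by
    intro u hu v _; simp; tauto
  have hpd : (K : Set (Finset V)).PairwiseDisjoint id := fun X hX Y hY hne => hdis X hX Y hY hne
  have hdU : ∑ u ∈ U, (G.neighborFinset u ∩ S).card = ∑ X ∈ K, dd G X := by
    rw [hU, sum_biUnion hpd]
    refine sum_congr rfl fun X hX => ?_
    rw [dd_closed (hK X hX).2.1 (hK X hX).2.2]; rfl
  have hdS : dd G S = ∑ X ∈ K, dd G X + dd G R := by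
    rw [← dd_compl, dd_closed disjoint_compl_left hScl, hUR, sum_union hRU, hdU,
      dd_closed hRS hRcl]
  set ein := ∑ u ∈ S, (G.neighborFinset u ∩ S).card with hein
  have h3S : dd G S + ein = 3 * S.card := by
    rw [dd_eq_sum, hein, ← sum_add_distrib, sum_const_nat (m := 3), mul_comm]
    intro u hu
    rw [card_nbr_split, h.cub]
  set Q : Finset V := {a, b, c, d} with hQ
  have hQc : Q.card = 4 := by
    have := hab.ne
    have := hcd.ne
    rw [hQ, card_insert_of_notMem (by simp; tauto), card_insert_of_notMem (by simp; tauto),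
     card_insert_of_notMem (by simp; tauto)]
    simp
  have hQS : Q ⊆ S := by
    intro v; simp only [hQ, mem_insert, mem_singleton]
    rintro (rfl | rfl | rfl | rfl) <;> assumption
  have hQ1 : ∀ u ∈ Q, 1 ≤ (G.neighborFinset u ∩ S).card := by
    intro u; simp only [hQ, mem_insert, mem_singleton]
    have : ∀ u v, v ∈ S → G.Adj u v → 1 ≤ (G.neighborFinset u ∩ S).card := by
      intro u v hv huv; exact card_pos.2 ⟨v, by simp [huv, hv]⟩
    rintro (rfl | rfl | rfl | rfl)
    · exact this _ _ hb hab
    · exact this _ _ ha hab.symm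
    · exact this _ _ hd hcd
    · exact this _ _ hc hcd.symm
  have hsplit : ein = ∑ u ∈ S \ Q, (G.neighborFinset u ∩ S).card + ∑ u ∈ Q, (G.neighborFinset u ∩ S).card := by
    rw [hein, sum_sdiff hQS]
  have hein4' : 4 ≤ ∑ u ∈ Q, (G.neighborFinset u ∩ S).card := by
    rw [← hQc, card_eq_sum_ones]; exact sum_le_sum hQ1
  have hein4 : 4 ≤ ein := by omega
  have hSQ : 4 ≤ S.card := by rw [← hQc]; exact card_le_card hQS
  have hd3 : ∀ X ∈ K, 3 ≤ dd G X := by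
    intro X hX
    obtain ⟨ka, kb, -⟩ := hK X hX
    have hp := dd_parity h.cub X
    rw [Nat.odd_iff] at ka
    by_contra hlt
    have := cut2 h X (by omega)
    have := card_le_card (subset_compl_iff_disjoint_left.2 kb : S ⊆ Xᶜ)
    omega
  have hsumK : 3 * K.card ≤ ∑ X ∈ K, dd G X := by
    rw [mul_comm]
    have := card_nsmul_le_sum K (fun X => dd G X) 3 hd3
    simpa using this
  have hKodd : (∑ X ∈ K, X.card) % 2 = K.card % 2 := by
    rw [sum_nat_mod, card_eq_sum_ones, sum_congr rfl (fun X hX => Nat.odd_iff.1 (hK X hX).1)]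
  have hUcard : U.card = ∑ X ∈ K, X.card := by
    rw [hU, card_biUnion]
    · rfl
    · intro X hX Y hY hne; exact hdis X hX Y hY hne
  have hncard : S.card + U.card + R.card = Fintype.card V := by
    have ea := card_compl_add_card S
    rw [hUR, card_union_of_disjoint hRU] at ea; omega
  have hKd : K.card + 2 = S.card := by omega
  have hRpar := dd_parity h.cub R
  rw [Nat.even_iff] at heven
  have hR0 : R = ∅ := by
    by_contra hne
    have := card_pos.2 (nonempty_iff_ne_empty.2 hne)
    have := cut2 h R (by omega)
    have := card_le_card (subset_compl_iff_disjoint_left.2 hRS : S ⊆ Rᶜ)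
    omega
  have hdR : dd G R = 0 := by rw [hR0, dd_empty]
  have hmain : ∑ X ∈ K, dd G X + ein = 3 * K.card + 6 := by omega
  have hone : ∀ X ∈ K, dd G X = 3 → X.card = 1 := by
    intro X hX hX3
    obtain ⟨ka, kb, -⟩ := hK X hX
    have := card_le_card (subset_compl_iff_disjoint_left.2 kb : S ⊆ Xᶜ)
    have := cut3 h htf X (by omega)
    have := ka.pos
    omega
  have hcov : ∀ v, v ∈ S ∨ ∃ X ∈ K, v ∈ X := by
    intro v
    by_cases hv : v ∈ S
    · exact Or.inl hv
    right
    rw [← mem_compl, hUR, hR0] at hv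
    simpa [hU] using hv
  by_cases hall : ∀ X ∈ K, dd G X = 3
  · left
    refine ⟨fun v => if v ∈ S then 1 else -1, ?_, ?_, ?_⟩
    · intro v; by_cases hv : v ∈ S <;> simp [hv]
    · intro u v huv
      by_cases hu : u ∈ S
      · by_cases hv : v ∈ S <;> simp [hu, hv]
      by_cases hv : v ∈ S
      · simp [hu, hv]
      exfalso
      obtain ⟨X, hX, huX⟩ := (hcov u).resolve_left hu
      have hvX := ((hK X hX).2.2 u huX v huv).resolve_right hv
      have := card_le_one.1 (hone X hX (hall X hX)).le u huX v hvX
      exact huv.ne this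
    · rw [sum_ite]
      simp only [sum_const]
      have ea : (univ.filter fun v => v ∈ S) = S := by ext; simp
      have eb : (univ.filter fun v => v ∉ S) = U := by
        ext v
        have : v ∈ Sᶜ ↔ v ∈ U := by rw [hUR, hR0, union_empty]
        simp at this ⊢; exact this
      rw [ea, eb, hUcard, sum_congr rfl (fun X hX => hone X hX (hall X hX))]
      simp; omega
  · right
    push Not at hall
    obtain ⟨H, hHK, hH3⟩ := hall
    obtain ⟨ka, kb, kc⟩ := hK H hHK
    have hHp := dd_parity h.cub H
    have hH3' := hd3 H hHK
    have hsumK' : dd G H + ∑ X ∈ K.erase H, dd G X = ∑ X ∈ K, dd G X :=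
      add_sum_erase K (fun X => dd G X) hHK
    have hKe := card_erase_add_one hHK
    have hsum3 : 3 * (K.erase H).card ≤ ∑ X ∈ K.erase H, dd G X := by
      rw [mul_comm]
      have := card_nsmul_le_sum (K.erase H) (fun X => dd G X) 3
        (fun X hX => hd3 X (mem_of_mem_erase hX))
      simpa using this
    rw [Nat.odd_iff] at ka
    have hdH : dd G H = 5 := by omega
    have hein' : ein = 4 := by omega
    have hallS : ∀ X ∈ K.erase H, dd G X = 3 := by
      have e : ∑ X ∈ K.erase H, 3 = ∑ X ∈ K.erase H, dd G X := by simp; omega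
      have := (sum_eq_sum_iff_of_le (fun X hX => hd3 X (mem_of_mem_erase hX))).1 e
      intro X hX; exact (this X hX).symm
    have hHS : ∀ v ∈ S, v ∉ H := fun v hv hv' => Finset.disjoint_left.1 kb hv' hv
    refine ⟨fun v => if v ∈ S then 1 else if v ∈ H then 0 else -1, H, ?_⟩
    have hQin : ∀ u ∈ S, ∀ v ∈ S, G.Adj u v → u ∈ Q ∧ (G.neighborFinset u ∩ S).card = 1 := by
      intro u hu v hv huv
      have hpos : 1 ≤ (G.neighborFinset u ∩ S).card := card_pos.2 ⟨v, by simp [huv, hv]⟩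
      have huQ : u ∈ Q := by
        by_contra hn
        have := single_le_sum (f := fun u => (G.neighborFinset u ∩ S).card)
          (fun _ _ => Nat.zero_le _) (mem_sdiff.2 ⟨hu, hn⟩)
        omega
      refine ⟨huQ, ?_⟩
      have e : ∑ u ∈ Q, 1 = ∑ u ∈ Q, (G.neighborFinset u ∩ S).card := by simp; omega
      exact ((sum_eq_sum_iff_of_le hQ1).1 e u huQ).symm
    constructor
    · intro v; by_cases hv : v ∈ S
      · simp [hv, hHS v hv]
      · by_cases hv' : v ∈ H <;> simp [hv, hv']
    · intro v; by_cases hv : v ∈ S <;> by_cases hv' : v ∈ H <;> simp [hv, hv']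
    · have key : ∀ u v, G.Adj u v → u ∉ S → u ∉ H → v ∈ S := by
        intro u v huv hu hu'
        by_contra hv
        obtain ⟨X, hX, huX⟩ := (hcov u).resolve_left hu
        have hvX := ((hK X hX).2.2 u huX v huv).resolve_right hv
        have hXH : X ≠ H := fun e => hu' (e ▸ huX)
        have := card_le_one.1 (hone X hX (hallS X (mem_erase.2 ⟨hXH, hX⟩))).le u huX v hvX
        exact huv.ne this
      intro u v huv
      have kd := key u v huv
      have ke := key v u huv.symm
      by_cases hu : u ∈ S <;> by_cases hu' : u ∈ H <;> by_cases hv : v ∈ S <;> by_cases hv' : v ∈ H <;>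
        simp [hu, hu', hv, hv'] <;> tauto
    · have ea : ∀ v, (if v ∈ S then (1:ℤ) else if v ∈ H then 0 else -1) =
          2 * (if v ∈ S then 1 else 0) + (if v ∈ H then 1 else 0) - 1 := by
        intro v; by_cases hv : v ∈ S
        · simp [hv, hHS v hv]
        · by_cases hv' : v ∈ H <;> simp [hv, hv']
      rw [sum_congr rfl (fun v _ => ea v)]
      rw [sum_sub_distrib, sum_add_distrib, ← mul_sum]
      have hUe : U.card = H.card + (K.erase H).card := by
        have ee : ∑ X ∈ K.erase H, X.card = ∑ X ∈ K.erase H, 1 :=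
          sum_congr rfl (fun X hX => hone X (mem_of_mem_erase hX) (hallS X hX))
        rw [hUcard, ← add_sum_erase K _ hHK, ee]
        simp
      rw [hR0] at hncard
      simp at hncard ⊢
      omega
    · exact hdH
    · by_contra hlt
      have : H.card = 1 := by omega
      obtain ⟨v, rfl⟩ := card_eq_one.1 this
      rw [dd_singleton h.cub] at hdH; omega
    · exact Nat.odd_iff.2 ka
    · exact hab
    · exact hcd
    · simp [ha]
    · simp [hb]
    · simp [hc]
    · simp [hd]
    · exact aa
    · exact af
    · exact ah
    · exact ag
    · intro u v huv hu hv
      have hu : u ∈ S := by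
        by_contra hn; by_cases hn' : u ∈ H <;> simp [hn, hn'] at hu
      have hv : v ∈ S := by
        by_contra hn; by_cases hn' : v ∈ H <;> simp [hn, hn'] at hv
      obtain ⟨hq, hc1⟩ := hQin u hu v hv huv
      have huniq : ∀ w ∈ S, G.Adj u w → v = w := by
        intro w hw huw
        exact card_le_one.1 hc1.le v (by simp [huv, hv]) w (by simp [huw, hw])
      simp only [hQ, mem_insert, mem_singleton] at hq
      rcases hq with e | e | e | e
      · exact Or.inl ⟨e, huniq b hb (e ▸ hab)⟩
      · exact Or.inr (Or.inl ⟨e, huniq a ha (e ▸ hab.symm)⟩)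
      · exact Or.inr (Or.inr (Or.inl ⟨e, huniq d hd (e ▸ hcd)⟩))
      · exact Or.inr (Or.inr (Or.inr ⟨e, huniq c hc (e ▸ hcd.symm)⟩))
set_option maxHeartbeats 1000000 in
lemma caseB_three (htf : TF G) {x : V → ℤ} {H : Finset V} {a b c d : V}
    (h : CaseB G x H a b c d) (ah : H.card = 3) : ∃ y, CaseA G y := by
  obtain ⟨p, q, r, hpq, hpr, hqr, hH⟩ := card_eq_three.1 ah
  have key : ∀ p q r, p ≠ q → p ≠ r → q ≠ r → H = {p, q, r} → ¬ G.Adj p r → ∃ y, CaseA G y := by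
    intro p q r hpq hpr hqr hH hn
    have hm : ∀ v, x v = 0 ↔ v = p ∨ v = q ∨ v = r := by
      intro v; rw [← h.memH, hH]; simp
    refine ⟨fun v => if v = p ∨ v = r then -1 else if v = q then 1 else x v, ?_, ?_, ?_⟩
    · intro v
      have := hm v
      have := h.pm v
      by_cases aa : v = p <;> by_cases af : v = q <;> by_cases ah : v = r <;> simp_all
    · have hn' : ¬ G.Adj r p := fun h => hn h.symm
      have key : ∀ u v, G.Adj u v → (u = p ∨ u = r) → 0 ≤ (if u = p ∨ u = r then -1 else if u = q then 1 else x u) + (if v = p ∨ v = r then -1 else if v = q then 1 else x v) := by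
        intro u v huv hu
        have aa := h.edge u v huv
        have af := h.pm v
        have ah := hm u
        have ag := hm v
        have hv : ¬ (v = p ∨ v = r) := by
          rintro (rfl | rfl) <;> rcases hu with rfl | rfl <;> first | exact huv.ne rfl | exact hn huv | exact hn' huv
        have hxu : x u = 0 := ah.2 (by tauto)
        simp only [hu, hv, if_true, if_false]
        split_ifs with hq
        · simp
        · have : x v ≠ 0 := fun am => by have := ag.1 am; tauto
          omega
      intro u v huv
      by_cases hu : u = p ∨ u = r
      · exact key u v huv hu
      by_cases hv : v = p ∨ v = r
      · rw [add_comm]; exact key v u huv.symm hv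
      have aa := h.edge u v huv
      simp only [hu, hv, if_false]
      have ah := hm u
      have ag := hm v
      split_ifs with hq hq'
      · simp
      · have : x u = 0 := ah.2 (by tauto)
        omega
      · have : x v = 0 := ag.2 (by tauto)
        omega
      · exact aa
    · have ea : ∀ v, (if v = p ∨ v = r then (-1:ℤ) else if v = q then 1 else x v) = x v +
        ((if v = q then 1 else 0) - (if v = p then 1 else 0) - (if v = r then 1 else 0)) := by
        intro v
        have := hm v
        by_cases aa : v = p <;> by_cases af : v = q <;> by_cases ah : v = r <;> simp_all
      rw [sum_congr rfl (fun v _ => ea v), sum_add_distrib, h.sum,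
        sum_sub_distrib, sum_sub_distrib]
      simp
  by_cases aa : G.Adj p q
  · by_cases af : G.Adj q r
    · exact key p q r hpq hpr hqr hH (fun h => htf p q r aa af h.symm)
    · exact key q p r hpq.symm hqr hpr (by rw [hH]; ext; simp; tauto) af
  · exact key p r q hpr hpq hqr.symm (by rw [hH]; ext; simp; tauto) aa
end P3

section P4
variable {V : Type*} [Fintype V] [DecidableEq V] {G : SimpleGraph V} [DecidableRel G.Adj]
lemma dd_insert_le (hc : Cub G) {a : V} {X : Finset V} (ha : a ∉ X)
    (T : Finset V) (hT : T ⊆ X) (hadj : ∀ t ∈ T, G.Adj a t) :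
    dd G (insert a X) + 2 * T.card ≤ dd G X + 3 := by
  have := dd_insert hc ha
  have : T.card ≤ (G.neighborFinset a ∩ X).card := by
    apply card_le_card
    intro t ht; simp [hadj t ht, hT ht]
  omega
lemma dd_insert1 (hc : Cub G) {a : V} {X : Finset V} (ha : a ∉ X)
    {t : V} (ht : t ∈ X) (h : G.Adj a t) :
    dd G (insert a X) ≤ dd G X + 1 := by
  have := dd_insert_le hc ha {t} (by simpa using ht) (by simpa using h)
  simp at this; omega
lemma dd_insert2 (hc : Cub G) {a : V} {X : Finset V} (ha : a ∉ X)
    {t s : V} (ht : t ∈ X) (hs : s ∈ X) (hts : t ≠ s) (h : G.Adj a t) (h' : G.Adj a s) :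
    dd G (insert a X) + 1 ≤ dd G X := by
  have := dd_insert_le hc ha {t, s} (by intro; simp; rintro (rfl | rfl) <;> assumption)
    (by intro; simp; rintro (rfl | rfl) <;> assumption)
  rw [card_pair hts] at this
  omega
lemma dd_insert3 (hc : Cub G) {a : V} {X : Finset V} (ha : a ∉ X)
    {t s r : V} (ht : t ∈ X) (hs : s ∈ X) (hr : r ∈ X) (hts : t ≠ s) (htr : t ≠ r) (hsr : s ≠ r)
    (h : G.Adj a t) (h' : G.Adj a s) (h'' : G.Adj a r) :
    dd G (insert a X) + 3 ≤ dd G X := by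
  have := dd_insert_le hc ha {t, s, r} (by intro; simp; rintro (rfl | rfl | rfl) <;> assumption)
    (by intro; simp; rintro (rfl | rfl | rfl) <;> assumption)
  rw [card_eq_three.2 ⟨t, s, r, hts, htr, hsr, rfl⟩] at this
  omega
lemma third (hc : Cub G) {a b c : V} (hab : G.Adj a b) (hac : G.Adj a c)
    (hbc : b ≠ c) : ∃ d, G.Adj a d ∧ d ≠ b ∧ d ≠ c ∧ ∀ e, G.Adj a e → e = b ∨ e = c ∨ e = d := by
  have aa : b ∈ G.neighborFinset a := by simpa
  have af : c ∈ (G.neighborFinset a).erase b := by simp [hac, hbc.symm]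
  have ah := card_erase_add_one aa
  have ag := card_erase_add_one af
  rw [hc] at ah
  obtain ⟨d, hd⟩ := card_eq_one.1 (show (((G.neighborFinset a).erase b).erase c).card = 1 by omega)
  have hd' : d ∈ ((G.neighborFinset a).erase b).erase c := by rw [hd]; simp
  simp at hd'
  refine ⟨d, hd'.2.2, hd'.2.1, hd'.1, fun e he => ?_⟩
  by_contra hcon
  push Not at hcon
  have : e ∈ ((G.neighborFinset a).erase b).erase c := by simp [he, hcon]
  rw [hd] at this
  simp at this; tauto
lemma nbr3 (hc : Cub G) (a : V) : ∃ b c d, G.Adj a b ∧ G.Adj a c ∧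
    G.Adj a d ∧ b ≠ c ∧ b ≠ d ∧ c ≠ d ∧ ∀ e, G.Adj a e → e = b ∨ e = c ∨ e = d := by
  obtain ⟨b, c, d, aa, af, ah, h⟩ := card_eq_three.1 (hc a)
  have : ∀ e, G.Adj a e ↔ e = b ∨ e = c ∨ e = d := by
    intro e; rw [← mem_neighborFinset, h]; simp
  exact ⟨b, c, d, by simp [this], by simp [this], by simp [this], aa, af, ah, fun e => (this e).1⟩
lemma nbr_all (hc : Cub G) {a b c d : V} (hab : G.Adj a b)
    (hac : G.Adj a c) (had : G.Adj a d) (aa : b ≠ c) (af : b ≠ d) (ah : c ≠ d) {e : V}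
    (he : G.Adj a e) : e = b ∨ e = c ∨ e = d := by
  obtain ⟨d', ag, aj, an, ao⟩ := third hc hab hac aa
  have := ao d had
  have := ao e he
  grind
set_option maxHeartbeats 1000000 in
lemma tri_not_ext (hcon : G.Connected) (hc : Cub G) (h : IsNExtendable G 2) :
    TF G := by
  intro a b c hab hbc hca
  have an := h.1
  obtain ⟨a', aa, af, ah, ag⟩ := third hc hab hca.symm hbc.ne
  have haa' := aa.ne
  have hex : ∃ y, G.Adj a' y ∧ y ≠ a ∧ y ≠ b ∧ y ≠ c := by
    by_contra hno
    push Not at hno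
    obtain ⟨p, q, r, pf, qg, rg, hpq, hpr, hqr, -⟩ := nbr3 hc a'
    have hp := hno p pf
    have hq := hno q qg
    have hr := hno r rg
    have hp' : p = a ∨ p = b ∨ p = c := by
      by_contra hh; push Not at hh; exact hh.2.2 (hp hh.1 hh.2.1)
    have hq' : q = a ∨ q = b ∨ q = c := by
      by_contra hh; push Not at hh; exact hh.2.2 (hq hh.1 hh.2.1)
    have hr' : r = a ∨ r = b ∨ r = c := by
      by_contra hh; push Not at hh; exact hh.2.2 (hr hh.1 hh.2.1)
    have hb' : G.Adj a' b ∧ G.Adj a' c := by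
      clear hno hp hq hr ag
      rcases hp' with rfl | rfl | rfl <;> rcases hq' with rfl | rfl | rfl <;>
        rcases hr' with rfl | rfl | rfl <;> first | exact ⟨by assumption, by assumption⟩ | (exfalso; apply hpq; rfl) | (exfalso; apply hpr; rfl) | (exfalso; apply hqr; rfl)
    have ea : dd G ({a} : Finset V) = 3 := dd_singleton hc a
    have eb := dd_insert1 hc (a := b) (X := {a}) (by simp [hab.ne']) (t := a) (by simp) hab.symm
    have ec := dd_insert2 hc (a := c) (X := {b, a}) (by simp [hbc.ne', hca.ne]) (t := b) (s := a) (by simp)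
      (by simp) hab.ne' hbc.symm hca
    have ed := dd_insert3 hc (a := a') (X := {c, b, a}) (by simp [af, ah, aa.ne']) (t := c) (s := b) (r := a) (by simp)
      (by simp) (by simp) hbc.ne' hca.ne hab.ne' hb'.2 hb'.1 aa.symm
    rcases dd_zero hcon (show dd G ({a', c, b, a} : Finset V) = 0 by omega) with am | am
    · simp at am
    · have : ({a', c, b, a} : Finset V).card ≤ 4 := card_le_four
      rw [am, card_univ] at this; omega
  obtain ⟨y, ya, yb, yc, yd⟩ := hex
  have hbc' := hbc.ne
  have hca' := hca.ne
  have hab' := hab.ne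
  have hay' := ya.ne
  refine not_ext_of_weight (G := G) (fun v => if v = a then -1 else if v = b ∨ v = c ∨ v = a' ∨ v = y then 1 else 0) ?_ ?_
    hbc ya af.symm yc.symm ah.symm yd.symm ?_ ?_ ?_ ?_ h
  · intro u v huv
    have ao : ∀ v, G.Adj a v → (if v = a then (-1 : ℤ) else if v = b ∨ v = c ∨ v = a' ∨ v = y then 1 else 0) = 1 := by
      intro v hv
      have := ag v hv
      have := hv.ne'
      simp only [this, if_false]
      rw [if_pos (by tauto)]
    by_cases hu : u = a
    · subst hu
      rw [ao v huv]; simp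
    by_cases hv : v = a
    · subst hv
      rw [ao u huv.symm]; simp
    simp only [hu, hv, if_false]
    split_ifs <;> simp
  · have ea : ∀ v, (if v = a then (-1:ℤ) else if v = b ∨ v = c ∨ v = a' ∨ v = y then 1 else 0) =
      (if v = b then 1 else 0) + (if v = c then 1 else 0) + (if v = a' then 1 else 0) + (if v = y then 1 else 0)
      - (if v = a then 1 else 0) := by
      intro v
      by_cases qg : v = a
      · subst qg; simp [*, hca'.symm, yb.symm]
      by_cases qf : v = b
      · subst qf; simp [*, af.symm, yc.symm]
      by_cases qh : v = c
      · subst qh; simp [*, ah.symm, yd.symm]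
      by_cases qi : v = a'
      · subst qi; simp [*]
      by_cases qj : v = y
      · subst qj; simp [*]
      simp [*]
    rw [sum_congr rfl (fun v _ => ea v)]
    simp only [sum_sub_distrib, sum_add_distrib]
    simp
  · simp [hab'.symm]
  · simp [hca']
  · simp [haa'.symm]
  · simp [yb]
lemma girth_of_tf (hcon : G.Connected) (hc : Cub G) (h : TF G) : 4 ≤ G.girth := by
  have hna : ¬ G.IsAcyclic := by
    intro ha
    have hT : G.IsTree := ⟨hcon, ha⟩
    have aa := hT.card_edgeFinset
    have af := G.sum_degrees_eq_twice_card_edges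
    have ah : ∑ v, G.degree v = ∑ v : V, 3 := sum_congr rfl fun v _ => by
      rw [← hc v, card_neighborFinset_eq_degree]
    rw [ah] at af
    simp at af
    omega
  obtain ⟨a, w, hw, hl⟩ := exists_girth_eq_length.2 hna
  by_contra hlt
  have ah := hw.three_le_length
  have h3' : w.length = 3 := by omega
  match w, h3' with
  | .cons p (.cons q (.cons r .nil)), _ => exact h _ _ _ p q r
lemma tf_of_girth (h : 4 ≤ G.girth) : TF G := by
  intro a b c hab hbc hca
  have hcyc : (Walk.cons hab (Walk.cons hbc (Walk.cons hca Walk.nil))).IsCycle := by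
    rw [Walk.cons_isCycle_iff]
    constructor
    · rw [Walk.cons_isPath_iff]
      constructor
      · rw [Walk.cons_isPath_iff]; simp [hca.ne]
      · simp [hbc.ne, hab.ne']
    · simp [hbc.ne, hca.ne, hab.ne', hab.ne, hca.ne']
  have := G.girth_le_length hcyc
  simp at this
  omega
end P4
section P4b
lemma circ_adj {m a b c : ℕ} {u v : ZMod m} : (circThree m a b c).Adj u v ↔ u ≠ v ∧
    ((u - v = a ∨ u - v = b ∨ u - v = c) ∨ (v - u = a ∨ v - u = b ∨ v - u = c)) := by
  simp [circThree, circulantGraph, fromRel_adj]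
set_option maxHeartbeats 1000000 in
lemma circ_not_ext {m k s : ℕ} (hm : m = 2 * k) (am : 0 < s) (hs : s + s < k) [Fintype (ZMod m)] (f : ℕ → ℤ)
    (hf : ∀ a < m, 0 ≤ f a + f (if a + s < m then a + s else a + s - m))
    (hg : ∀ a < m, f a + f (if a < k then a + k else a - k) = (if a = 0 then 2 else 0) + (if a = k then 2 else 0))
    (fj : f 0 = 1) (fa : f k = 1) (fd : f (k + s) = 1) (ff : f (m - s) = 1) :
    ¬ IsNExtendable (circThree m s (m - s) k) 2 := by
  haveI : NeZero m := ⟨by omega⟩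
  have hN : ∀ (a : ZMod m) (t : ℕ), t < m → (a + t).val = if a.val + t < m then a.val + t else a.val + t - m := by
    intro a t ht
    have := a.val_lt
    rw [ZMod.val_add, ZMod.val_natCast, Nat.mod_eq_of_lt ht]
    split_ifs with h
    · rw [Nat.mod_eq_of_lt h]
    · rw [Nat.mod_eq_sub_mod (by omega), Nat.mod_eq_of_lt (by omega)]
  have hm1 : ((m - s : ℕ) : ZMod m) = -s := by
    rw [Nat.cast_sub (by omega), ZMod.natCast_self]; simp
  have hE1 : ∀ a : ZMod m, 0 ≤ f a.val + f (a + s).val := by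
    intro a; rw [hN _ _ (by omega)]; exact hf _ a.val_lt
  have hE2 : ∀ a : ZMod m, f a.val + f (a + k).val = (if a.val = 0 then 2 else 0) + (if a.val = k then 2 else 0) := by
    intro a
    have := a.val_lt
    rw [hN _ _ (by omega), ← hg _ this]; congr 2; split_ifs <;> omega
  have hE2' : ∀ a : ZMod m, 0 ≤ f a.val + f (a + k).val := by
    intro a; rw [hE2]; split_ifs <;> omega
  have hv : ∀ t < m, (t : ZMod m).val = t := fun t ht => by rw [ZMod.val_natCast, Nat.mod_eq_of_lt ht]
  have hi : ∀ t < m, ∀ r < m, t ≠ r → (t : ZMod m) ≠ r := fun t ht r hr n e => n (by rw [← hv t ht, e, hv r hr])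
  have ib : 0 < m := by omega
  have ia : k < m := by omega
  have ic : k + s < m := by omega
  have ie : m - s < m := by omega
  refine not_ext_of_weight (fun a => f a.val) ?_ ?_ (a := ((m - s : ℕ) : ZMod m)) (b := (0 : ℕ))
    (c := (k : ZMod m)) (d := ((k + s : ℕ) : ZMod m)) ?_ ?_ (hi _ ie _ ia (by omega)) (hi _ ie _ ic (by omega))
    (hi _ ib _ ia (by omega)) (hi _ ib _ ic (by omega)) ?_ ?_ ?_ ?_
  · intro u v huv
    have key : ∀ u v : ZMod m, (u - v = s ∨ u - v = (m - s : ℕ) ∨ u - v = k) → 0 ≤ f u.val + f v.val := by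
      rintro u v (h | h | h)
      · rw [eq_add_of_sub_eq' h, add_comm]; exact hE1 v
      · rw [hm1] at h
        rw [show v = u + s by linear_combination -h]; exact hE1 u
      · rw [eq_add_of_sub_eq' h, add_comm]; exact hE2' v
    rcases (circ_adj.1 huv).2 with h | h
    · exact key u v h
    · show 0 ≤ f u.val + f v.val
      rw [add_comm]; exact key v u h
  · have ea : ∑ a : ZMod m, f (a + k).val = ∑ a : ZMod m, f a.val :=
      Equiv.sum_comp (Equiv.addRight (k : ZMod m)) (fun a => f a.val)
    have eb : ∑ a : ZMod m, (f a.val + f (a + k).val) = 4 := by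
      rw [sum_congr rfl (fun a _ => hE2 a), sum_add_distrib]
      have q : ∀ t < m, ∀ a : ZMod m, a.val = t ↔ a = t := fun t ht a =>
        ⟨fun e => by rw [← e, ZMod.natCast_zmod_val], fun e => by rw [e, hv t ht]⟩
      simp only [q 0 ib, q k ia]
      simp
    rw [sum_add_distrib, ea] at eb
    show ∑ a : ZMod m, f a.val < 4
    omega
  · exact circ_adj.2 ⟨hi _ ie _ ib (by omega), by simp⟩
  · exact circ_adj.2 ⟨hi _ ia _ ic (by omega), by simp⟩
  all_goals
    show f _ = 1
    rw [hv _ (by assumption)]; assumption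
lemma mobius_not_ext {n : ℕ} (hn : 2 ≤ n) [Fintype (ZMod (4 * n))] :
    ¬ IsNExtendable (circThree (4 * n) 1 (4 * n - 1) (2 * n)) 2 := by
  let f : ℕ → ℤ := fun v => if v = 2 * n then 1 else if v < 2 * n then (if v % 2 = 0 then 1 else -1)
    else (if v % 2 = 0 then -1 else 1)
  refine circ_not_ext (by omega) (by omega) (by omega) f ?_ ?_ ?_ ?_ ?_ ?_
  any_goals intro a ha
  all_goals simp only [f]; split_ifs <;> omega
set_option maxHeartbeats 1000000 in
lemma prism_not_ext {n : ℕ} (hn : 2 ≤ n) [Fintype (ZMod (4 * n + 2))] :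
    ¬ IsNExtendable (circThree (4 * n + 2) 2 (4 * n) (2 * n + 1)) 2 := by
  let f : ℕ → ℤ := fun v => if v = 2 * n + 1 then 1 else if v % 2 = 0 then (if v % 4 = 0 then 1 else -1)
    else if 2 * n + 1 < v then (if (v - (2 * n + 1)) % 4 = 0 then -1 else 1) else
      (if (v + (2 * n + 1)) % 4 = 0 then -1 else 1)
  refine circ_not_ext (m := 4 * n + 2) (s := 2) (by omega) (by omega) (by omega) f ?_ ?_ ?_ ?_ ?_ ?_
  any_goals intro a ha
  all_goals simp only [f]; split_ifs <;> omega
instance : DecidableRel (genPetersen 5 2).Adj := fun p q => by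
  unfold genPetersen; infer_instance
def petW : ZMod 5 ⊕ ZMod 5 → ℤ := fun v =>
  if v = Sum.inl 0 ∨ v = Sum.inl 2 ∨ v = Sum.inr 3 ∨ v = Sum.inr 4 then -1 else 1
set_option maxRecDepth 10000 in
lemma petersen_not_ext : ¬ IsNExtendable (genPetersen 5 2) 2 := by
  refine not_ext_of_weight petW ?_ ?_ (a := Sum.inl 3) (b := Sum.inl 4) (c := Sum.inl 1) (d := Sum.inr 1)
    ?_ ?_ ?_ ?_ ?_ ?_ ?_ ?_ ?_ ?_ <;> decide
end P4b

variable {V : Type*} [Fintype V] [DecidableEq V] {G : SimpleGraph V} [DecidableRel G.Adj]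

lemma iso_of_hom {W : Type*} [Nonempty W] {H : SimpleGraph W} (hcon : G.Connected)
    (hc : Cub G)
    (hH : ∀ w, ∃ p q r, p ≠ q ∧ p ≠ r ∧ q ≠ r ∧ H.Adj w p ∧ H.Adj w q ∧ H.Adj w r)
    (f : W → V) (hf : Function.Injective f) (hom : ∀ u v, H.Adj u v → G.Adj (f u) (f v)) :
    Nonempty (G ≃g H) := by
  have key : ∀ w v, G.Adj (f w) v → ∃ w', H.Adj w w' ∧ f w' = v := by
    intro w v hv
    obtain ⟨p, q, r, aa, af, ah, ag, aj, an⟩ := hH w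
    rcases nbr_all hc (hom _ _ ag) (hom _ _ aj) (hom _ _ an) (hf.ne aa) (hf.ne af) (hf.ne ah) hv with
      h | h | h
    · exact ⟨p, ag, h.symm⟩
    · exact ⟨q, aj, h.symm⟩
    · exact ⟨r, an, h.symm⟩
  have hsurj : Function.Surjective f := by
    have hw : ∀ {a b : V}, G.Walk a b → (∃ w, f w = a) → ∃ w, f w = b := by
      intro a b p
      induction p with
      | nil => exact id
      | cons hh _ ih =>
        rintro ⟨w, rfl⟩
        obtain ⟨w', -, h⟩ := key w _ hh
        exact ih ⟨w', h⟩
    intro v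
    obtain ⟨we⟩ := ‹Nonempty W›
    obtain ⟨p⟩ := hcon.preconnected (f we) v
    exact hw p ⟨we, rfl⟩
  let e : W ≃ V := Equiv.ofBijective f ⟨hf, hsurj⟩
  have : H ≃g G := ⟨e, by
    intro a b
    show G.Adj (f a) (f b) ↔ H.Adj a b
    constructor
    · intro h
      obtain ⟨w', aa, af⟩ := key a _ h
      rwa [hf af] at aa
    · exact hom a b⟩
  exact ⟨this.symm⟩
lemma avg (hvt : IsVertexTransitive G) {ι : Type*} (s : Finset ι) (c : ι → V) (x : V → ℤ) (K : ℤ)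
    (hK : ∀ φ : G ≃g G, K ≤ ∑ i ∈ s, x (φ (c i))) (hne : Nonempty V) :
    K * Fintype.card V ≤ s.card * ∑ v, x v := by
  classical
  haveI : Finite (G ≃g G) := Finite.of_injective (fun φ : G ≃g G => (φ : V → V)) DFunLike.coe_injective
  haveI : Fintype (G ≃g G) := Fintype.ofFinite _
  obtain ⟨va⟩ := hne
  set A := ∑ φ : G ≃g G, x (φ va) with hA
  have hconst : ∀ v, ∑ φ : G ≃g G, x (φ v) = A := by
    intro v
    obtain ⟨ψ, hψ⟩ := hvt va v
    have := Equiv.sum_comp (Equiv.mk (fun φ : G ≃g G => ψ.trans φ) (fun φ => ψ.symm.trans φ)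
      (by intro φ; ext; simp) (by intro φ; ext; simp)) (fun φ : G ≃g G => x (φ va))
    rw [hA, ← this]
    refine sum_congr rfl fun φ _ => ?_
    simp [hψ]
  have hN : (0 : ℤ) < Fintype.card (G ≃g G) := by
    have : Nonempty (G ≃g G) := ⟨RelIso.refl _⟩
    exact_mod_cast Fintype.card_pos
  have aa : (Fintype.card V : ℤ) * A = Fintype.card (G ≃g G) * ∑ v, x v := by
    have ea : ∑ v : V, ∑ φ : G ≃g G, x (φ v) = Fintype.card V * A := by
      rw [sum_congr rfl (fun v _ => hconst v)]; simp
    have eb : ∑ φ : G ≃g G, ∑ v : V, x (φ v) = Fintype.card (G ≃g G) * ∑ v, x v := by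
      have ee : ∀ φ : G ≃g G, ∑ v, x (φ v) = ∑ v, x v := fun φ => Equiv.sum_comp φ.toEquiv x
      simp only [ee]; simp
    rw [← ea, ← eb, sum_comm]
  have af : K * Fintype.card (G ≃g G) ≤ s.card * A := by
    have ea : ∑ i ∈ s, ∑ φ : G ≃g G, x (φ (c i)) = s.card * A := by
      rw [sum_congr rfl (fun i _ => hconst (c i))]; simp
    rw [← ea, sum_comm]
    have := card_nsmul_le_sum univ (fun φ : G ≃g G => ∑ i ∈ s, x (φ (c i))) K (fun φ _ => hK φ)
    simp at this; linarith
  have ah : (K * Fintype.card V) * Fintype.card (G ≃g G) ≤ (s.card * ∑ v, x v) * Fintype.card (G ≃g G) := by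
    have : (0 : ℤ) ≤ Fintype.card V := by positivity
    nlinarith
  exact le_of_mul_le_mul_right ah hN
lemma pigeon3 {α : Type*} {p q r a b c : α} (aa : p ≠ q) (af : p ≠ r) (ah : q ≠ r)
    (hp : p ≠ c → p = a ∨ p = b) (hq : q ≠ c → q = a ∨ q = b) (hr : r ≠ c → r = a ∨ r = b)
    (hp' : p ≠ a) (hq' : q ≠ a) (hr' : r ≠ a) : False := by
  by_cases ea : p = c
  · by_cases eb : q = c
    · exact aa (ea.trans eb.symm)
    · by_cases ec : r = c
      · exact af (ea.trans ec.symm)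
      · exact ah (((hq eb).resolve_left hq').trans ((hr ec).resolve_left hr').symm)
  · by_cases eb : q = c
    · by_cases ec : r = c
      · exact ah (eb.trans ec.symm)
      · exact af (((hp ea).resolve_left hp').trans ((hr ec).resolve_left hr').symm)
    · exact aa (((hp ea).resolve_left hp').trans ((hq eb).resolve_left hq').symm)
variable (G) in
def WK (u v : V) (m : ℕ) : Prop := ∃ p : G.Walk u v, p.length = m
lemma WK.trans {u v w : V} {m k : ℕ} (h : WK G u v m) (h' : WK G v w k) : WK G u w (m + k) := by
  obtain ⟨p, hp⟩ := h
  obtain ⟨q, hq⟩ := h'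
  exact ⟨p.append q, by rw [Walk.length_append, hp, hq]⟩
lemma WK.symm {u v : V} {m : ℕ} (h : WK G u v m) : WK G v u m := by
  obtain ⟨p, hp⟩ := h
  exact ⟨p.reverse, by simp [hp]⟩
lemma WK.adj {u v : V} (h : G.Adj u v) : WK G u v 1 := ⟨h.toWalk, by simp⟩
lemma WK.refl (u : V) : WK G u u 0 := ⟨.nil, rfl⟩
lemma exists_odd (hnb : ¬ G.Colorable 2) : ∃ (l : ℕ) (c : ℕ → V), Odd l ∧
    (∀ i, c (i + l) = c i) ∧ (∀ i, G.Adj (c i) (c (i + 1))) ∧ (∀ u m, WK G u u m → Odd m → l ≤ m) := by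
  classical
  rw [two_colorable_iff_forall_loop_even] at hnb
  push Not at hnb
  obtain ⟨u, w, hw⟩ := hnb
  have hex : ∃ l, Odd l ∧ ∃ u, WK G u u l := ⟨w.length, Nat.not_even_iff_odd.1 hw, u, w, rfl⟩
  obtain ⟨hl, u, p, hp⟩ := Nat.find_spec hex
  set l := Nat.find hex with hldef
  have hlpos : 0 < l := hl.pos
  refine ⟨l, fun i => p.getVert (i % l), hl, ?_, ?_, ?_⟩
  · intro i; simp
  · intro i
    have aa := Nat.mod_lt i hlpos
    have af := p.adj_getVert_succ (i := i % l) (by omega)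
    have ah : p.getVert ((i + 1) % l) = p.getVert (i % l + 1) := by
      rw [Nat.add_mod]
      by_cases hl1 : l = 1
      · have : p.getVert 1 = u := by rw [← hl1, ← hp, Walk.getVert_length]
        simp [hl1, Nat.mod_one, this]
      rw [Nat.mod_eq_of_lt (show 1 < l by omega)]
      rcases (show i % l + 1 ≤ l by omega).lt_or_eq with h | h
      · rw [Nat.mod_eq_of_lt h]
      · rw [h, Nat.mod_self, Walk.getVert_zero, ← hp, Walk.getVert_length]
    show G.Adj (p.getVert (i % l)) (p.getVert ((i + 1) % l))
    rw [ah]; exact af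
  · intro v m hv hm
    exact Nat.find_min' hex ⟨hm, v, hv⟩
lemma odd_sum {l : ℕ} (hl : Odd l) (y : ℕ → ℤ) (hp : y l = y 0) (hpm : ∀ i, y i = 1 ∨ y i = -1)
    (he : ∀ i, 0 ≤ y i + y (i + 1)) : 1 ≤ ∑ i ∈ range l, y i := by
  have aa : ∑ i ∈ range l, y (i + 1) = ∑ i ∈ range l, y i := by
    have ea := sum_range_succ y l
    have eb := sum_range_succ' y l
    rw [hp] at ea; linarith
  have af : 0 ≤ ∑ i ∈ range l, (y i + y (i + 1)) := sum_nonneg fun i _ => he i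
  rw [sum_add_distrib, aa] at af
  have ah : ∀ i, ∃ z : ℤ, y i = 1 - 2 * z := by
    intro i; rcases hpm i with h | h
    · exact ⟨0, by omega⟩
    · exact ⟨1, by omega⟩
  choose z hz using ah
  have ag : ∑ i ∈ range l, y i = l - 2 * ∑ i ∈ range l, z i := by
    rw [sum_congr rfl (fun i _ => hz i), sum_sub_distrib, mul_sum]; simp
  obtain ⟨k, hk⟩ := hl
  omega
set_option maxHeartbeats 1000000 in
lemma caseA_petersen (h : CVT G) (hnb : ¬ G.Colorable 2) (htf : TF G) (ag : F4 G) {x : V → ℤ}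
    (hA : CaseA G x) : Nonempty (G ≃g genPetersen 5 2) := by
  obtain ⟨l, c, hl, hper, hadj, hmin⟩ := exists_odd hnb
  have hl5 : 5 ≤ l := by
    by_contra hlt
    obtain ⟨k, hk⟩ := hl
    have : k = 0 ∨ k = 1 := by omega
    rcases this with rfl | rfl
    · have aa := hadj 0
      have af := hper 0
      rw [hk] at af; simp at af aa; rw [af] at aa; exact aa.ne rfl
    · have aa := hper 0
      have af := hadj 2
      rw [hk] at aa; simp at aa af
      rw [aa] at af
      exact htf _ _ _ (hadj 0) (hadj 1) af
  have hodd := Nat.odd_iff.1 hl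
  have hW : ∀ i d, WK G (c i) (c (i + d)) d := by
    intro i d
    induction d with
    | zero => exact WK.refl _
    | succ d ih => exact ih.trans (WK.adj (hadj (i + d)))
  have key : ∀ i d m, WK G (c i) (c (i + d)) m → d ≤ l →
      ((d + m) % 2 = 1 → l ≤ d + m) ∧ ((d + m) % 2 = 0 → d ≤ m) := by
    intro i d m hw hd
    constructor
    · intro ho
      exact hmin _ _ ((hW i d).trans hw.symm) (Nat.odd_iff.2 ho)
    · intro he
      have aa := hW (i + d) (l - d)
      rw [show i + d + (l - d) = i + l by omega, hper] at aa
      have := hmin _ _ (hw.trans aa) (Nat.odd_iff.2 (by omega))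
      omega
  have hmod : ∀ i, c i = c (i % l) := by
    intro i
    have : ∀ k j, c (j + l * k) = c j := by
      intro k; induction k with
      | zero => simp
      | succ k ih => intro j; rw [Nat.mul_succ, ← add_assoc, hper, ih]
    conv_lhs => rw [← Nat.mod_add_div i l]
    exact this _ _
  have hrep : ∀ i j, ∃ d < l, (i + d) % l = j % l := by
    intro i j
    refine ⟨(j + (l - 1) * i) % l, Nat.mod_lt _ (by omega), ?_⟩
    rw [Nat.add_mod_mod, show i + (j + (l - 1) * i) = j + l * i by
      obtain ⟨k, rfl⟩ : ∃ k, l = k + 1 := ⟨l - 1, by omega⟩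
      simp; ring]
    simp
  have hinj : ∀ i d, d < l → c i = c (i + d) → d = 0 := by
    intro i d hd he
    have := key i d 0 (by rw [← he]; exact WK.refl _) hd.le
    omega
  have hpred : ∀ i, G.Adj (c i) (c (i + (l - 1))) := by
    intro i
    have := hadj (i + (l - 1))
    rw [show i + (l - 1) + 1 = i + l by omega, hper] at this
    exact this.symm
  have hne1 : ∀ i, c (i + 1) ≠ c (i + (l - 1)) := by
    intro i he
    have := hinj (i + 1) (l - 2) (by omega) (by rw [he]; congr 1; omega)
    omega
  have hw := fun i => third h.cub (hadj i) (hpred i) (hne1 i)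
  choose we hw1 hw2 hw3 hw4 using hw
  set w : ℕ → V := fun i => we (i % l) with hwdef
  have hcm1 : ∀ i d, c (i % l + d) = c (i + d) := by
    intro i d; rw [hmod, hmod (i + d)]; congr 1; simp
  have hwa : ∀ i, G.Adj (c i) (w i) := by
    intro i; rw [hmod i]; exact hw1 _
  have hwn1 : ∀ i, w i ≠ c (i + 1) := by
    intro i; rw [← hcm1]; exact hw2 _
  have hwn2 : ∀ i, w i ≠ c (i + (l - 1)) := by
    intro i; rw [← hcm1]; exact hw3 _
  have hwall : ∀ i e, G.Adj (c i) e → e = c (i + 1) ∨ e = c (i + (l - 1)) ∨ e = w i := by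
    intro i e he
    rw [hmod i] at he
    have := hw4 (i % l) e he
    rwa [hcm1, hcm1] at this
  have hwper : ∀ i, w (i + l) = w i := by intro i; simp [hwdef]
  have hwmod : ∀ i j, i % l = j % l → w i = w j := by intro i j hij; simp only [hwdef, hij]
  have hcmod : ∀ i j, i % l = j % l → c i = c j := by intro i j hij; rw [hmod i, hmod j, hij]
  have hwC : ∀ i j, w i ≠ c j := by
    intro i j he
    obtain ⟨d, hd, hdj⟩ := hrep i j
    rw [← hcmod _ _ hdj] at he
    have := key i d 1 (WK.adj (he ▸ hwa i)) hd.le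
    have hd1 : d = 1 ∨ d = l - 1 ∨ d = 0 := by omega
    rcases hd1 with rfl | rfl | rfl
    · exact hwn1 i he
    · exact hwn2 i he
    · exact (hwa i).ne he.symm
  have hwinj : ∀ i d, d < l → w i = w (i + d) → d = 0 := by
    intro i d hd he
    have := key i d 2 ((WK.adj (hwa i)).trans (WK.adj (he ▸ (hwa (i + d)).symm))) hd.le
    have hd1 : d = 0 ∨ d = 2 ∨ d = l - 2 := by omega
    rcases hd1 with rfl | rfl | rfl
    · rfl
    · exfalso
      refine ag (c i) (c (i + 1)) (c (i + 2)) (w i) (hadj i) (hadj (i + 1)) (he ▸ hwa _) (hwa i).symm ?_ ?_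
      · intro h; have := hinj i 2 (by omega) h; omega
      · exact (hwC i _).symm
    · exfalso
      refine ag (c i) (c (i + (l - 1))) (c (i + (l - 2))) (w i) (hpred i) ?_ (he ▸ hwa _) (hwa i).symm ?_ ?_
      · have := hadj (i + (l - 2)); rw [show i + (l - 2) + 1 = i + (l - 1) by omega] at this; exact this.symm
      · intro h; have := hinj i _ (by omega) h; omega
      · exact (hwC i _).symm
  have hcinj' : ∀ i j, i < l → j < l → c i = c j → i = j := by
    intro i j hi hj he
    rcases le_total i j with hij | hij
    · have := hinj i (j - i) (by omega) (by rw [he]; congr 1; omega); omega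
    · have := hinj j (i - j) (by omega) (by rw [← he]; congr 1; omega); omega
  have hwinj' : ∀ i j, i < l → j < l → w i = w j → i = j := by
    intro i j hi hj he
    rcases le_total i j with hij | hij
    · have := hwinj i (j - i) (by omega) (by rw [he]; congr 1; omega); omega
    · have := hwinj j (i - j) (by omega) (by rw [← he]; congr 1; omega); omega
  have hn : Fintype.card V ≤ 2 * l := by
    have := avg h.vt (range l) c x 1 ?_ ⟨c 0⟩
    · rw [hA.sum] at this
      simp at this
      omega
    · intro φ
      apply odd_sum hl (fun i => x (φ (c i)))
      · have := hper 0; simp at this; simp [this]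
      · intro i; exact hA.pm _
      · intro i; exact hA.edge _ _ (φ.map_adj_iff.2 (hadj i))
  have hcov : ∀ v, (∃ i, v = c i) ∨ ∃ i, v = w i := by
    set Cs := (range l).image c
    set Ws := (range l).image w
    have ea : Cs.card = l := by
      rw [card_image_of_injOn, card_range]
      intro i hi j hj; simp at hi hj; exact hcinj' i j hi hj
    have eb : Ws.card = l := by
      rw [card_image_of_injOn, card_range]
      intro i hi j hj; simp at hi hj; exact hwinj' i j hi hj
    have ec : Disjoint Cs Ws := by
      rw [Finset.disjoint_left]
      intro v hv hv'
      simp only [Cs, Ws, mem_image] at hv hv'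
      obtain ⟨i, -, rfl⟩ := hv
      obtain ⟨j, -, he⟩ := hv'
      exact hwC _ _ he
    have ed := card_union_of_disjoint ec
    have ef : Cs ∪ Ws = univ := by
      apply eq_univ_of_card
      have := card_le_univ (Cs ∪ Ws)
      omega
    intro v
    have := mem_univ v
    rw [← ef, mem_union] at this
    simp only [Cs, Ws, mem_image] at this
    rcases this with ⟨i, -, rfl⟩ | ⟨i, -, rfl⟩
    · exact Or.inl ⟨i, rfl⟩
    · exact Or.inr ⟨i, rfl⟩
  have hww : ∀ i v, G.Adj (w i) v → v ≠ c i → v = w (i + 3) ∨ v = w (i + (l - 3)) := by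
    intro i v hv hvc
    rcases hcov v with ⟨j, rfl⟩ | ⟨j, rfl⟩
    · exfalso
      rcases hwall j _ hv.symm with aa | aa | aa
      · exact hwC _ _ aa
      · exact hwC _ _ aa
      · have := hwinj' (i % l) (j % l) (Nat.mod_lt _ (by omega)) (Nat.mod_lt _ (by omega))
          (by rw [hwmod (i % l) i (by simp), hwmod (j % l) j (by simp)]; exact aa)
        exact hvc (hcmod _ _ this.symm)
    · obtain ⟨d, hd, hdj⟩ := hrep i j
      rw [← hwmod _ _ hdj] at hv ⊢
      have := key i d 3 (((WK.adj (hwa i)).trans (WK.adj hv)).trans (WK.adj (hwa _).symm)) hd.le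
      have hd1 : d = 0 ∨ d = 1 ∨ d = l - 1 ∨ d = 3 ∨ d = l - 3 := by omega
      rcases hd1 with rfl | rfl | rfl | rfl | rfl
      · exact absurd rfl hv.ne
      · exact (ag (c i) (c (i + 1)) (w (i + 1)) (w i) (hadj i) (hwa _) hv.symm (hwa i).symm (hwC _ _).symm (hwC _ _).symm).elim
      · exact (ag (c i) (c (i + (l - 1))) (w (i + (l - 1))) (w i) (hpred i) (hwa _) hv.symm (hwa i).symm (hwC _ _).symm (hwC _ _).symm).elim
      · exact Or.inl rfl
      · exact Or.inr rfl
  have hw3 : ∀ i, G.Adj (w i) (w (i + 3)) := by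
    intro i
    obtain ⟨p, q, r, hp, hq, hr, hpq, hpr, hqr, hall⟩ := nbr3 h.cub (w i)
    by_contra hn
    have hp' := hww i p hp
    have hq' := hww i q hq
    have hr' := hww i r hr
    have hp'' : p ≠ w (i + 3) := fun e => hn (e ▸ hp)
    have hq'' : q ≠ w (i + 3) := fun e => hn (e ▸ hq)
    have hr'' : r ≠ w (i + 3) := fun e => hn (e ▸ hr)
    exact pigeon3 hpq hpr hqr hp' hq' hr' hp'' hq'' hr''
  have hl5' : l = 5 := by
    by_contra hne
    have aa := hw3 0
    have af := hw3 3
    have := key 0 6 4 ((((WK.adj (hwa 0)).trans (WK.adj aa)).trans (WK.adj af)).trans (WK.adj (hwa _).symm)) (by omega)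
    omega
  subst hl5'
  have za : ∀ i : ZMod 5, (i + 1).val % 5 = (i.val + 1) % 5 := by decide
  have zb : ∀ i : ZMod 5, (i.val) % 5 = ((i + 2).val + 3) % 5 := by decide
  have zlt : ∀ i : ZMod 5, i.val < 5 := fun i => i.val_lt
  refine iso_of_hom h.conn h.cub (H := genPetersen 5 2) ?_
    (fun v => Sum.elim (fun i : ZMod 5 => c i.val) (fun i : ZMod 5 => w i.val) v) ?_ ?_
  · rintro (i | i)
    · refine ⟨Sum.inl (i + 1), Sum.inl (i + 4), Sum.inr i, ?_⟩
      revert i; decide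
    · refine ⟨Sum.inr (i + 2), Sum.inr (i + 3), Sum.inl i, ?_⟩
      revert i; decide
  · rintro (i | i) (j | j) hij
    · simp at hij
      have := hcinj' _ _ (zlt i) (zlt j) hij
      rw [ZMod.val_injective 5 this]
    · exact absurd hij.symm (hwC _ _)
    · exact absurd hij (hwC _ _)
    · simp at hij
      have := hwinj' _ _ (zlt i) (zlt j) hij
      rw [ZMod.val_injective 5 this]
  · have hrel : ∀ p q, ((∃ i : ZMod 5, p = Sum.inl i ∧ q = Sum.inl (i + 1)) ∨
      (∃ i : ZMod 5, p = Sum.inl i ∧ q = Sum.inr i) ∨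
      (∃ i : ZMod 5, p = Sum.inr i ∧ q = Sum.inr (i + ((2 : ℕ) : ZMod 5)))) →
        G.Adj (Sum.elim (fun i : ZMod 5 => c i.val) (fun i : ZMod 5 => w i.val) p)
          (Sum.elim (fun i : ZMod 5 => c i.val) (fun i : ZMod 5 => w i.val) q) := by
      rintro p q (⟨i, rfl, rfl⟩ | ⟨i, rfl, rfl⟩ | ⟨i, rfl, rfl⟩)
      · simp only [Sum.elim_inl]
        rw [hcmod _ _ (za i)]; exact hadj _
      · exact hwa _
      · simp only [Sum.elim_inr]
        have := hw3 (i + 2).val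
        rw [← hwmod _ _ (zb i)] at this
        exact this.symm
    intro u v huv
    rw [genPetersen, fromRel_adj] at huv
    rcases huv.2 with aa | aa
    · exact hrel _ _ aa
    · exact (hrel _ _ aa).symm
lemma dd_le_list (L : List (V × ℕ)) (X : Finset V) (hX : X = (L.map Prod.fst).toFinset)
    (hL : ∀ p ∈ L, (G.neighborFinset p.1 \ X).card ≤ p.2) :
    dd G X ≤ (L.map Prod.snd).sum := by
  rw [dd_eq_sum]
  have key : ∀ M : List (V × ℕ), (∀ p ∈ M, (G.neighborFinset p.1 \ X).card ≤ p.2) →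
      ∑ u ∈ (M.map Prod.fst).toFinset, (G.neighborFinset u \ X).card ≤ (M.map Prod.snd).sum := by
    intro M
    induction M with
    | nil => simp
    | cons p M ih =>
      intro hM
      simp only [List.map_cons, List.toFinset_cons, List.sum_cons]
      have aa := hM p (by simp)
      have af := ih (fun q hq => hM q (by simp [hq]))
      by_cases hp : p.1 ∈ (M.map Prod.fst).toFinset
      · rw [insert_eq_of_mem hp]; omega
      · rw [sum_insert hp]; omega
  have := key L hL
  rw [← hX] at this
  exact this
lemma card_le_list (L : List (V × ℕ)) : ((L.map Prod.fst).toFinset).card ≤ L.length := by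
  have := List.toFinset_card_le (L.map Prod.fst)
  simpa using this
lemma out0 {X : Finset V} {v a b c : V} (hv : ∀ e, G.Adj v e ↔ e = a ∨ e = b ∨ e = c)
    (ha : a ∈ X) (hb : b ∈ X) (hc : c ∈ X) : (G.neighborFinset v \ X).card ≤ 0 := by
  rw [Nat.le_zero, card_eq_zero, sdiff_eq_empty_iff_subset]
  intro e he
  rw [mem_neighborFinset, hv] at he
  rcases he with rfl | rfl | rfl <;> assumption
lemma out1 {X : Finset V} {v a b c : V} (hv : ∀ e, G.Adj v e ↔ e = a ∨ e = b ∨ e = c)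
    (ha : a ∈ X) (hb : b ∈ X) : (G.neighborFinset v \ X).card ≤ 1 := by
  have : G.neighborFinset v \ X ⊆ {c} := by
    intro e he
    rw [mem_sdiff, mem_neighborFinset, hv] at he
    obtain ⟨rfl | rfl | rfl, h⟩ := he
    · exact absurd ha h
    · exact absurd hb h
    · simp
  simpa using card_le_card this
lemma nbr_iff (hc : Cub G) {a b c : V} (hab : G.Adj a b)
    (hac : G.Adj a c) (hbc : b ≠ c) : ∃ d, d ≠ b ∧ d ≠ c ∧ ∀ e, G.Adj a e ↔ e = b ∨ e = c ∨ e = d := by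
  obtain ⟨d, aa, af, ah, ag⟩ := third hc hab hac hbc
  refine ⟨d, af, ah, fun e => ⟨ag e, ?_⟩⟩
  rintro (rfl | rfl | rfl) <;> assumption
lemma nbr_iff3 (hc : Cub G) {a b c d : V} (hab : G.Adj a b)
    (hac : G.Adj a c) (had : G.Adj a d) (aa : b ≠ c) (af : b ≠ d) (ah : c ≠ d) :
    ∀ e, G.Adj a e ↔ e = b ∨ e = c ∨ e = d := by
  refine fun e => ⟨fun he => nbr_all hc hab hac had aa af ah he, ?_⟩
  rintro (rfl | rfl | rfl) <;> assumption
lemma small3 (h : CVT G) (htf : TF G) (heven : Even (Fintype.card V)) {X : Finset V} (hX : dd G X ≤ 3) {u v : V} (hu : u ∈ X)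
    (hv : v ∈ X) (huv : u ≠ v) (hc : X.card ≤ 10) : Fintype.card V ≤ 10 := by
  have aa := one_lt_card.2 ⟨u, hu, v, hv, huv⟩
  have := cut3 h htf X (by omega)
  have := card_compl_add_card X
  obtain ⟨k, hk⟩ := heven
  omega
lemma small4 (h : CVT G) (htf : TF G) (ag : F4 G) (heven : Even (Fintype.card V)) {X : Finset V}
    (hX : dd G X ≤ 4) {u v w : V} (hu : u ∈ X) (hv : v ∈ X) (hw : w ∈ X)
    (huv : u ≠ v) (huw : u ≠ w) (hvw : v ≠ w) (hc : X.card ≤ 10) : Fintype.card V ≤ 10 ∨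
    ∃ y z, G.Adj y z ∧ ∀ e, e ∉ X ↔ e = y ∨ e = z := by
  have aa := two_lt_card.2 ⟨u, hu, v, hv, w, hw, huv, huw, hvw⟩
  have af := cut4 h htf ag X (by omega)
  have ah := card_compl_add_card X
  by_cases hn : Fintype.card V ≤ 10
  · exact Or.inl hn
  right
  obtain ⟨k, hk⟩ := heven
  have aj : Xᶜ.card = 2 := by omega
  obtain ⟨y, z, hyz, hc2⟩ := card_eq_two.1 aj
  refine ⟨y, z, ?_, ?_⟩
  · by_contra hn
    have an := dd_insert h.cub (show y ∉ ({z} : Finset V) by simpa using hyz)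
    rw [← hc2, dd_singleton h.cub, dd_compl] at an
    have : (G.neighborFinset y ∩ {z}).card = 0 := by
      rw [card_eq_zero]; ext e; simp; rintro h rfl; exact hn h
    omega
  · intro e; rw [← mem_compl, hc2]; simp
variable (G) in
def Th (v p q : V) : Prop := G.Adj v p ∧ G.Adj v q ∧ p ≠ q ∧
  ∀ s, G.Adj p s → s ≠ v → ∃ t, G.Adj q t ∧ t ≠ v ∧ G.Adj s t
variable (G) in
structure TD (v u w vb uc ud wc wd ai ak bb ba : V) : Prop where
  nv : ∀ e, G.Adj v e ↔ e = u ∨ e = w ∨ e = vb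
  nu : ∀ e, G.Adj u e ↔ e = v ∨ e = uc ∨ e = ud
  nw : ∀ e, G.Adj w e ↔ e = v ∨ e = wc ∨ e = wd
  nu1 : ∀ e, G.Adj uc e ↔ e = u ∨ e = wc ∨ e = ai
  nu2 : ∀ e, G.Adj ud e ↔ e = u ∨ e = wd ∨ e = ak
  nw1 : ∀ e, G.Adj wc e ↔ e = w ∨ e = uc ∨ e = bb
  nw2 : ∀ e, G.Adj wd e ↔ e = w ∨ e = ud ∨ e = ba
  uw : u ≠ w
  uv1 : u ≠ vb
  wv1 : w ≠ vb
  vu1 : v ≠ uc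
  vu2 : v ≠ ud
  u12 : uc ≠ ud
  vw1 : v ≠ wc
  vw2 : v ≠ wd
  w12 : wc ≠ wd
  uw1 : u ≠ wc
  ua1 : u ≠ ai
  wa1 : wc ≠ ai
  uw2 : u ≠ wd
  ua2 : u ≠ ak
  wa2 : wd ≠ ak
  wu1 : w ≠ uc
  wb1 : w ≠ bb
  ub1 : uc ≠ bb
  wu2 : w ≠ ud
  wb2 : w ≠ ba
  ub2 : ud ≠ ba
lemma TD.swap12 {v u w vb uc ud wc wd ai ak bb ba : V} (D : TD G v u w vb uc ud wc wd ai ak bb ba) :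
    TD G v u w vb ud uc wd wc ak ai ba bb where
  nv := D.nv
  nu := fun e => by rw [D.nu, or_comm (b := e = ud)]
  nw := fun e => by rw [D.nw, or_comm (b := e = wd)]
  nu1 := D.nu2
  nu2 := D.nu1
  nw1 := D.nw2
  nw2 := D.nw1
  uw := D.uw
  uv1 := D.uv1
  wv1 := D.wv1
  vu1 := D.vu2
  vu2 := D.vu1
  u12 := D.u12.symm
  vw1 := D.vw2
  vw2 := D.vw1
  w12 := D.w12.symm
  uw1 := D.uw2
  ua1 := D.ua2
  wa1 := D.wa2
  uw2 := D.uw1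
  ua2 := D.ua1
  wa2 := D.wa1
  wu1 := D.wu2
  wb1 := D.wb2
  ub1 := D.ub2
  wu2 := D.wu1
  wb2 := D.wb1
  ub2 := D.ub1
lemma TD.swapUW {v u w vb uc ud wc wd ai ak bb ba : V} (D : TD G v u w vb uc ud wc wd ai ak bb ba) :
    TD G v w u vb wc wd uc ud bb ba ai ak where
  nv := fun e => by rw [D.nv, or_left_comm]
  nu := D.nw
  nw := D.nu
  nu1 := D.nw1
  nu2 := D.nw2
  nw1 := D.nu1
  nw2 := D.nu2
  uw := D.uw.symm
  uv1 := D.wv1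
  wv1 := D.uv1
  vu1 := D.vw1
  vu2 := D.vw2
  u12 := D.w12
  vw1 := D.vu1
  vw2 := D.vu2
  w12 := D.u12
  uw1 := D.wu1
  ua1 := D.wb1
  wa1 := D.ub1
  uw2 := D.wu2
  ua2 := D.wb2
  wa2 := D.ub2
  wu1 := D.uw1
  wb1 := D.ua1
  ub1 := D.wa1
  wu2 := D.uw2
  wb2 := D.ua2
  ub2 := D.wa2
lemma Th.expand (h : CVT G) (htf : TF G) (ag : F4 G) {v u w : V} (hT : Th G v u w) :
    ∃ vb uc ud wc wd ai ak bb ba, TD G v u w vb uc ud wc wd ai ak bb ba := by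
  obtain ⟨hvu, hvw, huw, hT⟩ := hT
  obtain ⟨vb, aa, af, nv⟩ := nbr_iff h.cub hvu hvw huw
  obtain ⟨uc, hu1, hu1v, -⟩ := third h.cub hvu.symm hvu.symm |> fun _ => (by
    obtain ⟨b, c, d, hb, hc, hd, hbc, hbd, hcd, hall⟩ := nbr3 h.cub u
    by_cases e : b = v
    · exact ⟨c, hc, fun e' => hbc (e.trans e'.symm), trivial⟩
    · exact ⟨b, hb, e, trivial⟩ : ∃ uc, G.Adj u uc ∧ uc ≠ v ∧ True)
  obtain ⟨ud, hu2v, hu21, nu⟩ := nbr_iff h.cub hvu.symm hu1 hu1v.symm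
  have hu2 : G.Adj u ud := by simp [nu]
  obtain ⟨wc, hw1, hw1v, huw1⟩ := hT uc hu1 hu1v
  obtain ⟨wd, hw2, hw2v, huw2⟩ := hT ud hu2 hu2v
  have hw12 : wc ≠ wd := by
    rintro rfl
    exact ag u uc wc ud hu1 huw1 huw2.symm hu2.symm (by rintro rfl; exact htf _ _ _ hvw hw1 hvu.symm) hu21.symm
  have nw := nbr_iff3 h.cub hvw.symm hw1 hw2 hw1v.symm hw2v.symm hw12
  have ea : u ≠ wc := by rintro rfl; exact htf _ _ _ hvw hw1 hvu.symm
  have eb : u ≠ wd := by rintro rfl; exact htf _ _ _ hvw hw2 hvu.symm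
  have ec : w ≠ uc := by rintro rfl; exact htf _ _ _ hvu hu1 hvw.symm
  have ed : w ≠ ud := by rintro rfl; exact htf _ _ _ hvu hu2 hvw.symm
  obtain ⟨ai, ha1, ha1', nu1⟩ := nbr_iff h.cub hu1.symm huw1 ea
  obtain ⟨ak, ha2, ha2', nu2⟩ := nbr_iff h.cub hu2.symm huw2 eb
  obtain ⟨bb, hb1, hb1', nw1⟩ := nbr_iff h.cub hw1.symm huw1.symm ec
  obtain ⟨ba, hb2, hb2', nw2⟩ := nbr_iff h.cub hw2.symm huw2.symm ed
  exact ⟨vb, uc, ud, wc, wd, ai, ak, bb, ba, nv, nu, nw, nu1, nu2, nw1, nw2, huw, aa.symm, af.symm,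
    hu1v.symm, hu2v.symm, hu21.symm, hw1v.symm, hw2v.symm, hw12, ea, ha1.symm, ha1'.symm, eb,
    ha2.symm, ha2'.symm, ec, hb1.symm, hb1'.symm, ed, hb2.symm, hb2'.symm⟩
lemma TD.th {v u w vb uc ud wc wd ai ak bb ba : V} (D : TD G v u w vb uc ud wc wd ai ak bb ba) :
    Th G v w u := by
  refine ⟨by simp [D.nv], by simp [D.nv], D.uw.symm, ?_⟩
  intro s hs hsv
  rcases (D.nw s).1 hs with rfl | rfl | rfl
  · exact absurd rfl hsv
  · exact ⟨uc, by simp [D.nu], D.vu1.symm, by simp [D.nw1]⟩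
  · exact ⟨ud, by simp [D.nu], D.vu2.symm, by simp [D.nw2]⟩
lemma Th.symm (h : CVT G) (htf : TF G) (ag : F4 G) {v u w : V} (hT : Th G v u w) : Th G v w u := by
  obtain ⟨vb, uc, ud, wc, wd, ai, ak, bb, ba, D⟩ := hT.expand h htf ag
  exact D.th
lemma TD.lemA1 {v u w vb uc ud wc wd ai ak bb ba : V} (D : TD G v u w vb uc ud wc wd ai ak bb ba)
    (h : CVT G) (htf : TF G) (ag : F4 G) (hT : Th G u v uc) : G.Adj vb ai := by
  obtain ⟨t, aa, af, ah⟩ := hT.2.2.2 vb (by simp [D.nv]) D.uv1.symm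
  rcases (D.nu1 t).1 aa with rfl | rfl | rfl
  · exact absurd rfl af
  · exact (ag v vb t w (by simp [D.nv]) ah (by simp [D.nw1]) (by simp [D.nw]) D.vw1 D.wv1.symm).elim
  · exact ah
lemma TD.lemA2 {v u w vb uc ud wc wd ai ak bb ba : V} (D : TD G v u w vb uc ud wc wd ai ak bb ba)
    (h : CVT G) (htf : TF G) (ag : F4 G) (heven : Even (Fintype.card V)) (hT : Th G u uc ud) :
    Fintype.card V ≤ 10 := by
  have huu1 : G.Adj u uc := by simp [D.nu]
  have huu2 : G.Adj u ud := by simp [D.nu]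
  have h1a1 : G.Adj uc ai := by simp [D.nu1]
  have h2a2 : G.Adj ud ak := by simp [D.nu2]
  have h11 : G.Adj uc wc := by simp [D.nu1]
  have hw2w : G.Adj wd w := by simp [D.nw2]
  have hww1 : G.Adj w wc := by simp [D.nw]
  have aa : G.Adj wc ak := by
    obtain ⟨t, aa, af, ah⟩ := hT.2.2.2 wc h11 D.uw1.symm
    rcases (D.nu2 t).1 aa with rfl | rfl | rfl
    · exact absurd rfl af
    · exact (htf _ _ _ ah hw2w hww1).elim
    · exact ah
  have af : G.Adj ai wd := by
    obtain ⟨t, aj, af, ah⟩ := hT.2.2.2 ai h1a1 D.ua1.symm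
    rcases (D.nu2 t).1 aj with rfl | rfl | rfl
    · exact absurd rfl af
    · exact ah
    · exact (ag uc ai t wc h1a1 ah aa.symm h11.symm (by rintro rfl; exact htf _ _ _ huu1 h2a2.symm huu2.symm) D.wa1.symm).elim
  have hn1 : uc ≠ wd := by rintro rfl; exact htf _ _ _ h11 hww1.symm hw2w.symm
  have hn2 : ud ≠ wc := by rintro rfl; exact htf _ _ _ hww1 (by simp [D.nu2] : G.Adj ud wd) hw2w
  obtain ⟨p, -, -, na1⟩ := nbr_iff h.cub h1a1.symm af hn1
  obtain ⟨q, -, -, na2⟩ := nbr_iff h.cub h2a2.symm aa.symm hn2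
  set L : List (V × ℕ) := [(v,1),(u,0),(w,0),(uc,0),(ud,0),(wc,0),(wd,0),(ai,1),(ak,1)] with hL
  set X := (L.map Prod.fst).toFinset with hX
  have hb1 : ak = bb := by
    rcases (D.nw1 ak).1 aa with rfl | rfl | rfl
    · exact (htf _ _ _ h2a2 hw2w.symm (by simp [D.nw2])).elim
    · exact (htf _ _ _ huu1 h2a2.symm huu2.symm).elim
    · rfl
  have hb2 : ai = ba := by
    rcases (D.nw2 ai).1 af.symm with rfl | rfl | rfl
    · exact (htf _ _ _ h1a1 hww1 h11.symm).elim
    · exact (htf _ _ _ huu1 h1a1 huu2.symm).elim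
    · rfl
  have hd := dd_le_list (G := G) L X hX (by
    simp only [hL, List.forall_mem_cons, List.not_mem_nil, false_imp_iff, implies_true, and_true]
    refine ⟨out1 D.nv ?_ ?_, out0 D.nu ?_ ?_ ?_, out0 D.nw ?_ ?_ ?_, out0 D.nu1 ?_ ?_ ?_, out0 D.nu2 ?_ ?_ ?_,
      out0 D.nw1 ?_ ?_ ?_, out0 D.nw2 ?_ ?_ ?_, out1 na1 ?_ ?_, out1 na2 ?_ ?_⟩ <;> simp [hX, hL, hb1, hb2])
  exact small3 h htf heven hd (u := v) (v := u) (by simp [hX, hL]) (by simp [hX, hL])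
    (by rintro rfl; simpa using D.nv v) ((card_le_list L).trans (by simp [hL]))
lemma TD.lemA {v u w vb uc ud wc wd ai ak bb ba : V} (D : TD G v u w vb uc ud wc wd ai ak bb ba)
    (h : CVT G) (htf : TF G) (ag : F4 G) (heven : Even (Fintype.card V)) (hT : ∀ v, ∃ p q, Th G v p q) :
    Fintype.card V ≤ 10 ∨ G.Adj vb ai ∨ G.Adj vb ak := by
  obtain ⟨p, q, hpq⟩ := hT u
  have hp := (D.nu p).1 hpq.1
  have hq := (D.nu q).1 hpq.2.1
  have hne := hpq.2.2.1
  have hpq' := hpq.symm h htf ag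
  rcases hp with rfl | rfl | rfl <;> rcases hq with rfl | rfl | rfl
  · exact absurd rfl hne
  · exact Or.inr (Or.inl (D.lemA1 h htf ag hpq))
  · exact Or.inr (Or.inr (D.swap12.lemA1 h htf ag hpq))
  · exact Or.inr (Or.inl (D.lemA1 h htf ag hpq'))
  · exact absurd rfl hne
  · exact Or.inl (D.lemA2 h htf ag heven hpq)
  · exact Or.inr (Or.inr (D.swap12.lemA1 h htf ag hpq'))
  · exact Or.inl (D.lemA2 h htf ag heven hpq')
  · exact absurd rfl hne
lemma pig2 {α : Type*} {p q b y z : α} (aa : p = y ∨ p = z) (af : q = y ∨ q = z) (ah : b = y ∨ b = z)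
    (nc : p ≠ q) (nd : p ≠ b) : b = q := by
  rcases aa with rfl | rfl <;> rcases af with rfl | rfl <;> rcases ah with rfl | rfl <;>
    first | rfl | exact absurd rfl nc | exact absurd rfl nd
lemma TD.facts {v u w vb uc ud wc wd ai ak bb ba : V} (D : TD G v u w vb uc ud wc wd ai ak bb ba)
    (htf : TF G) (ag : F4 G) :
    ai ≠ v ∧ ai ≠ ud ∧ ai ≠ w ∧ ai ≠ wd ∧ ai ≠ ak ∧ vb ≠ uc ∧ vb ≠ ud ∧ ai ≠ vb ∧ uc ≠ wd ∧ ai ≠ bb ∧ ai ≠ uc := by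
  have hvu : G.Adj v u := by simp [D.nv]
  have hvw : G.Adj v w := by simp [D.nv]
  have hvv1 : G.Adj v vb := by simp [D.nv]
  have huu1 : G.Adj u uc := by simp [D.nu]
  have huu2 : G.Adj u ud := by simp [D.nu]
  have hww1 : G.Adj w wc := by simp [D.nw]
  have hww2 : G.Adj w wd := by simp [D.nw]
  have h11 : G.Adj uc wc := by simp [D.nu1]
  have h22 : G.Adj ud wd := by simp [D.nu2]
  have h1a1 : G.Adj uc ai := by simp [D.nu1]
  have h2a2 : G.Adj ud ak := by simp [D.nu2]
  have h1b1 : G.Adj wc bb := by simp [D.nw1]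
  refine ⟨?_, ?_, ?_, ?_, ?_, ?_, ?_, ?_, ?_, ?_, ?_⟩
  · rintro rfl; exact htf _ _ _ h1a1 hvu huu1
  · rintro rfl; exact htf _ _ _ huu1 h1a1 huu2.symm
  · rintro rfl; exact htf _ _ _ h1a1 hww1 h11.symm
  · rintro rfl; exact ag _ _ _ _ huu1 h1a1 h22.symm huu2.symm D.uw2 D.u12
  · rintro rfl; exact ag _ _ _ _ huu1 h1a1 h2a2.symm huu2.symm D.ua1 D.u12
  · rintro rfl; exact htf _ _ _ hvu huu1 hvv1.symm
  · rintro rfl; exact htf _ _ _ hvu huu2 hvv1.symm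
  · rintro rfl; exact ag _ _ _ _ hvu huu1 h1a1 hvv1.symm D.vu1 D.uv1
  · rintro rfl; exact htf _ _ _ hww1 h11.symm hww2.symm
  · rintro rfl; exact htf _ _ _ h11 h1b1 h1a1.symm
  · rintro rfl; exact h1a1.ne rfl
lemma TD.lemB1 {v u w vb uc ud wc wd ai ak bb ba : V} (D : TD G v u w vb uc ud wc wd ai ak bb ba)
    (h : CVT G) (htf : TF G) (ag : F4 G) (heven : Even (Fintype.card V)) (ha : G.Adj vb ai) (hb : G.Adj vb bb) :
    Fintype.card V ≤ 10 := by
  obtain ⟨fa, fd, ff, fc, fe, fb, fh, fi, fg, f10, f11⟩ := D.facts htf ag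
  obtain ⟨gb, gc, gd, gf, gg, ga, gh, gi, gj, g10, g11⟩ := D.swapUW.facts htf ag
  have hvv1 : G.Adj v vb := by simp [D.nv]
  have h1a1 : G.Adj uc ai := by simp [D.nu1]
  have h1b1 : G.Adj wc bb := by simp [D.nw1]
  have h2a2 : G.Adj ud ak := by simp [D.nu2]
  have h2b2 : G.Adj wd ba := by simp [D.nw2]
  have h22 : G.Adj ud wd := by simp [D.nu2]
  have hvu : G.Adj v u := by simp [D.nv]
  have hvw : G.Adj v w := by simp [D.nv]
  have nv1 := nbr_iff3 h.cub hvv1.symm ha hb fa.symm gb.symm f10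
  obtain ⟨p, -, -, na1⟩ := nbr_iff h.cub h1a1.symm ha.symm fb.symm
  obtain ⟨q, -, -, nb1⟩ := nbr_iff h.cub h1b1.symm hb.symm ga.symm
  set L : List (V × ℕ) := [(v,0),(u,0),(w,0),(uc,0),(ud,1),(wc,0),(wd,1),(vb,0),(ai,1),(bb,1)] with hL
  set X := (L.map Prod.fst).toFinset with hX
  have hd := dd_le_list (G := G) L X hX (by
    simp only [hL, List.forall_mem_cons, List.not_mem_nil, false_imp_iff, implies_true, and_true]
    refine ⟨out0 D.nv ?_ ?_ ?_, out0 D.nu ?_ ?_ ?_, out0 D.nw ?_ ?_ ?_, out0 D.nu1 ?_ ?_ ?_, out1 D.nu2 ?_ ?_,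
      out0 D.nw1 ?_ ?_ ?_, out1 D.nw2 ?_ ?_, out0 nv1 ?_ ?_ ?_, out1 na1 ?_ ?_, out1 nb1 ?_ ?_⟩ <;> simp [hX, hL])
  by_cases hA : ak ∈ X
  · set L' : List (V × ℕ) := [(v,0),(u,0),(w,0),(uc,0),(ud,0),(wc,0),(wd,1),(vb,0),(ai,1),(bb,1)] with hL'
    have hd := dd_le_list (G := G) L' X (by simp [hX, hL, hL']) (by
      simp only [hL', List.forall_mem_cons, List.not_mem_nil, false_imp_iff, implies_true, and_true]
      refine ⟨out0 D.nv ?_ ?_ ?_, out0 D.nu ?_ ?_ ?_, out0 D.nw ?_ ?_ ?_, out0 D.nu1 ?_ ?_ ?_, out0 D.nu2 ?_ ?_ hA,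
        out0 D.nw1 ?_ ?_ ?_, out1 D.nw2 ?_ ?_, out0 nv1 ?_ ?_ ?_, out1 na1 ?_ ?_, out1 nb1 ?_ ?_⟩ <;> simp [hX, hL])
    exact small3 h htf heven hd (u := v) (v := u) (by simp [hX, hL]) (by simp [hX, hL])
      hvu.ne ((card_le_list L).trans (by simp [hL]))
  by_cases hB : ba ∈ X
  · set L' : List (V × ℕ) := [(v,0),(u,0),(w,0),(uc,0),(ud,1),(wc,0),(wd,0),(vb,0),(ai,1),(bb,1)] with hL'
    have hd := dd_le_list (G := G) L' X (by simp [hX, hL, hL']) (by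
      simp only [hL', List.forall_mem_cons, List.not_mem_nil, false_imp_iff, implies_true, and_true]
      refine ⟨out0 D.nv ?_ ?_ ?_, out0 D.nu ?_ ?_ ?_, out0 D.nw ?_ ?_ ?_, out0 D.nu1 ?_ ?_ ?_, out1 D.nu2 ?_ ?_,
        out0 D.nw1 ?_ ?_ ?_, out0 D.nw2 ?_ ?_ hB, out0 nv1 ?_ ?_ ?_, out1 na1 ?_ ?_, out1 nb1 ?_ ?_⟩ <;> simp [hX, hL])
    exact small3 h htf heven hd (u := v) (v := u) (by simp [hX, hL]) (by simp [hX, hL])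
      hvu.ne ((card_le_list L).trans (by simp [hL]))
  rcases small4 h htf ag heven hd (u := v) (v := u) (w := w) (by simp [hX, hL]) (by simp [hX, hL])
    (by simp [hX, hL]) hvu.ne hvw.ne D.uw ((card_le_list L).trans (by simp [hL])) with hh | ⟨y, z, hyz, hc⟩
  · exact hh
  exfalso
  have hu2X : ud ∈ X := by simp [hX, hL]
  have hw2X : wd ∈ X := by simp [hX, hL]
  have ea : ud ≠ ba := fun e => hB (e ▸ hu2X)
  have eb : ak ≠ wd := fun e => hA (e ▸ hw2X)
  rcases (hc _).1 hA with rfl | rfl <;> rcases (hc _).1 hB with rfl | rfl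
  · exact htf _ _ _ h2a2 h2b2.symm h22.symm
  · exact ag _ _ _ _ h2a2 hyz h2b2.symm h22.symm ea eb
  · exact ag _ _ _ _ h2a2 hyz.symm h2b2.symm h22.symm ea eb
  · exact htf _ _ _ h2a2 h2b2.symm h22.symm
set_option maxHeartbeats 1000000 in
lemma TD.lemB2 {v u w vb uc ud wc wd ai ak bb ba : V} (D : TD G v u w vb uc ud wc wd ai ak bb ba)
    (h : CVT G) (htf : TF G) (ag : F4 G) (heven : Even (Fintype.card V)) (hT : ∀ v, ∃ p q, Th G v p q)
    (ha : G.Adj vb ai) (hb : G.Adj vb ba) :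
    Fintype.card V ≤ 10 := by
  obtain ⟨fa, fd, ff, fc, fe, fb, fh, fi, fg, f10, f11⟩ := D.facts htf ag
  obtain ⟨gb, gc, gd, gf, gg, ga, gh, gi, gj, g10, g11⟩ := D.swap12.swapUW.facts htf ag
  have hvv1 : G.Adj v vb := by simp [D.nv]
  have h1a1 : G.Adj uc ai := by simp [D.nu1]
  have h1b1 : G.Adj wc bb := by simp [D.nw1]
  have h2a2 : G.Adj ud ak := by simp [D.nu2]
  have h2b2 : G.Adj wd ba := by simp [D.nw2]
  have h22 : G.Adj ud wd := by simp [D.nu2]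
  have h11 : G.Adj uc wc := by simp [D.nu1]
  have hvu : G.Adj v u := by simp [D.nv]
  have hvw : G.Adj v w := by simp [D.nv]
  have huu1 : G.Adj u uc := by simp [D.nu]
  have huu2 : G.Adj u ud := by simp [D.nu]
  have hww1 : G.Adj w wc := by simp [D.nw]
  have hww2 : G.Adj w wd := by simp [D.nw]
  by_cases hab : ai = ba
  · have na1 := nbr_iff3 h.cub h1a1.symm ha.symm (hab ▸ h2b2.symm) fb.symm fg ga
    obtain ⟨p, -, -, nv1⟩ := nbr_iff h.cub hvv1.symm ha fa.symm
    set L : List (V × ℕ) := [(v,0),(u,0),(w,0),(uc,0),(ud,1),(wc,1),(wd,0),(vb,1),(ai,0)] with hL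
    set X := (L.map Prod.fst).toFinset with hX
    have hd := dd_le_list (G := G) L X hX (by
      simp only [hL, List.forall_mem_cons, List.not_mem_nil, false_imp_iff, implies_true, and_true]
      refine ⟨out0 D.nv ?_ ?_ ?_, out0 D.nu ?_ ?_ ?_, out0 D.nw ?_ ?_ ?_, out0 D.nu1 ?_ ?_ ?_, out1 D.nu2 ?_ ?_,
        out1 D.nw1 ?_ ?_, out0 D.nw2 ?_ ?_ ?_, out1 nv1 ?_ ?_, out0 na1 ?_ ?_ ?_⟩ <;> simp [hX, hL, hab])
    exact small3 h htf heven hd (u := v) (v := u) (by simp [hX, hL]) (by simp [hX, hL])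
      hvu.ne ((card_le_list L).trans (by simp [hL]))
  have nv1 := nbr_iff3 h.cub hvv1.symm ha hb fa.symm gb.symm hab
  obtain ⟨p, hp1, hp2, na1⟩ := nbr_iff h.cub h1a1.symm ha.symm fb.symm
  obtain ⟨q, hq1, hq2, nb2⟩ := nbr_iff h.cub h2b2.symm hb.symm ga.symm
  set L : List (V × ℕ) := [(v,0),(u,0),(w,0),(uc,0),(ud,1),(wc,1),(wd,0),(vb,0),(ai,1),(ba,1)] with hL
  set X := (L.map Prod.fst).toFinset with hX
  have hd := dd_le_list (G := G) L X hX (by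
    simp only [hL, List.forall_mem_cons, List.not_mem_nil, false_imp_iff, implies_true, and_true]
    refine ⟨out0 D.nv ?_ ?_ ?_, out0 D.nu ?_ ?_ ?_, out0 D.nw ?_ ?_ ?_, out0 D.nu1 ?_ ?_ ?_, out1 D.nu2 ?_ ?_,
      out1 D.nw1 ?_ ?_, out0 D.nw2 ?_ ?_ ?_, out0 nv1 ?_ ?_ ?_, out1 na1 ?_ ?_, out1 nb2 ?_ ?_⟩ <;> simp [hX, hL])
  have hmem : ∀ e, e ∈ X ↔ e = v ∨ e = u ∨ e = w ∨ e = uc ∨ e = ud ∨ e = wc ∨ e = wd ∨ e = vb ∨ e = ai ∨ e = ba := by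
    intro e; simp [hX, hL]
  have mk : ∀ ka kb kc kd : ℕ, (G.neighborFinset ud \ X).card ≤ ka → (G.neighborFinset wc \ X).card ≤ kb →
      (G.neighborFinset ai \ X).card ≤ kc → (G.neighborFinset ba \ X).card ≤ kd → ka + kb + kc + kd ≤ 3 →
      Fintype.card V ≤ 10 := by
    intro ka kb kc kd ib ia ic ie hk
    set L' : List (V × ℕ) := [(v,0),(u,0),(w,0),(uc,0),(ud,ka),(wc,kb),(wd,0),(vb,0),(ai,kc),(ba,kd)] with hL'
    have hd := dd_le_list (G := G) L' X (by simp [hX, hL, hL']) (by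
      simp only [hL', List.forall_mem_cons, List.not_mem_nil, false_imp_iff, implies_true, and_true]
      refine ⟨out0 D.nv ?_ ?_ ?_, out0 D.nu ?_ ?_ ?_, out0 D.nw ?_ ?_ ?_, out0 D.nu1 ?_ ?_ ?_, ib,
        ia, out0 D.nw2 ?_ ?_ ?_, out0 nv1 ?_ ?_ ?_, ic, ie⟩ <;> simp [hX, hL])
    exact small3 h htf heven (hd.trans (by simp [hL']; omega)) (u := v) (v := u) (by simp [hX, hL]) (by simp [hX, hL])
      hvu.ne ((card_le_list L).trans (by simp [hL]))
  have oc : (G.neighborFinset ud \ X).card ≤ 1 := out1 D.nu2 (by simp [hmem]) (by simp [hmem])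
  have od : (G.neighborFinset wc \ X).card ≤ 1 := out1 D.nw1 (by simp [hmem]) (by simp [hmem])
  have oa : (G.neighborFinset ai \ X).card ≤ 1 := out1 na1 (by simp [hmem]) (by simp [hmem])
  have oe : (G.neighborFinset ba \ X).card ≤ 1 := out1 nb2 (by simp [hmem]) (by simp [hmem])
  by_cases hA : ak ∈ X
  · exact mk 0 1 1 1 (out0 D.nu2 (by simp [hmem]) (by simp [hmem]) hA) od oa oe (by norm_num)
  by_cases hB : bb ∈ X
  · exact mk 1 0 1 1 oc (out0 D.nw1 (by simp [hmem]) (by simp [hmem]) hB) oa oe (by norm_num)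
  by_cases hP : p ∈ X
  · exact mk 1 1 0 1 oc od (out0 na1 (by simp [hmem]) (by simp [hmem]) hP) oe (by norm_num)
  by_cases hQ : q ∈ X
  · exact mk 1 1 1 0 oc od oa (out0 nb2 (by simp [hmem]) (by simp [hmem]) hQ) (by norm_num)
  rcases small4 h htf ag heven hd (u := v) (v := u) (w := w) (by simp [hX, hL]) (by simp [hX, hL])
    (by simp [hX, hL]) hvu.ne hvw.ne D.uw ((card_le_list L).trans (by simp [hL])) with hh | ⟨y, z, hyz, hc⟩
  · exact hh
  exfalso
  have hap : G.Adj ai p := by simp [na1]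
  have hbq : G.Adj ba q := by simp [nb2]
  have nX : ∀ {s t}, s ∉ X → t ∈ X → s ≠ t := fun hs ht e => hs (e ▸ ht)
  have nc : p ≠ q := by
    rintro rfl
    exact ag _ _ _ _ ha hap hbq.symm hb.symm (nX hP (by simp [hmem])).symm hab
  have nd : p ≠ bb := by
    rintro rfl
    exact ag _ _ _ _ h1a1 hap h1b1.symm h11.symm (nX hP (by simp [hmem])).symm D.wa1.symm
  have nf : q ≠ ak := by
    rintro rfl
    exact ag _ _ _ _ h2b2 hbq h2a2.symm h22 (nX hQ (by simp [hmem])).symm D.ub2.symm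
  have hpa : bb = q := pig2 ((hc _).1 hP) ((hc _).1 hQ) ((hc _).1 hB) nc nd
  have hqb : ak = p := pig2 ((hc _).1 hQ) ((hc _).1 hP) ((hc _).1 hA) nc.symm nf
  obtain ⟨s, t, hst⟩ := hT vb
  have ka : ¬ Th G vb v ai := by
    intro hh
    obtain ⟨r, rg, rh, rf⟩ := hh.2.2.2 w hvw D.wv1
    rcases (na1 r).1 rg with rfl | rfl | rfl
    · exact htf _ _ _ h11 hww1.symm rf
    · exact rh rfl
    · exact hP ((hmem _).2 (by rcases (D.nw _).1 rf with e | e | e <;> simp [e]))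
  have kb : ¬ Th G vb v ba := by
    intro hh
    obtain ⟨r, rg, rh, rf⟩ := hh.2.2.2 u hvu D.uv1
    rcases (nb2 r).1 rg with rfl | rfl | rfl
    · exact htf _ _ _ huu2 h22 rf.symm
    · exact rh rfl
    · exact hQ ((hmem _).2 (by rcases (D.nu _).1 rf with e | e | e <;> simp [e]))
  have kc : ¬ Th G vb ai ba := by
    intro hh
    obtain ⟨r, rg, rh, rf⟩ := hh.2.2.2 uc h1a1.symm fb.symm
    rcases (nb2 r).1 rg with rfl | rfl | rfl
    · exact ag _ _ _ _ rf hww2.symm hww1 h11.symm D.wu1.symm D.w12.symm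
    · exact rh rfl
    · exact hQ ((hmem _).2 (by rcases (D.nu1 _).1 rf with e | e | e <;> simp [e]))
  have hst' := hst.symm h htf ag
  have hne := hst.2.2.1
  rcases (nv1 s).1 hst.1 with rfl | rfl | rfl <;> rcases (nv1 t).1 hst.2.1 with rfl | rfl | rfl <;>
    first | exact hne rfl | exact ka hst | exact ka hst' | exact kb hst | exact kb hst' | exact kc hst | exact kc hst'
lemma th_small (h : CVT G) (htf : TF G) (ag : F4 G) (heven : Even (Fintype.card V)) {v p q : V}
    (hT : Th G v p q) : Fintype.card V ≤ 10 := by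
  have hT' : ∀ v, ∃ p q, Th G v p q := by
    intro v'
    obtain ⟨φ, rfl⟩ := h.vt v v'
    obtain ⟨aa, af, ah, aj⟩ := hT
    refine ⟨φ p, φ q, φ.map_adj_iff.2 aa, φ.map_adj_iff.2 af, fun e => ah (φ.injective e), ?_⟩
    intro s hs hsv
    obtain ⟨s, rfl⟩ := φ.surjective s
    obtain ⟨t, ht1, ht2, ht3⟩ := aj s (φ.map_adj_iff.1 hs) (fun e => hsv (e ▸ rfl))
    exact ⟨φ t, φ.map_adj_iff.2 ht1, fun e => ht2 (φ.injective e), φ.map_adj_iff.2 ht3⟩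
  obtain ⟨vb, uc, ud, wc, wd, ai, ak, bb, ba, D⟩ := hT.expand h htf ag
  rcases D.lemA h htf ag heven hT' with hh | ha | ha
  · exact hh
  · rcases D.swapUW.lemA h htf ag heven hT' with hh | hb | hb
    · exact hh
    · exact D.lemB1 h htf ag heven ha hb
    · exact D.lemB2 h htf ag heven hT' ha hb
  · rcases D.swapUW.lemA h htf ag heven hT' with hh | hb | hb
    · exact hh
    · exact D.swap12.lemB2 h htf ag heven hT' ha hb
    · exact D.swap12.lemB1 h htf ag heven ha hb
lemma acyc (hc : Cub G) (htf : TF G) (ag : F4 G) {Y : Finset V}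
    (aa : 1 ≤ Y.card) (af : Y.card ≤ 4) : Y.card + 2 ≤ dd G Y := by
  have := dd_parity hc Y
  by_contra hcon
  exact short_cycle hc Y (card_pos.1 aa) (by omega) (by omega) htf (fun _ => ag) (by omega)
lemma five_cycle (hc : Cub G) (htf : TF G) (ag : F4 G) {X : Finset V}
    (aj : X.card = 5) (hd : dd G X = 5) : ∃ a b c d e, G.Adj a b ∧ G.Adj b c ∧ G.Adj c d ∧ G.Adj d e ∧
      G.Adj e a ∧ ({a, b, c, d, e} : Finset V) = X := by
  obtain ⟨Z, hZX, hne, hdZ, hZ⟩ := exists_core hc X (by rw [← card_pos]; omega) (by omega)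
  have hZ1 := card_pos.2 hne
  have hle := card_le_card hZX
  have : Z = X := by
    apply eq_of_subset_of_card_le hZX
    by_contra hcon
    have := acyc hc htf ag hZ1 (by omega)
    omega
  subst this
  obtain ⟨v, hv⟩ := hne
  obtain ⟨a, haZ, -, hva⟩ := exists_other (a := v) (hZ v hv)
  obtain ⟨b, hbZ, hba, hvb⟩ := exists_other (a := a) (hZ v hv)
  obtain ⟨c, hcZ, hcv, hac⟩ := exists_other (a := v) (hZ a haZ)
  obtain ⟨d, hdZ', hdv, hbd⟩ := exists_other (a := v) (hZ b hbZ)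
  have hcd : c ≠ d := by
    rintro rfl; exact ag _ _ _ _ hva hac hbd.symm hvb.symm hcv.symm hba.symm
  have hca : c ≠ b := by rintro rfl; exact htf _ _ _ hva hac hvb.symm
  have hda : d ≠ a := by rintro rfl; exact htf _ _ _ hvb hbd hva.symm
  have heq : ({v, a, c, d, b} : Finset V) = Z := by
    apply eq_of_subset_of_card_le
    · intro e; simp; rintro (rfl | rfl | rfl | rfl | rfl) <;> assumption
    · rw [aj, card_insert_of_notMem, card_insert_of_notMem, card_insert_of_notMem,
        card_pair hbd.ne.symm]
      · simp [hcd, hca]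
      · simp [hac.ne, hda.symm, hba.symm]
      · simp [hva.ne, hvb.ne, hcv.symm, hdv.symm]
  obtain ⟨e, heZ, hea, hce⟩ := exists_other (a := a) (hZ c hcZ)
  have hed : e = d := by
    rw [← heq] at heZ
    simp at heZ
    rcases heZ with rfl | rfl | rfl | rfl | rfl
    · exact (htf _ _ _ hva hac hce).elim
    · exact absurd rfl hea
    · exact absurd rfl hce.ne
    · rfl
    · exact (ag _ _ _ _ hva hac hce hvb.symm hcv.symm hba.symm).elim
  subst hed
  exact ⟨v, a, c, e, b, hva, hac, hce, hbd.symm, hvb.symm, heq⟩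
lemma th_of (hc : Cub G) (htf : TF G) {m s s' t t' p q : V} (hms : G.Adj m s) (hmt : G.Adj m t) (hst : s ≠ t)
    (aa : G.Adj s s') (af : G.Adj t t') (ah : G.Adj s' t') (ag : G.Adj s p) (aj : G.Adj t q)
    (an : G.Adj p q) (nc : s' ≠ m) (nd : p ≠ m) (nf : p ≠ s') (ng : t' ≠ m) (nh : q ≠ m) : Th G m s t := by
  refine ⟨hms, hmt, hst, fun r hr hrm => ?_⟩
  rcases nbr_all hc hms.symm aa ag nc.symm nd.symm nf.symm hr with rfl | rfl | rfl
  · exact absurd rfl hrm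
  · exact ⟨t', af, ng, ah⟩
  · exact ⟨q, aj, nh, an⟩
lemma th_of7 (hc : Cub G) (htf : TF G) (ag : F4 G) {X C : Finset V}
    (hCX : C ⊆ X) (aj : C.card = 5) (ao : X.card = 7) (hdC : dd G C = 5) (hdX : dd G X = 5) :
    ∃ m s t, Th G m s t := by
  have af : (X \ C).card = 2 := by rw [card_sdiff_of_subset hCX]; omega
  obtain ⟨p, q, hpq, hXC⟩ := card_eq_two.1 af
  have hp : p ∈ X \ C := by rw [hXC]; simp
  have hq : q ∈ X \ C := by rw [hXC]; simp
  rw [mem_sdiff] at hp hq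
  have hX : X = insert q (insert p C) := by
    rw [← sdiff_union_of_subset hCX, hXC]; ext; simp; tauto
  have ib := dd_insert hc hp.2
  have ia := dd_insert hc (show q ∉ insert p C by simp [hq.2, hpq.symm])
  rw [← hX] at ia
  obtain ⟨a, b, c, d, e, hab, hbc, hcd, hde, hea, hC⟩ := five_cycle hc htf ag aj hdC
  have mem : ∀ x, x ∈ C ↔ x = a ∨ x = b ∨ x = c ∨ x = d ∨ x = e := by intro x; rw [← hC]; simp
  have one : ∀ r, r ∉ C → (G.neighborFinset r ∩ C).card ≤ 1 := by
    intro r hr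
    rw [card_le_one]
    intro s hs t ht
    simp only [mem_inter, mem_neighborFinset, mem] at hs ht
    have hra : r ≠ a ∧ r ≠ b ∧ r ≠ c ∧ r ≠ d ∧ r ≠ e := by rw [mem] at hr; push Not at hr; exact hr
    obtain ⟨ra, rb, rc, rd, re⟩ := hra
    obtain ⟨hrs, hs⟩ := hs
    obtain ⟨hrt, ht⟩ := ht
    by_contra hst
    rcases hs with rfl | rfl | rfl | rfl | rfl <;> rcases ht with rfl | rfl | rfl | rfl | rfl <;>
      first
      | exact hst rfl
      | exact htf _ _ _ hrs hab hrt.symm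
      | exact htf _ _ _ hrs hbc hrt.symm
      | exact htf _ _ _ hrs hcd hrt.symm
      | exact htf _ _ _ hrs hde hrt.symm
      | exact htf _ _ _ hrs hea hrt.symm
      | exact htf _ _ _ hrs hab.symm hrt.symm
      | exact htf _ _ _ hrs hbc.symm hrt.symm
      | exact htf _ _ _ hrs hcd.symm hrt.symm
      | exact htf _ _ _ hrs hde.symm hrt.symm
      | exact htf _ _ _ hrs hea.symm hrt.symm
      | exact ag _ _ _ _ hrs hab hbc hrt.symm rb hst
      | exact ag _ _ _ _ hrs hbc hcd hrt.symm rc hst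
      | exact ag _ _ _ _ hrs hcd hde hrt.symm rd hst
      | exact ag _ _ _ _ hrs hde hea hrt.symm re hst
      | exact ag _ _ _ _ hrs hea hab hrt.symm ra hst
      | exact ag _ _ _ _ hrt hab hbc hrs.symm rb (Ne.symm hst)
      | exact ag _ _ _ _ hrt hbc hcd hrs.symm rc (Ne.symm hst)
      | exact ag _ _ _ _ hrt hcd hde hrs.symm rd (Ne.symm hst)
      | exact ag _ _ _ _ hrt hde hea hrs.symm re (Ne.symm hst)
      | exact ag _ _ _ _ hrt hea hab hrs.symm ra (Ne.symm hst)
  have hp1 := one p hp.2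
  have hq1 := one q hq.2
  have hq2 : (G.neighborFinset q ∩ insert p C).card ≤ (G.neighborFinset q ∩ C).card + 1 := by
    by_cases h : G.Adj q p
    · rw [inter_insert_of_mem (by simpa using h)]; exact card_insert_le _ _
    · rw [inter_insert_of_notMem (by simpa using h)]; omega
  have hqp : G.Adj q p := by
    by_contra h
    rw [inter_insert_of_notMem (by simpa using h)] at ia
    omega
  obtain ⟨s, hs⟩ := card_pos.1 (show 0 < (G.neighborFinset p ∩ C).card by omega)
  obtain ⟨t, ht⟩ := card_pos.1 (show 0 < (G.neighborFinset q ∩ C).card by omega)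
  rw [mem_inter, mem_neighborFinset] at hs ht
  obtain ⟨hps, hsC⟩ := hs
  obtain ⟨hqt, htC⟩ := ht
  have hpm := hp.2
  have hqm := hq.2
  rw [mem] at hpm hqm hsC htC
  push Not at hpm hqm
  have dist : a ≠ b ∧ a ≠ c ∧ a ≠ d ∧ a ≠ e ∧ b ≠ c ∧ b ≠ d ∧ b ≠ e ∧ c ≠ d ∧ c ≠ e ∧ d ≠ e := by
    refine ⟨hab.ne, ?_, ?_, hea.ne.symm, hbc.ne, ?_, ?_, hcd.ne, ?_, hde.ne⟩
    · rintro rfl; exact htf _ _ _ hcd hde hea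
    · rintro rfl; exact htf _ _ _ hab hbc hcd
    · rintro rfl; exact htf _ _ _ hde hea hab
    · rintro rfl; exact htf _ _ _ hbc hcd hde
    · rintro rfl; exact htf _ _ _ hea hab hbc
  obtain ⟨ab, ac, ad, ae, bc, bd, be, cd, ce, de⟩ := dist
  obtain ⟨pa, pb, pc, pd, pe⟩ := hpm
  obtain ⟨qa, qb, qc, qd, qe⟩ := hqm
  have T1 : ∀ x y, G.Adj x y → x ≠ q → y ≠ p → G.Adj p x → G.Adj q y → False := by
    intro x y hxy hx hy aa af
    exact ag _ _ _ _ aa hxy af.symm hqp hy.symm hx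
  have T0 : ∀ x, G.Adj p x → G.Adj q x → False := fun x aa af => htf _ _ _ aa af.symm hqp
  have K : ∀ m s s' t' t, G.Adj m s → G.Adj s s' → G.Adj s' t' → G.Adj t' t → G.Adj t m → s ≠ t → s' ≠ m →
      t' ≠ m → p ≠ m → q ≠ m → p ≠ s' → G.Adj p s → G.Adj q t → ∃ m s t, Th G m s t := by
    intro m s s' t' t gb gc gd gf gg nc nd nf ng nh ni ga gh
    exact ⟨m, s, t, th_of hc htf gb gg.symm nc gc gf.symm gd ga.symm gh.symm hqp.symm nd ng ni nf nh⟩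
  rcases hsC with rfl | rfl | rfl | rfl | rfl <;> rcases htC with rfl | rfl | rfl | rfl | rfl
  · exact (T0 _ hps hqt).elim
  · exact (T1 _ _ hab qa.symm pb.symm hps hqt).elim
  · exact K _ _ _ _ _ hab.symm hea.symm hde.symm hcd.symm hbc.symm ac be.symm bd.symm pb qb pe hps hqt
  · exact K _ _ _ _ _ hea hab hbc hcd hde ad be ce pe qe pb hps hqt
  · exact (T1 _ _ hea.symm qa.symm pe.symm hps hqt).elim
  · exact (T1 _ _ hab.symm qb.symm pa.symm hps hqt).elim
  · exact (T0 _ hps hqt).elim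
  · exact (T1 _ _ hbc qb.symm pc.symm hps hqt).elim
  · exact K _ _ _ _ _ hbc.symm hab.symm hea.symm hde.symm hcd.symm bd ac ce.symm pc qc pa hps hqt
  · exact K _ _ _ _ _ hab hbc hcd hde hea be ac.symm ad.symm pa qa pc hps hqt
  · exact K _ _ _ _ _ hbc hcd hde hea hab ac.symm bd.symm be.symm pb qb pd hps hqt
  · exact (T1 _ _ hbc.symm qc.symm pb.symm hps hqt).elim
  · exact (T0 _ hps hqt).elim
  · exact (T1 _ _ hcd qc.symm pd.symm hps hqt).elim
  · exact K _ _ _ _ _ hcd.symm hbc.symm hab.symm hea.symm hde.symm ce bd ad pd qd pb hps hqt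
  · exact K _ _ _ _ _ hde.symm hcd.symm hbc.symm hab.symm hea.symm ad.symm ce be pe qe pc hps hqt
  · exact K _ _ _ _ _ hcd hde hea hab hbc bd.symm ce.symm ac pc qc pe hps hqt
  · exact (T1 _ _ hcd.symm qd.symm pc.symm hps hqt).elim
  · exact (T0 _ hps hqt).elim
  · exact (T1 _ _ hde qd.symm pe.symm hps hqt).elim
  · exact (T1 _ _ hea qe.symm pa.symm hps hqt).elim
  · exact K _ _ _ _ _ hea.symm hde.symm hcd.symm hbc.symm hab.symm be.symm ad.symm ac.symm pa qa pd hps hqt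
  · exact K _ _ _ _ _ hde hea hab hbc hcd ce.symm ad bd pd qd pa hps hqt
  · exact (T1 _ _ hde.symm qe.symm pd.symm hps hqt).elim
  · exact (T0 _ hps hqt).elim
lemma cut5' (h : CVT G) (htf : TF G) (ag : F4 G) (hT : ∀ m s t, ¬ Th G m s t) (X : Finset V) (hX : dd G X = 5) :
    X.card ≤ 5 ∨ Xᶜ.card ≤ 5 := by
  by_contra hbad
  have hex : ∃ m, ∃ X : Finset V, X.card = m ∧ dd G X = 5 ∧ 5 < X.card ∧ 5 < Xᶜ.card :=
    ⟨_, X, rfl, hX, by omega, by omega⟩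
  classical
  obtain ⟨X, hXm, hX, hX1, hX2⟩ := Nat.find_spec hex
  have hmin : ∀ Z : Finset V, dd G Z = 5 → Z.card < X.card → Z.card ≤ 5 ∨ Zᶜ.card ≤ 5 := by
    intro Z hZ hlt
    by_contra hcon
    exact Nat.find_min hex (hXm ▸ hlt) ⟨Z, rfl, hZ, by omega, by omega⟩
  have hhalf : X.card ≤ Xᶜ.card := by
    by_contra hcon
    have := hmin Xᶜ (by rw [dd_compl, hX]) (by omega)
    rw [compl_compl] at this; omega
  have hcc := card_compl_add_card X
  have hpar := dd_parity h.cub X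
  have IH := cut4 h htf ag
  have hsmall : ∀ Z : Finset V, dd G Z ≤ 5 → Z.card < X.card → Z.card = 0 ∨ Z.card = 1 ∨ Z.card = 2 ∨ Z.card = 3 ∨
      (Z.card = 5 ∧ dd G Z = 5) := by
    intro Z hZ hlt
    have := card_compl_add_card Z
    have h4' : Z.card ≠ 4 := by
      intro e
      have := acyc h.cub htf ag (Y := Z) (by omega) (by omega)
      omega
    rcases hZ.lt_or_eq with hZ | hZ
    · have := IH Z hZ; omega
    · have := hmin Z hZ hlt; omega
  by_cases hb : ∀ φ : G ≃g G, X.image φ = X ∨ Disjoint X (X.image φ)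
  · obtain ⟨t, ht⟩ := block_lemma h hb
    rw [hX] at ht
    have : X.card ≤ 5 := Nat.le_of_dvd (by norm_num) ⟨t, ht⟩
    omega
  push Not at hb
  obtain ⟨φ, aa, af⟩ := hb
  set Y := X.image φ with hY
  have hYc : Y.card = X.card := card_image_aut φ X
  have hYd : dd G Y = 5 := by rw [hY, dd_image, hX]
  obtain ⟨ca, cb, ch, cg⟩ := cross hX hYd hYc.symm (by omega)
  have hi : 0 < (X ∩ Y).card := by
    rw [card_pos]; exact not_disjoint_iff_nonempty_inter.1 af
  have hs : 0 < (X \ Y).card := by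
    rw [card_pos, sdiff_nonempty]
    intro hsub; exact aa (eq_of_subset_of_card_le hsub (by omega)).symm
  have hs' : (X \ Y).card = 1 ∨ (X \ Y).card = 2 ∨ (X \ Y).card = 3 ∨ ((X \ Y).card = 5 ∧ (dd G (X \ Y) = 5 ∨ dd G (Y \ X) = 5)) := by
    rcases cb with cb | cb
    · have := hsmall _ cb (by omega); omega
    · have := hsmall _ cb (by omega); omega
  have hi' : (X ∩ Y).card = 1 ∨ (X ∩ Y).card = 2 ∨ (X ∩ Y).card = 3 ∨ ((X ∩ Y).card = 5 ∧ dd G (X ∩ Y) = 5) := by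
    rcases ca with ca | ⟨ca, ci⟩
    · have := hsmall _ ca (by omega); omega
    · have := card_le_card (subset_union_left : X ⊆ X ∪ Y)
      have := IH _ ca
      rw [compl_compl] at this; omega
  have ao : X.card = 7 := by omega
  have : ∃ m s t, Th G m s t := by
    by_cases hi5 : (X ∩ Y).card = 5
    · exact th_of7 h.cub htf ag (inter_subset_left : X ∩ Y ⊆ X) hi5 ao (by omega) hX
    · have hs5 : (X \ Y).card = 5 := by omega
      have : dd G (X \ Y) = 5 ∨ dd G (Y \ X) = 5 := by omega
      rcases this with hh | hh
      · exact th_of7 h.cub htf ag (sdiff_subset : X \ Y ⊆ X) hs5 ao hh hX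
      · exact th_of7 h.cub htf ag (sdiff_subset : Y \ X ⊆ Y) (by omega) (by omega) hh hYd
  obtain ⟨m, s, t, hh⟩ := this
  exact hT m s t hh
lemma caseB_compl (hc : Cub G) (htf : TF G) (heven : Even (Fintype.card V))
    {x : V → ℤ} {H : Finset V} {a b c d : V} (hB : CaseB G x H a b c d) : 7 ≤ Hᶜ.card := by
  have hcc := card_compl_add_card H
  have hodd := hB.oddH
  have ag : ({a, b, c, d} : Finset V).card = 4 := by
    rw [card_insert_of_notMem, card_insert_of_notMem, card_pair hB.hcd.ne]
    · simp [hB.bc, hB.bd]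
    · simp [hB.hab.ne, hB.ac, hB.ad]
  have hsub : ({a, b, c, d} : Finset V) ⊆ Hᶜ := by
    intro e; simp [hB.memH]; rintro (rfl | rfl | rfl | rfl) <;> simp [hB.xa, hB.xb, hB.xc, hB.xd]
  have hle := card_le_card hsub
  by_contra hlt
  have aj : Hᶜ.card = 5 := by
    rcases heven with ⟨k, hk⟩; rcases hodd with ⟨l, hl⟩; omega
  have aa : (Hᶜ \ {a, b, c, d}).card = 1 := by rw [card_sdiff_of_subset hsub]; omega
  obtain ⟨i, hi⟩ := card_eq_one.1 aa
  have hsum : ∑ v ∈ Hᶜ, x v = 3 := by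
    rw [← hB.sum, ← sum_compl_add_sum H]
    rw [sum_eq_zero (s := H) (fun v hv => (hB.memH v).1 hv), add_zero]
  rw [← sum_sdiff hsub, hi, sum_singleton, sum_insert, sum_insert, sum_pair hB.hcd.ne,
    hB.xa, hB.xb, hB.xc, hB.xd] at hsum
  rotate_left
  · simp [hB.bc, hB.bd]
  · simp [hB.hab.ne, hB.ac, hB.ad]
  have hxi : x i = -1 := by linarith
  have hN : G.neighborFinset i ⊆ (G.neighborFinset i ∩ {a, b}) ∪ (G.neighborFinset i ∩ {c, d}) := by
    intro e he
    have hie : G.Adj i e := by simpa using he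
    have hxe : x e = 1 := by
      have := hB.edge i e hie
      rcases hB.pm e with h | h | h <;> omega
    have : e ∈ ({a, b, c, d} : Finset V) := by
      by_contra hcon
      have : e ∈ Hᶜ \ {a, b, c, d} := by
        rw [mem_sdiff]; refine ⟨?_, hcon⟩
        simp [hB.memH, hxe]
      rw [hi, mem_singleton] at this
      rw [this] at hie; exact hie.ne rfl
    simp at this
    simp [hie]; tauto
  have ah := (card_le_card hN).trans (card_union_le _ _)
  have two : ∀ p q, G.Adj p q → (G.neighborFinset i ∩ {p, q}).card ≤ 1 := by
    intro p q hpq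
    rw [card_le_one]
    intro s hs t ht
    simp at hs ht
    by_contra hst
    obtain ⟨hs1, rfl | rfl⟩ := hs <;> obtain ⟨ht1, rfl | rfl⟩ := ht
    · exact hst rfl
    · exact htf _ _ _ hs1 hpq ht1.symm
    · exact htf _ _ _ ht1 hpq hs1.symm
    · exact hst rfl
  have := two a b hB.hab
  have := two c d hB.hcd
  rw [hc] at ah
  omega
lemma int5 {A B C D E : ℤ} (hA : A = 1 ∨ A = -1 ∨ A = 0) (hB : B = 1 ∨ B = -1 ∨ B = 0) (hC : C = 1 ∨ C = -1 ∨ C = 0)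
    (hD : D = 1 ∨ D = -1 ∨ D = 0) (hE : E = 1 ∨ E = -1 ∨ E = 0) (aa : 0 ≤ A + B) (af : 0 ≤ B + C) (ah : 0 ≤ C + D)
    (ag : 0 ≤ D + E) (aj : 0 ≤ E + A) : 1 ≤ A + B + C + D + E ∨ (A = 0 ∧ B = 0 ∧ C = 0 ∧ D = 0 ∧ E = 0) := by
  omega
lemma int5' {A B C D E : ℤ} (hA : A = 1 ∨ A = -1) (hB : B = 1 ∨ B = -1) (hC : C = 1 ∨ C = -1)
    (hD : D = 1 ∨ D = -1) (hE : E = 1 ∨ E = -1) (aa : 0 ≤ A + B) (af : 0 ≤ B + C) (ah : 0 ≤ C + D)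
    (ag : 0 ≤ D + E) (aj : 0 ≤ E + A) : (A = 1 ∧ B = 1) ∨ (B = 1 ∧ C = 1) ∨ (C = 1 ∧ D = 1) ∨ (D = 1 ∧ E = 1) ∨ (E = 1 ∧ A = 1) := by
  omega
variable (G) in
def Pent : Finset (Finset V) := univ.filter fun X => X.card = 5 ∧ dd G X = 5
lemma five_dist (htf : TF G) {a b c d e : V} (hab : G.Adj a b) (hbc : G.Adj b c) (hcd : G.Adj c d)
    (hde : G.Adj d e) (hea : G.Adj e a) :
    a ≠ b ∧ a ≠ c ∧ a ≠ d ∧ a ≠ e ∧ b ≠ c ∧ b ≠ d ∧ b ≠ e ∧ c ≠ d ∧ c ≠ e ∧ d ≠ e := by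
  refine ⟨hab.ne, ?_, ?_, hea.ne.symm, hbc.ne, ?_, ?_, hcd.ne, ?_, hde.ne⟩
  · rintro rfl; exact htf _ _ _ hcd hde hea
  · rintro rfl; exact htf _ _ _ hab hbc hcd
  · rintro rfl; exact htf _ _ _ hde hea hab
  · rintro rfl; exact htf _ _ _ hbc hcd hde
  · rintro rfl; exact htf _ _ _ hea hab hbc
lemma pent_inter (h : CVT G) (htf : TF G) (ag : F4 G) (hn : 12 ≤ Fintype.card V) (hT : ∀ m s t, ¬ Th G m s t)
    {C C' : Finset V} (hC : C ∈ Pent G) (hC' : C' ∈ Pent G) (ah : 3 ≤ (C ∩ C').card) : C = C' := by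
  simp [Pent] at hC hC'
  have aa := dd_submod (G := G) C C'
  have af := card_union_add_card_inter C C'
  have hi := card_le_card (inter_subset_left : C ∩ C' ⊆ C)
  by_contra hne
  have aj : (C ∩ C').card ≠ 5 := by
    intro e
    have ea := eq_of_subset_of_card_le (inter_subset_left : C ∩ C' ⊆ C) (by omega)
    have eb := eq_of_subset_of_card_le (inter_subset_right : C ∩ C' ⊆ C') (by omega)
    exact hne (ea.symm.trans eb)
  have := acyc h.cub htf ag (Y := C ∩ C') (by omega) (by omega)
  have hcc := card_compl_add_card (C ∪ C')
  by_cases hlt : dd G (C ∪ C') < 5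
  · have := cut4 h htf ag _ hlt
    omega
  obtain ⟨m, s, t, hh⟩ := th_of7 h.cub htf ag (subset_union_left : C ⊆ C ∪ C') hC.1 (by omega) hC.2 (by omega)
  exact hT m s t hh
lemma pent_two (hc : Cub G) (htf : TF G) (ag : F4 G) {C : Finset V} (hC : C ∈ Pent G)
    {v : V} (hv : v ∈ C) : ∃ p q, p ∈ C ∧ q ∈ C ∧ p ≠ q ∧ G.Adj v p ∧ G.Adj v q := by
  simp [Pent] at hC
  obtain ⟨a, b, c, d, e, hab, hbc, hcd, hde, hea, rfl⟩ := five_cycle hc htf ag hC.1 hC.2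
  obtain ⟨ab, ac, ad, ae, bc, bd, be, cd, ce, de⟩ := five_dist htf hab hbc hcd hde hea
  simp at hv
  rcases hv with rfl | rfl | rfl | rfl | rfl
  · exact ⟨b, e, by simp, by simp, be, hab, hea.symm⟩
  · exact ⟨a, c, by simp, by simp, ac, hab.symm, hbc⟩
  · exact ⟨b, d, by simp, by simp, bd, hbc.symm, hcd⟩
  · exact ⟨c, e, by simp, by simp, ce, hcd.symm, hde⟩
  · exact ⟨a, d, by simp, by simp, ad, hea, hde.symm⟩
lemma pent_k (h : CVT G) (htf : TF G) (ag : F4 G) (hn : 12 ≤ Fintype.card V) (hT : ∀ m s t, ¬ Th G m s t)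
    (v : V) : ((Pent G).filter (v ∈ ·)).card ≤ 3 := by
  obtain ⟨p, q, r, hp, hq, hr, hpq, hpr, hqr, hall⟩ := nbr3 h.cub v
  have one : ∀ s t, s ≠ t → G.Adj v s → G.Adj v t → ((Pent G).filter (fun C => v ∈ C ∧ s ∈ C ∧ t ∈ C)).card ≤ 1 := by
    intro s t hst hs ht
    rw [card_le_one]
    intro C hC C' hC'
    simp only [mem_filter] at hC hC'
    apply pent_inter h htf ag hn hT hC.1 hC'.1
    have : ({v, s, t} : Finset V) ⊆ C ∩ C' := by
      intro e; simp; rintro (rfl | rfl | rfl)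
      · exact ⟨hC.2.1, hC'.2.1⟩
      · exact ⟨hC.2.2.1, hC'.2.2.1⟩
      · exact ⟨hC.2.2.2, hC'.2.2.2⟩
    have ah := card_le_card this
    rwa [card_eq_three.2 ⟨v, s, t, hs.ne, ht.ne, hst, rfl⟩] at ah
  have hsub : (Pent G).filter (v ∈ ·) ⊆ (Pent G).filter (fun C => v ∈ C ∧ p ∈ C ∧ q ∈ C) ∪
      ((Pent G).filter (fun C => v ∈ C ∧ p ∈ C ∧ r ∈ C) ∪ (Pent G).filter (fun C => v ∈ C ∧ q ∈ C ∧ r ∈ C)) := by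
    intro C hC
    simp only [mem_filter, mem_union] at hC ⊢
    obtain ⟨s, t, hs, ht, hst, hvs, hvt⟩ := pent_two h.cub htf ag hC.1 hC.2
    have hC1 := hC.1
    have hC2 := hC.2
    rcases hall s hvs with rfl | rfl | rfl <;> rcases hall t hvt with rfl | rfl | rfl <;>
      first | exact absurd rfl hst | simp [hC1, hC2, hs, ht]
  have aa := one p q hpq hp hq
  have af := one p r hpr hp hr
  have ah := one q r hqr hq hr
  have aj := card_le_card hsub
  have an := card_union_le ((Pent G).filter (fun C => v ∈ C ∧ p ∈ C ∧ q ∈ C)) ((Pent G).filter (fun C => v ∈ C ∧ p ∈ C ∧ r ∈ C) ∪ (Pent G).filter (fun C => v ∈ C ∧ q ∈ C ∧ r ∈ C))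
  have ao := card_union_le ((Pent G).filter (fun C => v ∈ C ∧ p ∈ C ∧ r ∈ C)) ((Pent G).filter (fun C => v ∈ C ∧ q ∈ C ∧ r ∈ C))
  omega
lemma pent_const (h : CVT G) (u v : V) : ((Pent G).filter (u ∈ ·)).card = ((Pent G).filter (v ∈ ·)).card := by
  have key : ∀ u v, ((Pent G).filter (u ∈ ·)).card ≤ ((Pent G).filter (v ∈ ·)).card := by
    intro u v
    obtain ⟨φ, rfl⟩ := h.vt u v
    apply card_le_card_of_injOn (fun C => C.image φ)
    · intro C hC
      simp [Pent] at hC ⊢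
      exact ⟨⟨by rw [card_image_aut]; exact hC.1.1, by rw [dd_image]; exact hC.1.2⟩, hC.2⟩
    · intro C _ C' _ e
      exact image_injective φ.injective e
  exact le_antisymm (key u v) (key v u)
lemma pent_sum (h : CVT G) (va : V) (f : V → ℤ) :
    ∑ C ∈ Pent G, ∑ v ∈ C, f v = ((Pent G).filter (va ∈ ·)).card * ∑ v, f v := by
  have : ∀ C : Finset V, ∑ v ∈ C, f v = ∑ v, if v ∈ C then f v else 0 := by
    intro C; rw [sum_ite_mem, univ_inter]
  simp only [this]
  rw [sum_comm, mul_sum]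
  refine sum_congr rfl fun v _ => ?_
  rw [pent_const h va v, ← sum_filter, sum_const, nsmul_eq_mul]
  simp
lemma caseB_girth5 (h : CVT G) (htf : TF G) (ag : F4 G) (heven : Even (Fintype.card V))
    {x : V → ℤ} {H : Finset V} {a b c d : V} (hB : CaseB G x H a b c d) : ∃ y, CaseA G y := by
  by_cases ah : H.card = 3
  · exact caseB_three htf hB ah
  exfalso
  have ao := caseB_compl h.cub htf heven hB
  have hcc := card_compl_add_card H
  have hH5 : 5 ≤ H.card := by
    have := hB.cardH
    rcases hB.oddH with ⟨k, hk⟩; omega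
  have hn : 12 ≤ Fintype.card V := by omega
  have hT : ∀ m s t, ¬ Th G m s t := by
    intro m s t hh
    have := th_small h htf ag heven hh
    omega
  have hH : H.card = 5 := by
    have := cut5' h htf ag hT H hB.dH
    omega
  have hHP : H ∈ Pent G := by simp [Pent, hH, hB.dH]
  set k := ((Pent G).filter (a ∈ ·)).card with hk
  have hk3 : k ≤ 3 := pent_k h htf ag hn hT a
  have sa := pent_sum h a (fun _ => 1)
  have sb := pent_sum h a x
  rw [hB.sum, ← hk] at sb
  rw [← hk] at sa
  have ea : ∀ C ∈ Pent G, ∑ v ∈ C, (1 : ℤ) = 5 := by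
    intro C hC; simp [Pent] at hC; simp [hC.1]
  rw [sum_congr rfl ea] at sa
  simp at sa
  have eb : ∀ C ∈ (Pent G).erase H, 1 ≤ ∑ v ∈ C, x v := by
    intro C hC
    rw [mem_erase] at hC
    obtain ⟨hne, hC⟩ := hC
    simp [Pent] at hC
    obtain ⟨p, q, r, s, t, hpq, hqr, hrs, hst, htp, rfl⟩ := five_cycle h.cub htf ag hC.1 hC.2
    obtain ⟨ab, ac, ad, ae, bc, bd, be, cd, ce, de⟩ := five_dist htf hpq hqr hrs hst htp
    rw [sum_insert (by simp [ab, ac, ad, ae]), sum_insert (by simp [bc, bd, be]),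
      sum_insert (by simp [cd, ce]), sum_pair de]
    rcases int5 (hB.pm p) (hB.pm q) (hB.pm r) (hB.pm s) (hB.pm t) (hB.edge _ _ hpq) (hB.edge _ _ hqr) (hB.edge _ _ hrs)
      (hB.edge _ _ hst) (hB.edge _ _ htp) with hh | ⟨za, zb, zd, z4, z5⟩
    · linarith
    · exfalso
      apply hne
      apply eq_of_subset_of_card_le
      · intro e; simp [hB.memH]; rintro (rfl | rfl | rfl | rfl | rfl) <;> assumption
      · omega
  have ec : ((Pent G).erase H).card ≤ 3 * k := by
    have := card_nsmul_le_sum ((Pent G).erase H) (fun C => ∑ v ∈ C, x v) 1 eb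
    have ed : ∑ v ∈ H, x v = 0 := sum_eq_zero (fun v hv => (hB.memH v).1 hv)
    have ef := add_sum_erase (Pent G) (fun C => ∑ v ∈ C, x v) hHP
    simp only [ed] at ef
    simp at this
    have : (((Pent G).erase H).card : ℤ) ≤ k * 3 := by linarith
    have h' : ((Pent G).erase H).card ≤ k * 3 := by exact_mod_cast this
    omega
  have ed := card_erase_add_one hHP
  have sd : (Pent G).card * 5 = k * Fintype.card V := by exact_mod_cast sa
  have hk1 : k = 1 ∧ (Pent G).card = 4 := by
    rcases heven with ⟨l, hl⟩
    interval_cases k <;> omega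
  have uniq : ∀ v C C', C ∈ Pent G → C' ∈ Pent G → v ∈ C → v ∈ C' → C = C' := by
    intro v C C' hC hC' hv hv'
    have := pent_const h v a
    rw [← hk, hk1.1] at this
    exact card_le_one.1 this.le C (by simp [hC, hv]) C' (by simp [hC', hv'])
  have pp : ∀ C ∈ (Pent G).erase H, a ∈ C ∨ c ∈ C := by
    intro C hC
    rw [mem_erase] at hC
    obtain ⟨hne, hC⟩ := hC
    have nz : ∀ v ∈ C, x v = 1 ∨ x v = -1 := by
      intro v hv
      rcases hB.pm v with am | am | am
      · exact Or.inl am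
      · exact Or.inr am
      · exact absurd (uniq v C H hC hHP hv ((hB.memH v).2 am)) hne
    simp [Pent] at hC
    obtain ⟨p, q, r, s, t, hpq, hqr, hrs, hst, htp, rfl⟩ := five_cycle h.cub htf ag hC.1 hC.2
    have fin : ∀ u v, u ∈ ({p, q, r, s, t} : Finset V) → v ∈ ({p, q, r, s, t} : Finset V) → G.Adj u v → x u = 1 → x v = 1 →
      a ∈ ({p, q, r, s, t} : Finset V) ∨ c ∈ ({p, q, r, s, t} : Finset V) := by
      intro u v hu hv huv aa af
      rcases hB.only u v huv aa af with ⟨rfl, rfl⟩ | ⟨rfl, rfl⟩ | ⟨rfl, rfl⟩ | ⟨rfl, rfl⟩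
      · exact Or.inl hu
      · exact Or.inl hv
      · exact Or.inr hu
      · exact Or.inr hv
    rcases int5' (nz p (by simp)) (nz q (by simp)) (nz r (by simp)) (nz s (by simp)) (nz t (by simp)) (hB.edge _ _ hpq) (hB.edge _ _ hqr) (hB.edge _ _ hrs)
      (hB.edge _ _ hst) (hB.edge _ _ htp) with hh | hh | hh | hh | hh
    · exact fin p q (by simp) (by simp) hpq hh.1 hh.2
    · exact fin q r (by simp) (by simp) hqr hh.1 hh.2
    · exact fin r s (by simp) (by simp) hrs hh.1 hh.2
    · exact fin s t (by simp) (by simp) hst hh.1 hh.2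
    · exact fin t p (by simp) (by simp) htp hh.1 hh.2
  have hsub : (Pent G).erase H ⊆ (Pent G).filter (a ∈ ·) ∪ (Pent G).filter (c ∈ ·) := by
    intro C hC
    have := pp C hC
    rw [mem_erase] at hC
    simp only [mem_union, mem_filter]
    tauto
  have aa := (card_le_card hsub).trans (card_union_le _ _)
  have af := pent_const h c a
  omega
lemma bip (A : Finset V) (z : V) (hA : ∀ e ∈ A, ∀ f ∈ A, ¬ G.Adj e f)
    (hB : ∀ e, e ∉ A → e ≠ z → ∀ f, G.Adj e f → f ∈ A) : G.Colorable 2 := by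
  refine ⟨Coloring.mk (fun v => if v ∈ A then (0 : Fin 2) else 1) ?_⟩
  intro u v huv
  by_cases hu : u ∈ A <;> by_cases hv : v ∈ A
  · exact absurd huv (hA u hu v hv)
  · simp [hu, hv]
  · simp [hu, hv]
  · by_cases hz : u = z
    · have : v ≠ z := fun e => huv.ne (hz.trans e.symm)
      exact absurd (hB v hv this u huv.symm) hu
    · exact absurd (hB u hu hz v huv) hv
lemma compl_one (h : CVT G) (htf : TF G) {X : Finset V} (hX : dd G X ≤ 3) {u v : V} (hu : u ∈ X)
    (hv : v ∈ X) (huv : u ≠ v) : ∃ z, ∀ e, e ≠ z → e ∈ X := by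
  have aa := one_lt_card.2 ⟨u, hu, v, hv, huv⟩
  have := cut3 h htf X (by omega)
  have af : Xᶜ.card ≤ 1 := by omega
  haveI : Nonempty V := ⟨u⟩
  rw [card_le_one_iff_subset_singleton] at af
  obtain ⟨z, hz⟩ := af
  refine ⟨z, fun e he => ?_⟩
  by_contra hcon
  have := hz (mem_compl.2 hcon)
  exact he (by simpa using this)
lemma noK (h : CVT G) (hnb : ¬ G.Colorable 2) (htf : TF G) {v o p q r : V} (hvo : v ≠ o) (hpq : p ≠ q) (hpr : p ≠ r) (hqr : q ≠ r)
    (vp : G.Adj v p) (vq : G.Adj v q) (vr : G.Adj v r) (op : G.Adj o p) (oq : G.Adj o q) (or : G.Adj o r) : False := by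
  have nv := nbr_iff3 h.cub vp vq vr hpq hpr hqr
  have no := nbr_iff3 h.cub op oq or hpq hpr hqr
  obtain ⟨p', -, -, np⟩ := nbr_iff h.cub vp.symm op.symm hvo
  obtain ⟨q', -, -, nq⟩ := nbr_iff h.cub vq.symm oq.symm hvo
  obtain ⟨r', -, -, nr⟩ := nbr_iff h.cub vr.symm or.symm hvo
  set L : List (V × ℕ) := [(v,0),(o,0),(p,1),(q,1),(r,1)] with hL
  set X := (L.map Prod.fst).toFinset with hX
  have hmem : ∀ e, e ∈ X ↔ e = v ∨ e = o ∨ e = p ∨ e = q ∨ e = r := by intro e; simp [hX, hL]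
  have hd := dd_le_list (G := G) L X hX (by
    simp only [hL, List.forall_mem_cons, List.not_mem_nil, false_imp_iff, implies_true, and_true]
    refine ⟨out0 nv ?_ ?_ ?_, out0 no ?_ ?_ ?_, out1 np ?_ ?_, out1 nq ?_ ?_, out1 nr ?_ ?_⟩ <;> simp [hmem])
  obtain ⟨z, hz⟩ := compl_one h htf hd (u := v) (v := o) (by simp [hmem]) (by simp [hmem]) hvo
  apply hnb
  apply bip {p, q, r} z
  · intro e he f hf hef
    have he' : G.Adj v e := (nv e).2 (by simpa using he)
    have hf' : G.Adj v f := (nv f).2 (by simpa using hf)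
    exact htf _ _ _ he' hef hf'.symm
  · intro e he hez f hef
    have := (hmem e).1 (hz e hez)
    rcases this with rfl | rfl | hh
    · simpa using (nv f).1 hef
    · simpa using (no f).1 hef
    · exact absurd (by simpa using hh) he
variable (G) in
def Rung (v p : V) : Prop := G.Adj v p ∧ ∀ q, G.Adj v q → q ≠ p → ∃ o, G.Adj p o ∧ o ≠ v ∧ G.Adj q o
lemma Rung.expand (h : CVT G) (hnb : ¬ G.Colorable 2) (htf : TF G) {v p q : V} (hR : Rung G v p) (hq : G.Adj v q)
    (hqp : q ≠ p) : ∃ r o o', (∀ e, G.Adj v e ↔ e = p ∨ e = q ∨ e = r) ∧ (∀ e, G.Adj p e ↔ e = v ∨ e = o ∨ e = o') ∧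
      G.Adj q o ∧ G.Adj r o' ∧ r ≠ p ∧ r ≠ q ∧ o ≠ v ∧ o' ≠ v ∧ o ≠ o' := by
  obtain ⟨hvp, hR⟩ := hR
  obtain ⟨r, hrp, hrq, nv⟩ := nbr_iff h.cub hvp hq hqp.symm
  have hr : G.Adj v r := by simp [nv]
  obtain ⟨o, aa, af, ah⟩ := hR q hq hqp
  obtain ⟨o', h1', h2', h3'⟩ := hR r hr hrp
  have hoo : o ≠ o' := by
    rintro rfl
    exact noK h hnb htf af.symm hqp.symm hrp.symm hrq.symm hvp hq hr aa.symm ah.symm h3'.symm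
  exact ⟨r, o, o', nv, nbr_iff3 h.cub hvp.symm aa h1' af.symm h2'.symm hoo, ah, h3', hrp, hrq, af, h2', hoo⟩
lemma exists_nbr_ne (hc : Cub G) (v p : V) : ∃ q, G.Adj v q ∧ q ≠ p := by
  obtain ⟨b, c, d, hb, hc, hd, hbc, -⟩ := nbr3 hc v
  by_cases e : b = p
  · exact ⟨c, hc, fun e' => hbc (e.trans e'.symm)⟩
  · exact ⟨b, hb, e⟩
lemma Rung.symm (h : CVT G) (hnb : ¬ G.Colorable 2) (htf : TF G) {v p : V} (hR : Rung G v p) : Rung G p v := by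
  obtain ⟨q, hq, hqp⟩ := exists_nbr_ne h.cub v p
  obtain ⟨r, o, o', nv, np, qo, ro, hrp, hrq, hov, hov', hoo⟩ := hR.expand h hnb htf hq hqp
  refine ⟨hR.1.symm, fun e he hev => ?_⟩
  rcases (np e).1 he with rfl | rfl | rfl
  · exact absurd rfl hev
  · exact ⟨q, hq, hqp, qo.symm⟩
  · exact ⟨r, by simp [nv], hrp, ro.symm⟩
lemma Rung.uniq (h : CVT G) (hnb : ¬ G.Colorable 2) (htf : TF G) {v p q : V} (hR : Rung G v p) (hR' : Rung G v q) : p = q := by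
  by_contra hpq
  obtain ⟨r, pf, pg, nv, np, qp1, rp2, hrp, hrq, p1v, p2v, p12⟩ := hR.expand h hnb htf hR'.1 (Ne.symm hpq)
  have vp := hR.1
  have vq := hR'.1
  have vr : G.Adj v r := by simp [nv]
  have pp1 : G.Adj p pf := by simp [np]
  have pp2 : G.Adj p pg := by simp [np]
  obtain ⟨qf, q2v, q2p1, nq⟩ := nbr_iff h.cub vq.symm qp1 p1v.symm
  have qq2 : G.Adj q qf := by simp [nq]
  obtain ⟨o, ho1, ho2, ho3⟩ := hR'.2 r vr hrq
  have rq2 : G.Adj r qf := by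
    rcases (nq o).1 ho1 with rfl | rfl | rfl
    · exact absurd rfl ho2
    · exact (noK h hnb htf p1v.symm hpq hrp.symm hrq.symm vp vq vr pp1.symm qp1.symm ho3.symm).elim
    · exact ho3
  have p2q2 : pg ≠ qf := by
    rintro rfl
    exact noK h hnb htf p2v.symm hpq hrp.symm hrq.symm vp vq vr pp2.symm qq2.symm rq2.symm
  have nr := nbr_iff3 h.cub vr.symm rp2 rq2 p2v.symm q2v.symm p2q2
  obtain ⟨xe, -, -, np1⟩ := nbr_iff h.cub pp1.symm qp1.symm hpq
  obtain ⟨xf, -, -, np2⟩ := nbr_iff h.cub pp2.symm rp2.symm hrp.symm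
  obtain ⟨x3, -, -, nq2⟩ := nbr_iff h.cub qq2.symm rq2.symm hrq.symm
  set L : List (V × ℕ) := [(v,0),(p,0),(q,0),(r,0),(pf,1),(pg,1),(qf,1)] with hL
  set X := (L.map Prod.fst).toFinset with hX
  have hmem : ∀ e, e ∈ X ↔ e = v ∨ e = p ∨ e = q ∨ e = r ∨ e = pf ∨ e = pg ∨ e = qf := by intro e; simp [hX, hL]
  have hd := dd_le_list (G := G) L X hX (by
    simp only [hL, List.forall_mem_cons, List.not_mem_nil, false_imp_iff, implies_true, and_true]
    refine ⟨out0 nv ?_ ?_ ?_, out0 np ?_ ?_ ?_, out0 nq ?_ ?_ ?_, out0 nr ?_ ?_ ?_, out1 np1 ?_ ?_, out1 np2 ?_ ?_, out1 nq2 ?_ ?_⟩ <;> simp [hmem])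
  obtain ⟨z, hz⟩ := compl_one h htf hd (u := v) (v := p) (by simp [hmem]) (by simp [hmem]) vp.ne
  apply hnb
  apply bip {v, pf, pg, qf} z
  · intro e he f hf hef
    simp at he hf
    rcases he with rfl | rfl | rfl | rfl <;> rcases hf with rfl | rfl | rfl | rfl <;>
    first
    | exact hef.ne rfl
    | exact htf _ _ _ vp pp1 hef.symm
    | exact htf _ _ _ vp pp2 hef.symm
    | exact htf _ _ _ vq qq2 hef.symm
    | exact htf _ _ _ vp pp1 hef
    | exact htf _ _ _ vp pp2 hef
    | exact htf _ _ _ vq qq2 hef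
    | exact htf _ _ _ pp1 hef pp2.symm
    | exact htf _ _ _ pp2 hef pp1.symm
    | exact htf _ _ _ qp1 hef qq2.symm
    | exact htf _ _ _ qq2 hef qp1.symm
    | exact htf _ _ _ rp2 hef rq2.symm
    | exact htf _ _ _ rq2 hef rp2.symm
  · intro e he hez f hef
    have hm := (hmem e).1 (hz e hez)
    simp at he ⊢
    rcases hm with rfl | rfl | rfl | rfl | rfl | rfl | rfl
    · simp at he
    · rcases (np f).1 hef with e | e | e <;> simp [e]
    · rcases (nq f).1 hef with e | e | e <;> simp [e]
    · rcases (nr f).1 hef with e | e | e <;> simp [e]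
    all_goals simp at he
lemma Rung.par (h : CVT G) (hnb : ¬ G.Colorable 2) (htf : TF G) (hall : ∀ v, ∃ p, Rung G v p) {v p q s : V} (hR : Rung G v p)
    (hq : G.Adj v q) (hqp : q ≠ p) (hs : Rung G q s) : G.Adj p s := by
  obtain ⟨r, o, o', nv, np, qo, ro, hrp, hrq, hov, hov', hoo⟩ := hR.expand h hnb htf hq hqp
  have vp := hR.1
  have vr : G.Adj v r := by simp [nv]
  have po : G.Adj p o := by simp [np]
  have po' : G.Adj p o' := by simp [np]
  obtain ⟨qh, q3v, q3o, nq⟩ := nbr_iff h.cub hq.symm qo hov.symm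
  have qq3 : G.Adj q qh := by simp [nq]
  rcases (nq s).1 hs.1 with rfl | rfl | rfl
  · exact (hqp ((hs.symm h hnb htf).uniq h hnb htf hR)).elim
  · exact po
  exfalso
  have hvne : p ≠ q := hqp.symm
  have npq3 : ¬ G.Adj p s := by
    intro hh
    rcases (np s).1 hh with rfl | rfl | rfl
    · exact q3v rfl
    · exact q3o rfl
    · exact noK h hnb htf hvne hov.symm hov'.symm hoo vp.symm po po' hq.symm qo qq3
  have rs : G.Adj r s := by
    obtain ⟨t, aa, af, ah⟩ := hs.2 v hq.symm q3v.symm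
    rcases (nv t).1 ah with rfl | rfl | rfl
    · exact absurd aa.symm npq3
    · exact absurd rfl af
    · exact aa.symm
  obtain ⟨oa, o3p, o3q, no⟩ := nbr_iff h.cub po.symm qo.symm hvne
  have oo3 : G.Adj o oa := by simp [no]
  have o3s : G.Adj oa s := by
    obtain ⟨t, aa, af, ah⟩ := hs.2 o qo q3o.symm
    rcases (no t).1 ah with rfl | rfl | rfl
    · exact absurd aa.symm npq3
    · exact absurd rfl af
    · exact aa.symm
  have o's : o' ≠ s := by rintro rfl; exact npq3 po'
  have nr := nbr_iff3 h.cub vr.symm ro rs hov'.symm q3v.symm o's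
  have ro3 : r ≠ oa := by
    rintro rfl
    rcases (nr o).1 oo3.symm with e | e | e
    · exact hov e
    · exact hoo e
    · exact q3o e.symm
  have ns := nbr_iff3 h.cub qq3.symm rs.symm o3s.symm hrq.symm o3q.symm ro3
  obtain ⟨xe, -, -, no'⟩ := nbr_iff h.cub po'.symm ro.symm hrp.symm
  obtain ⟨xf, -, -, no3⟩ := nbr_iff h.cub oo3.symm o3s q3o.symm
  set L : List (V × ℕ) := [(v,0),(p,0),(q,0),(o,0),(r,0),(s,0),(o',1),(oa,1)] with hL
  set X := (L.map Prod.fst).toFinset with hX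
  have hmem : ∀ e, e ∈ X ↔ e = v ∨ e = p ∨ e = q ∨ e = o ∨ e = r ∨ e = s ∨ e = o' ∨ e = oa := by intro e; simp [hX, hL]
  have hd := dd_le_list (G := G) L X hX (by
    simp only [hL, List.forall_mem_cons, List.not_mem_nil, false_imp_iff, implies_true, and_true]
    refine ⟨out0 nv ?_ ?_ ?_, out0 np ?_ ?_ ?_, out0 nq ?_ ?_ ?_, out0 no ?_ ?_ ?_, out0 nr ?_ ?_ ?_, out0 ns ?_ ?_ ?_,
      out1 no' ?_ ?_, out1 no3 ?_ ?_⟩ <;> simp [hmem])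
  simp [hL] at hd
  have aa := one_lt_card.2 ⟨v, (hmem v).2 (by simp), p, (hmem p).2 (by simp), vp.ne⟩
  have af := cut2 h X (by omega)
  have ah : Xᶜ.card = 0 := by omega
  rw [card_eq_zero, compl_eq_empty_iff] at ah
  apply hnb
  apply bip {v, o, o', s} oa
  · intro e he f hf hef
    simp at he hf
    rcases he with rfl | rfl | rfl | rfl <;> rcases hf with rfl | rfl | rfl | rfl <;>
    first
    | exact hef.ne rfl
    | exact htf _ _ _ vp po hef.symm
    | exact htf _ _ _ vp po' hef.symm
    | exact htf _ _ _ hq qq3 hef.symm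
    | exact htf _ _ _ vp po hef
    | exact htf _ _ _ vp po' hef
    | exact htf _ _ _ hq qq3 hef
    | exact htf _ _ _ po hef po'.symm
    | exact htf _ _ _ po' hef po.symm
    | exact htf _ _ _ qo hef qq3.symm
    | exact htf _ _ _ qq3 hef qo.symm
    | exact htf _ _ _ ro hef rs.symm
    | exact htf _ _ _ rs hef ro.symm
  · intro e he hez f hef
    have hm := (hmem e).1 (by rw [ah]; simp)
    simp at he ⊢
    rcases hm with rfl | rfl | rfl | rfl | rfl | rfl | rfl | rfl
    · simp at he
    · rcases (np f).1 hef with e | e | e <;> simp [e]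
    · rcases (nq f).1 hef with e | e | e <;> simp [e]
    · simp at he
    · rcases (nr f).1 hef with e | e | e <;> simp [e]
    · simp at he
    · simp at he
    · exact absurd rfl hez
lemma circ_hom (hcon : G.Connected) (hc : Cub G) {a b : ℕ} (ha : 0 < a) (hab : a < b)
    (g : ℕ → V) (hper : ∀ w, g (w + 2 * b) = g w) (hinj : ∀ i j, i < 2 * b → j < 2 * b → g i = g j → i = j)
    (aa : ∀ w, G.Adj (g w) (g (w + a))) (af : ∀ w, G.Adj (g w) (g (w + b))) :
    Nonempty (G ≃g circThree (2 * b) a (2 * b - a) b) := by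
  haveI : NeZero (2 * b) := ⟨by omega⟩
  have hmod : ∀ w, g (w % (2 * b)) = g w := by
    intro w
    have : ∀ k r, g (r + k * (2 * b)) = g r := by
      intro k r
      induction k with
      | zero => simp
      | succ k ih => rw [Nat.succ_mul, ← add_assoc, hper, ih]
    conv_rhs => rw [← Nat.mod_add_div w (2 * b), mul_comm (2 * b) (w / (2 * b)), this]
  have hval : ∀ (z : ZMod (2 * b)) (k : ℕ), g (z + (k : ZMod (2*b))).val = g (z.val + k) := by
    intro z k
    rw [ZMod.val_add, hmod, ZMod.val_natCast, ← hmod, Nat.add_mod_mod, hmod]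
  have hM : ((2 * b - a : ℕ) : ZMod (2 * b)) = - (a : ZMod (2*b)) := by
    rw [Nat.cast_sub (by omega), ZMod.natCast_self, zero_sub]
  have hbb : (b : ZMod (2*b)) = - b := by
    have := ZMod.natCast_self (2 * b)
    push_cast at this
    linear_combination this
  have hfi : Function.Injective (fun z : ZMod (2 * b) => g z.val) := by
    intro x y hxy
    exact ZMod.val_injective _ (hinj _ _ x.val_lt y.val_lt hxy)
  have ne1 : ∀ z : ZMod (2 * b), g (z + (a : ZMod (2*b))).val ≠ g z.val := by
    intro z; rw [hval]; exact (aa _).ne'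
  have ne2 : ∀ z : ZMod (2 * b), g (z + (b : ZMod (2*b))).val ≠ g z.val := by
    intro z; rw [hval]; exact (af _).ne'
  have cne : ∀ i j : ℕ, i < 2 * b → j < 2 * b → i ≠ j → (i : ZMod (2 * b)) ≠ j := by
    intro i j hi hj hij he
    have := congrArg ZMod.val he
    rw [ZMod.val_natCast, ZMod.val_natCast, Nat.mod_eq_of_lt hi, Nat.mod_eq_of_lt hj] at this
    exact hij this
  refine iso_of_hom hcon hc ?_ (fun z => g z.val) hfi ?_
  · intro w
    refine ⟨w + a, w + (2 * b - a : ℕ), w + b, ?_, ?_, ?_, ?_, ?_, ?_⟩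
    · exact fun h => cne a (2*b-a) (by omega) (by omega) (by omega) (add_left_cancel h)
    · exact fun h => cne a b (by omega) (by omega) (by omega) (add_left_cancel h)
    · exact fun h => cne (2*b-a) b (by omega) (by omega) (by omega) (add_left_cancel h)
    · rw [circ_adj]; exact ⟨fun h => ne1 w (by rw [← h]), Or.inr (Or.inl (by ring))⟩
    · rw [circ_adj]; refine ⟨fun h => ?_, Or.inr (Or.inr (Or.inl (by ring)))⟩
      have := cne (2*b-a) 0 (by omega) (by omega) (by omega)
      apply this
      rw [Nat.cast_zero]
      exact (left_eq_add.1 h)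
    · rw [circ_adj]; exact ⟨fun h => ne2 w (by rw [← h]), Or.inr (Or.inr (Or.inr (by ring)))⟩
  · intro u v huv
    rw [circ_adj, hM] at huv
    have A : ∀ x y : ZMod (2 * b), x = y + a → G.Adj (g x.val) (g y.val) := by
      rintro x y rfl; rw [hval]; exact (aa _).symm
    have B : ∀ x y : ZMod (2 * b), x = y + b → G.Adj (g x.val) (g y.val) := by
      rintro x y rfl; rw [hval]; exact (af _).symm
    rcases huv with ⟨-, (h | h | h) | (h | h | h)⟩
    · exact A _ _ (by rw [← h]; ring)
    · exact (A v u (by linear_combination -h)).symm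
    · exact B _ _ (by rw [← h]; ring)
    · exact (A v u (by linear_combination h)).symm
    · exact (A u v (by linear_combination -h))
    · exact (B v u (by linear_combination h)).symm
structure Lad (G : SimpleGraph V) (μ : V → V) (F : ℕ → V) : Prop where
  inv : ∀ v, μ (μ v) = v
  adj : ∀ v, G.Adj v (μ v)
  aut : ∀ u v, G.Adj u v → G.Adj (μ u) (μ v)
  step : ∀ i, G.Adj (F i) (F (i+1))
  nr : ∀ i, F (i+1) ≠ μ (F i)
  nb : ∀ i, F (i+2) ≠ F i
variable {μ : V → V} {F : ℕ → V}
lemma Lad.iter2 (L : Lad G μ F) (c : ℕ) (v : V) : μ^[c] v = if c % 2 = 0 then v else μ v := by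
  induction c with
  | zero => simp
  | succ c ih =>
    rw [Function.iterate_succ_apply', ih]
    have := L.inv
    split_ifs <;> first | omega | simp [this]
lemma Lad.iterAdj (L : Lad G μ F) (c : ℕ) {u v : V} (h : G.Adj u v) : G.Adj (μ^[c] u) (μ^[c] v) := by
  rw [L.iter2, L.iter2]; split_ifs; exact h; exact L.aut _ _ h
lemma Lad.iterR (L : Lad G μ F) (c : ℕ) {u : V} : G.Adj (μ^[c] u) (μ^[c+1] u) := by
  rw [Function.iterate_succ_apply']; exact L.adj _
lemma Lad.iterEq (L : Lad G μ F) {a b : ℕ} {u : V} : μ^[a] u = μ^[b] u ↔ a % 2 = b % 2 := by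
  rw [L.iter2, L.iter2]
  have := (L.adj u).ne
  have := this.symm
  split_ifs <;> simp [*] <;> omega
lemma Lad.move (L : Lad G μ F) {a b : ℕ} {u v : V} (h : μ^[a] u = μ^[b] v) : u = μ^[a+b] v := by
  have := congrArg (μ^[a]) h
  rw [← Function.iterate_add_apply, ← Function.iterate_add_apply, L.iter2 (a+a), if_pos (by omega)] at this
  exact this
lemma Lad.nbrs (L : Lad G μ F) (hc : Cub G) (c i : ℕ) {e : V} (he : G.Adj (μ^[c] (F (i+1))) e) :
    e = μ^[c] (F i) ∨ e = μ^[c] (F (i+2)) ∨ e = μ^[c+1] (F (i+1)) := by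
  have hj := Function.Injective.iterate (show Function.Injective μ from Function.LeftInverse.injective L.inv) c
  refine nbr_all hc (L.iterAdj c (L.step i).symm) (L.iterAdj c (L.step (i+1))) (L.iterR c) ?_ ?_ ?_ he
  · exact fun h => L.nb i (hj h).symm
  · intro h
    rw [Function.iterate_succ_apply] at h
    have := hj h
    exact L.nr i (by rw [this, L.inv])
  · intro h
    rw [Function.iterate_succ_apply] at h
    exact L.nr (i+1) (hj h)
lemma Lad.period (L : Lad G μ F) (htf : TF G) (hc : Cub G) : ∃ N c : ℕ, 0 < N ∧ F N = μ^[c] (F 0) ∧ F (N+1) = μ^[c] (F 1) ∧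
    ∀ i j a, j < N → i < j → F j ≠ μ^[a] (F i) := by
  have hex : ∃ N, ∃ i < N, ∃ a, F N = μ^[a] (F i) := by
    obtain ⟨x, y, hxy, hne⟩ := Function.not_injective_iff.1 (not_injective_infinite_finite F)
    rcases lt_or_gt_of_ne hne with h | h
    · exact ⟨y, x, h, 0, hxy.symm⟩
    · exact ⟨x, y, h, 0, hxy⟩
  obtain ⟨N, ⟨i, hi, a, ha⟩, hmin⟩ : ∃ N, (∃ i < N, ∃ a, F N = μ^[a] (F i)) ∧ ∀ i j a, j < N → i < j → F j ≠ μ^[a] (F i) := by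
    classical
    exact ⟨Nat.find hex, Nat.find_spec hex, fun i j a hj hi h => Nat.find_min hex hj ⟨i, hi, a, h⟩⟩
  obtain ⟨M, rfl⟩ : ∃ M, N = M + 1 := ⟨N - 1, by omega⟩
  have hMa : ∀ a, F (M+1) ≠ μ^[a] (F M) := by
    intro a h
    rw [L.iter2] at h
    split_ifs at h
    · exact (L.step M).ne h.symm
    · exact L.nr M h
  have hiM : i ≠ M := by rintro rfl; exact hMa _ ha
  have hadj : G.Adj (μ^[a] (F i)) (F M) := by rw [← ha]; exact (L.step M).symm
  have hM2 : M ≠ i + 1 := by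
    rintro rfl
    rw [L.iter2] at ha
    split_ifs at ha with af
    · exact L.nb i ha
    · exact htf _ _ _ (L.step i) (L.step (i+1)) (by rw [show F (i+1+1) = μ (F i) from ha]; exact (L.adj _).symm)
  have am : i = 0 := by
    by_contra am
    obtain ⟨k, rfl⟩ : ∃ k, i = k + 1 := ⟨i - 1, by omega⟩
    rcases L.nbrs hc a k hadj with h | h | h
    · exact hmin k M a (by omega) (by omega) h
    · by_cases aj : k + 2 = M
      · exact hM2 (by omega)
      · exact hmin (k+2) M a (by omega) (by omega) h
    · exact hmin (k+1) M (a+1) (by omega) (by omega) h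
  subst am
  refine ⟨M+1, a, by omega, ha, ?_, hmin⟩
  have aa : G.Adj (μ^[0] (F (M+1))) (μ^[a] (F 1)) := by
    rw [ha]; simpa using L.iterAdj a (L.step 0)
  rcases L.nbrs hc 0 M aa with h | h | h
  · exact absurd (h.symm) (hmin 1 M a (by omega) (by omega))
  · exact h.symm
  · rw [ha, ← Function.iterate_add_apply] at h
    have := L.move h
    have an := L.nr 0
    have ao := L.step 0
    rw [L.iter2] at this
    split_ifs at this
    · exact absurd this.symm ao.ne
    · exact absurd this an
lemma Lad.main (h : CVT G) (hnb : ¬ G.Colorable 2) (htf : TF G) (L : Lad G μ F) :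
    (∃ n, 2 ≤ n ∧ Nonempty (G ≃g circThree (4 * n) 1 (4 * n - 1) (2 * n))) ∨
    (∃ n, 2 ≤ n ∧ Nonempty (G ≃g circThree (4 * n + 2) 2 (4 * n) (2 * n + 1))) := by
  classical
  obtain ⟨N, c, hN, ee, ea, hmin⟩ := L.period htf h.cub
  have hper : ∀ i, F (i + N) = μ^[c] (F i) ∧ F (i + 1 + N) = μ^[c] (F (i+1)) := by
    intro i
    induction i with
    | zero => exact ⟨by simpa using ee, by simpa [add_comm] using ea⟩
    | succ i ih =>
      refine ⟨ih.2, ?_⟩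
      have aa : G.Adj (μ^[c] (F (i+1))) (F (i+1+1+N)) := by
        rw [← ih.2]
        have := L.step (i+1+N)
        rwa [show i+1+N+1 = i+1+1+N by omega] at this
      rcases L.nbrs h.cub c i aa with af | af | af
      · rw [← ih.1] at af
        have := L.nb (i+N)
        exact absurd af (by rwa [show i+1+1+N = i+N+2 by omega])
      · exact af
      · rw [Function.iterate_succ_apply', ← ih.2] at af
        have := L.nr (i+1+N)
        exact absurd af (by rwa [show i+1+1+N = i+1+N+1 by omega])
  have hperk : ∀ k i, F (i + k * N) = μ^[c * k] (F i) := by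
    intro k i
    induction k with
    | zero => simp
    | succ k ih =>
      rw [Nat.succ_mul, ← add_assoc, (hper _).1, ih, ← Function.iterate_add_apply]
      rw [Nat.mul_succ, add_comm c]
  have hred : ∀ i, F i = μ^[c * (i / N)] (F (i % N)) := by
    intro i
    rw [← hperk]; congr 1; rw [mul_comm (i / N) N, Nat.mod_add_div]
  have key : ∀ i j s t, μ^[s] (F i) = μ^[t] (F j) → i % N = j % N ∧ (s + c * (i / N)) % 2 = (t + c * (j / N)) % 2 := by
    intro i j s t he
    rw [hred i, hred j, ← Function.iterate_add_apply, ← Function.iterate_add_apply] at he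
    have hr : i % N = j % N := by
      rcases lt_trichotomy (i % N) (j % N) with hh | hh | hh
      · exact absurd (L.move he.symm) (hmin _ _ _ (Nat.mod_lt _ hN) hh)
      · exact hh
      · exact absurd (L.move he) (hmin _ _ _ (Nat.mod_lt _ hN) hh)
    rw [hr, L.iterEq] at he
    exact ⟨hr, he⟩
  have hcov : ∀ v, ∃ s i, v = μ^[s] (F i) := by
    set X : Finset V := univ.filter (fun v => ∃ s i, v = μ^[s] (F i)) with hX
    have hcl : ∀ u ∈ X, ∀ v, G.Adj u v → v ∈ X := by
      intro u hu v huv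
      simp only [hX, mem_filter, mem_univ, true_and] at hu ⊢
      obtain ⟨s, i, rfl⟩ := hu
      have : ∃ s' i', μ^[s] (F i) = μ^[s'] (F (i' + 1)) := by
        refine ⟨s + c, i + N - 1, ?_⟩
        rw [show i + N - 1 + 1 = i + N by omega, (hper i).1, ← Function.iterate_add_apply, L.iterEq]
        omega
      obtain ⟨s', i', e⟩ := this
      rw [e] at huv
      rcases L.nbrs h.cub _ _ huv with h | h | h <;> exact ⟨_, _, h⟩
    have hd : dd G X = 0 := by
      rw [dd_eq_sum]
      apply sum_eq_zero
      intro u hu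
      rw [card_eq_zero, sdiff_eq_empty_iff_subset]
      intro v hv
      exact hcl u hu v (by simpa using hv)
    rcases dd_zero h.conn hd with h' | h'
    · have : F 0 ∈ X := by simp only [hX, mem_filter, mem_univ, true_and]; exact ⟨0, 0, rfl⟩
      rw [h'] at this; simp at this
    · intro v
      have : v ∈ X := by rw [h']; simp
      simpa only [hX, mem_filter, mem_univ, true_and] using this
  have hpar : ∀ i, i % 2 = (i % N + (i / N) * N) % 2 := by
    intro i; conv_lhs => rw [← Nat.mod_add_div i N, mul_comm]
  have hodd : (N + c) % 2 = 1 := by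
    by_contra hev
    apply hnb
    have hcol : ∀ i j s t, μ^[s] (F i) = μ^[t] (F j) → (s + i) % 2 = (t + j) % 2 := by
      intro i j s t he
      obtain ⟨aa, af⟩ := key _ _ _ _ he
      have ah := hpar i
      have ag := hpar j
      rw [aa] at ah
      have aj : N % 2 = c % 2 := by omega
      have an : ∀ k, (k * N) % 2 = (c * k) % 2 := by
        intro k; rw [Nat.mul_mod, aj, ← Nat.mul_mod, mul_comm]
      have ao := an (i / N)
      have av := an (j / N)
      omega
    choose S I hSI using hcov
    refine ⟨Coloring.mk (fun v => (⟨(S v + I v) % 2, Nat.mod_lt _ (by omega)⟩ : Fin 2)) ?_⟩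
    intro u v huv heq
    simp only [Fin.mk.injEq] at heq
    obtain ⟨s', i', e⟩ : ∃ s' i', μ^[S u] (F (I u)) = μ^[s'] (F (i' + 1)) := by
      refine ⟨S u + c, I u + N - 1, ?_⟩
      rw [show I u + N - 1 + 1 = I u + N by omega, (hper _).1, ← Function.iterate_add_apply, L.iterEq]
      omega
    have pf := hcol _ _ _ _ e
    rw [hSI u, e] at huv
    rcases L.nbrs h.cub _ _ huv with h | h | h <;>
    · rw [hSI v] at h
      have := hcol _ _ _ _ h
      omega
  have hN1 : N ≠ 1 := by
    rintro rfl
    rw [L.iter2] at ee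
    split_ifs at ee
    · exact (L.step 0).ne ee.symm
    · exact L.nr 0 ee
  have hN2 : N ≠ 2 := by
    rintro rfl
    rw [L.iter2, if_neg (by omega)] at ee
    exact htf _ _ _ (L.step 0) (L.step 1) (by rw [show F (1+1) = μ (F 0) from ee]; exact (L.adj _).symm)
  rcases Nat.even_or_odd' N with ⟨n, hn | hn⟩
  · left
    refine ⟨n, by omega, ?_⟩
    have hc1 : c % 2 = 1 := by omega
    have aa := circ_hom h.conn h.cub (a := 1) (b := N) (by omega) (by omega) F ?_ ?_ L.step ?_
    · rwa [show 4 * n = 2 * N by omega, ← hn]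
    · intro w; have := hperk 2 w; rw [this, L.iter2, if_pos (by omega)]
    · intro i j hi hj he
      obtain ⟨af, ah⟩ := key i j 0 0 he
      have an : ∀ k, (c * k) % 2 = k % 2 := by
        intro k; rw [Nat.mul_mod, hc1]; simp
      have ai := an (i / N)
      have ak := an (j / N)
      have bb : i / N < 2 := Nat.div_lt_of_lt_mul (by omega)
      have ba : j / N < 2 := Nat.div_lt_of_lt_mul (by omega)
      rw [zero_add, zero_add, ai, ak] at ah
      have ca := Nat.mod_add_div i N
      have cb := Nat.mod_add_div j N
      generalize i / N = x at *
      generalize j / N = y at *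
      have hxy : x = y := by omega
      subst hxy
      omega
    · intro w; rw [(hper w).1, L.iter2, if_neg (by omega)]; exact L.adj _
  · right
    have hc0 : c % 2 = 0 := by omega
    have hN3 : N ≠ 3 := by
      rintro rfl
      rw [L.iter2, if_pos hc0] at ee
      exact htf _ _ _ (L.step 0) (L.step 1) (by have := L.step 2; rwa [show 2 + 1 = 3 by rfl, ee] at this)
    refine ⟨n, by omega, ?_⟩
    have hck : ∀ k, (c * k) % 2 = 0 := by intro k; rw [Nat.mul_mod, hc0]; simp
    have hp0 : ∀ k i, F (i + k * N) = F i := by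
      intro k i; rw [hperk, L.iter2, if_pos (hck k)]
    have aa := circ_hom h.conn h.cub (a := 2) (b := N) (by omega) (by omega) (fun w => μ^[w] (F ((n+1) * w))) ?_ ?_ ?_ ?_
    · rwa [show 4 * n + 2 = 2 * N by omega, show 4 * n = 2 * N - 2 by omega, ← hn]
    · intro w
      show μ^[w + 2 * N] (F ((n+1) * (w + 2 * N))) = _
      rw [show (n+1) * (w + 2 * N) = (n+1) * w + (2 * (n+1)) * N by ring, hp0, L.iterEq]
      omega
    · intro i j hi hj he
      obtain ⟨af, ah⟩ := key _ _ _ _ he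
      have ai := hck ((n+1) * i / N)
      have ak := hck ((n+1) * j / N)
      have ag : (2 * ((n+1) * i)) ≡ (2 * ((n+1) * j)) [MOD N] := Nat.ModEq.mul_left 2 af
      have aj : ∀ k, (2 * ((n+1) * k)) ≡ k [MOD N] := by
        intro k
        rw [show 2 * ((n+1) * k) = k + N * k by rw [hn]; ring]
        simp [Nat.ModEq]
      have an : i ≡ j [MOD N] := (aj i).symm.trans (ag.trans (aj j))
      have ao : i ≡ j [MOD 2] := by unfold Nat.ModEq; omega
      have av : i ≡ j [MOD 2 * N] := (Nat.modEq_and_modEq_iff_modEq_mul (by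
        rw [Nat.coprime_two_left]; exact ⟨n, hn⟩)).1 ⟨ao, an⟩
      unfold Nat.ModEq at av
      rwa [Nat.mod_eq_of_lt hi, Nat.mod_eq_of_lt hj] at av
    · intro w
      show G.Adj (μ^[w] (F ((n+1) * w))) (μ^[w+2] (F ((n+1) * (w+2))))
      rw [show (n+1) * (w+2) = (n+1)*w + 1 + 1 * N by rw [hn]; ring, hp0, L.iterEq.2 (show (w+2)%2 = w % 2 by omega)]
      exact L.iterAdj w (L.step _)
    · intro w
      show G.Adj (μ^[w] (F ((n+1) * w))) (μ^[w+N] (F ((n+1) * (w+N))))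
      rw [show (n+1) * (w+N) = (n+1)*w + (n+1) * N by ring, hp0, L.iterEq.2 (show (w+N)%2 = (w+1) % 2 by omega)]
      exact L.iterR w
lemma exists_other' {w b c d u m : V} (aa : G.Adj w b) (af : G.Adj w c) (ah : G.Adj w d) (ag : b ≠ c) (aj : b ≠ d) (an : c ≠ d) :
    ∃ x, G.Adj w x ∧ x ≠ u ∧ x ≠ m := by
  by_cases ea : b = u ∨ b = m
  · by_cases eb : c = u ∨ c = m
    · refine ⟨d, ah, ?_, ?_⟩
      · rintro rfl; rcases ea with e | e <;> rcases eb with f | f <;> simp_all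
      · rintro rfl; rcases ea with e | e <;> rcases eb with f | f <;> simp_all
    · push Not at eb; exact ⟨c, af, eb⟩
  · push Not at ea; exact ⟨b, aa, ea⟩
lemma rung_main (h : CVT G) (hnb : ¬ G.Colorable 2) (htf : TF G) {v p : V} (hR : Rung G v p) :
    (∃ n, 2 ≤ n ∧ Nonempty (G ≃g circThree (4 * n) 1 (4 * n - 1) (2 * n))) ∨
    (∃ n, 2 ≤ n ∧ Nonempty (G ≃g circThree (4 * n + 2) 2 (4 * n) (2 * n + 1))) := by
  have hall : ∀ v, ∃ p, Rung G v p := by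
    intro w
    obtain ⟨φ, rfl⟩ := h.vt v w
    refine ⟨φ p, φ.map_adj_iff.2 hR.1, ?_⟩
    intro q hq hqp
    obtain ⟨q', rfl⟩ := φ.surjective q
    obtain ⟨o, aa, af, ah⟩ := hR.2 q' (φ.map_adj_iff.1 hq) (fun e => hqp (by rw [e]))
    exact ⟨φ o, φ.map_adj_iff.2 aa, φ.injective.ne af, φ.map_adj_iff.2 ah⟩
  choose μ hμ using hall
  have hinv : ∀ v, μ (μ v) = v := fun v => (hμ (μ v)).uniq h hnb htf ((hμ v).symm h hnb htf)
  have hσ : ∀ u w, ∃ x, G.Adj w x ∧ x ≠ u ∧ x ≠ μ w := by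
    intro u w
    obtain ⟨b, c, d, aa, af, ah, ag, aj, an, -⟩ := nbr3 h.cub w
    obtain ⟨x, hx, ea, eb⟩ := exists_other' aa af ah ag aj an (u := u) (m := μ w)
    exact ⟨x, hx, ea, eb⟩
  choose σ sa sb sd using hσ
  let P : ℕ → V × V := fun n => (fun q : V × V => (q.2, σ q.1 q.2))^[n] (v, σ v v)
  have hP : ∀ n, P (n+1) = ((P n).2, σ (P n).1 (P n).2) := fun n => by
    simp only [P]; rw [Function.iterate_succ_apply']
  have hP2 : ∀ n, (P n).2 = (P (n+1)).1 := fun n => by rw [hP]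
  have hst : ∀ n, G.Adj (P n).1 (P (n+1)).1 ∧ (P (n+1)).1 ≠ μ (P n).1 := by
    intro n
    cases n with
    | zero => rw [← hP2]; exact ⟨sa v v, sd v v⟩
    | succ n => rw [← hP2 (n+1), hP n]; exact ⟨sa _ _, sd _ _⟩
  refine Lad.main h hnb htf (μ := μ) (F := fun n => (P n).1) ⟨hinv, fun v => (hμ v).1, ?_, fun i => (hst i).1, fun i => (hst i).2, ?_⟩
  · intro u w huw
    by_cases hw : w = μ u
    · subst hw; rw [hinv]; exact huw.symm
    · have := Rung.par h hnb htf (fun v => ⟨_, hμ v⟩) (hμ u) huw hw (hμ w)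
      exact this
  · intro i
    show (P (i+1+1)).1 ≠ (P i).1
    rw [← hP2, hP]
    exact sb _ _
structure S4 (G : SimpleGraph V) (o l p : V → V) : Prop where
  oo : ∀ v, o (o v) = v
  ll : ∀ v, l (l v) = v
  one : ∀ v, o v ≠ v
  nb : ∀ v e, G.Adj v e ↔ e = p v ∨ e = o (p v) ∨ e = l v
  no : ∀ v e, G.Adj (o v) e ↔ e = p v ∨ e = o (p v) ∨ e = l (o v)
  np : ∀ v e, G.Adj (p v) e ↔ e = v ∨ e = o v ∨ e = l (p v)
  da : ∀ v, p v ≠ l v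
  db : ∀ v, o (p v) ≠ l v
  eqo : ∀ (φ : G ≃g G) v, φ (o v) = o (φ v)
  eql : ∀ (φ : G ≃g G) v, φ (l v) = l (φ v)
  sq : ∀ v u w w', G.Adj v w → G.Adj v w' → w ≠ w' → u ≠ v → G.Adj u w → G.Adj u w' → u = o v ∧ w ≠ l v ∧ w' ≠ l v
lemma isO_uniq_aux (h : CVT G) (hnb : ¬ G.Colorable 2) (htf : TF G) (hR : ∀ v p, ¬ Rung G v p) {v u u' p q r : V}
    (hu : u ≠ v) (hu' : u' ≠ v) (hpq : p ≠ q) (hpr : p ≠ r) (hqr : q ≠ r) (vp : G.Adj v p) (vq : G.Adj v q) (vr : G.Adj v r)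
    (up : G.Adj u p) (uq : G.Adj u q) (up' : G.Adj u' p) (ur' : G.Adj u' r) : False := by
  apply hR v p
  refine ⟨vp, fun e he hep => ?_⟩
  rcases nbr_all h.cub vp vq vr hpq hpr hqr he with rfl | rfl | rfl
  · exact absurd rfl hep
  · exact ⟨u, up.symm, hu, uq.symm⟩
  · exact ⟨u', up'.symm, hu', ur'.symm⟩
lemma isO_uniq (h : CVT G) (hnb : ¬ G.Colorable 2) (htf : TF G) (hR : ∀ v p, ¬ Rung G v p) {v u u' p q p' q' : V}
    (hu : u ≠ v) (hu' : u' ≠ v) (hpq : p ≠ q) (vp : G.Adj v p) (vq : G.Adj v q) (up : G.Adj u p) (uq : G.Adj u q)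
    (hpq' : p' ≠ q') (vp' : G.Adj v p') (vq' : G.Adj v q') (up' : G.Adj u' p') (uq' : G.Adj u' q') :
    u = u' ∧ ((p = p' ∧ q = q') ∨ (p = q' ∧ q = p')) := by
  obtain ⟨r, hrp, hrq, nv⟩ := nbr_iff h.cub vp vq hpq
  have vr : G.Adj v r := by simp [nv]
  have A := fun {u'} (hu' : u' ≠ v) => isO_uniq_aux h hnb htf hR (u' := u') hu hu' hpq hrp.symm hrq.symm vp vq vr up uq
  have B := fun {u'} (hu' : u' ≠ v) => isO_uniq_aux h hnb htf hR (u' := u') hu hu' hpq.symm hrq.symm hrp.symm vq vp vr uq up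
  have C : ∀ u', u' ≠ v → G.Adj u' p → G.Adj u' q → u = u' := by
    intro u' aa af ah
    by_contra hne
    exact noK h hnb htf hpq hu.symm aa.symm hne vp.symm up.symm af.symm vq.symm uq.symm ah.symm
  rcases (nv p').1 vp' with rfl | rfl | rfl <;> rcases (nv q').1 vq' with rfl | rfl | rfl
  · exact absurd rfl hpq'
  · exact ⟨C _ hu' up' uq', Or.inl ⟨rfl, rfl⟩⟩
  · exact (A hu' up' uq').elim
  · exact ⟨C _ hu' uq' up', Or.inr ⟨rfl, rfl⟩⟩
  · exact absurd rfl hpq'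
  · exact (B hu' up' uq').elim
  · exact (A hu' uq' up').elim
  · exact (B hu' uq' up').elim
  · exact absurd rfl hpq'
lemma exists_S4 (h : CVT G) (hnb : ¬ G.Colorable 2) (htf : TF G) (hR : ∀ v p, ¬ Rung G v p) (ag : ¬ F4 G) :
    ∃ o l p, S4 G o l p := by
  have hO : ∀ v, ∃ u p q, u ≠ v ∧ p ≠ q ∧ G.Adj v p ∧ G.Adj v q ∧ G.Adj u p ∧ G.Adj u q := by
    intro v
    unfold F4 at ag
    push Not at ag
    obtain ⟨a, b, c, d, aa, af, ah, aj, an, ao⟩ := ag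
    obtain ⟨φ, rfl⟩ := h.vt a v
    have ao := ao.1
    exact ⟨φ c, φ b, φ d, φ.injective.ne an.symm, φ.injective.ne ao, φ.map_adj_iff.2 aa, φ.map_adj_iff.2 aj.symm,
      φ.map_adj_iff.2 af.symm, φ.map_adj_iff.2 ah⟩
  choose o p q hov hpq vp vq op oq using hO
  have hL := fun v => nbr_iff h.cub (vp v) (vq v) (hpq v)
  choose l hlp hlq nv using hL
  have U := fun {v u a b} (aa : u ≠ v) (af : a ≠ b) (ah : G.Adj v a) (ag : G.Adj v b) (aj : G.Adj u a) (an : G.Adj u b) =>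
    isO_uniq h hnb htf hR (hov v) aa (hpq v) (vp v) (vq v) (op v) (oq v) af ah ag aj an
  have oo : ∀ v, o (o v) = v := fun v =>
    (U (v := o v) (hov v).symm (hpq v) (op v) (oq v) (vp v) (vq v)).1
  have oq' : ∀ v, o (p v) = q v := fun v =>
    (U (v := p v) (hpq v).symm (hov v) (op v).symm (vp v).symm (oq v).symm (vq v).symm).1
  have hlo : ∀ v, ¬ G.Adj (o v) (l v) := by
    intro v hh
    have := (U (v := v) (hov v) (hlp v).symm (vp v) ((nv v _).2 (by simp)) (op v) hh).2
    rcases this with h' | h'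
    · exact hlq v h'.2.symm
    · exact hlp v h'.1.symm
  have sq : ∀ v u w w', G.Adj v w → G.Adj v w' → w ≠ w' → u ≠ v → G.Adj u w → G.Adj u w' → u = o v ∧ w ≠ l v ∧ w' ≠ l v := by
    intro v u w w' aa af ah ag aj an
    have := (U (v := v) ag ah aa af aj an).1
    subst this
    exact ⟨rfl, fun e => hlo v (e ▸ aj), fun e => hlo v (e ▸ an)⟩
  have hl : ∀ v e, G.Adj v e → ¬ G.Adj (o v) e → e = l v := by
    intro v e aa af
    rcases (nv v e).1 aa with rfl | rfl | rfl
    · exact absurd (op v) af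
    · exact absurd (oq v) af
    · rfl
  have lad : ∀ v, G.Adj v (l v) := fun v => (nv v _).2 (by simp)
  have ll : ∀ v, l (l v) = v := by
    intro v
    refine (hl (l v) v (lad v).symm ?_).symm
    intro hh
    have hne : l v ≠ o (l v) := (hov (l v)).symm
    obtain ⟨x, hx1, hx2, hx3⟩ : ∃ x, x ≠ v ∧ G.Adj (l v) x ∧ G.Adj (o (l v)) x := by
      by_cases e : p (l v) = v
      · exact ⟨q (l v), fun e' => hpq (l v) (e.trans e'.symm), vq _, oq _⟩
      · exact ⟨p (l v), e, vp _, op _⟩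
    exact (sq v x (l v) (o (l v)) (lad v) hh.symm hne hx1 hx2.symm hx3.symm).2.1 rfl
  have npl : ∀ v, p v ≠ l v := fun v => (hlp v).symm
  have nql : ∀ v, q v ≠ l v := fun v => (hlq v).symm
  refine ⟨o, l, p, ⟨oo, ll, hov, ?_, ?_, ?_, npl, ?_, ?_, ?_, sq⟩⟩
  · intro v e; rw [nv, oq']
  · intro v
    have hpl : p v ≠ l (o v) := fun e => hlo (o v) (by rw [← e, oo]; exact vp v)
    have hql : q v ≠ l (o v) := fun e => hlo (o v) (by rw [← e, oo]; exact vq v)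
    rw [oq']
    exact nbr_iff3 h.cub (op v) (oq v) (lad (o v)) (hpq v) hpl hql
  · intro v
    refine nbr_iff3 h.cub (vp v).symm (op v).symm (lad (p v)) (hov v).symm ?_ ?_
    · intro e; have eb := congrArg l e; rw [ll] at eb; exact npl v eb.symm
    · intro e
      have : p v = l (o v) := by rw [e, ll]
      exact hlo (o v) (by rw [← this, oo]; exact vp v)
  · intro v; rw [oq']; exact nql v
  · intro φ v
    exact (U (v := φ v) (φ.injective.ne (hov v)) (φ.injective.ne (hpq v)) (φ.map_adj_iff.2 (vp v)) (φ.map_adj_iff.2 (vq v))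
      (φ.map_adj_iff.2 (op v)) (φ.map_adj_iff.2 (oq v))).1.symm
  · intro φ v
    have he : φ (o v) = o (φ v) := (U (v := φ v) (φ.injective.ne (hov v)) (φ.injective.ne (hpq v)) (φ.map_adj_iff.2 (vp v)) (φ.map_adj_iff.2 (vq v))
      (φ.map_adj_iff.2 (op v)) (φ.map_adj_iff.2 (oq v))).1.symm
    apply hl
    · exact φ.map_adj_iff.2 (lad v)
    · rw [← he, φ.map_adj_iff]; exact hlo v
variable {o l p : V → V}
def ZZ (o p : V → V) (v : V) : Finset V := {v, o v, p v, o (p v)}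
def Cl (o p : V → V) (D : Finset V) : Prop := ∀ v, (o v ∈ D ↔ v ∈ D) ∧ (p v ∈ D ↔ v ∈ D)
lemma S4.po (S : S4 G o l p) (v : V) : p (o v) = p v ∨ p (o v) = o (p v) := by
  have h := (S.nb (o v) (p (o v))).2 (by simp)
  rcases (S.no v _).1 h with h | h | h
  · exact Or.inl h
  · exact Or.inr h
  · exact absurd h (S.da _)
lemma S4.pp (S : S4 G o l p) (v : V) : p (p v) = v ∨ p (p v) = o v := by
  have h := (S.nb (p v) (p (p v))).2 (by simp)
  rcases (S.np v _).1 h with h | h | h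
  · exact Or.inl h
  · exact Or.inr h
  · exact absurd h (S.da _)
lemma S4.ap (S : S4 G o l p) (v : V) : G.Adj v (p v) := by simp [S.nb]
lemma S4.aop (S : S4 G o l p) (v : V) : G.Adj v (o (p v)) := by simp [S.nb]
lemma S4.al (S : S4 G o l p) (v : V) : G.Adj v (l v) := by simp [S.nb]
lemma S4.oap (S : S4 G o l p) (v : V) : G.Adj (o v) (p v) := by simp [S.no]
lemma S4.oaop (S : S4 G o l p) (v : V) : G.Adj (o v) (o (p v)) := by simp [S.no]
lemma S4.nao (S : S4 G o l p) (htf : TF G) (v : V) : ¬ G.Adj v (o v) := fun h =>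
  htf _ _ _ h (S.oap v) (S.ap v).symm
lemma S4.lo (S : S4 G o l p) (htf : TF G) (v : V) : l v ≠ o v := fun h => S.nao htf v (h ▸ S.al v)
lemma ZZ_self (v : V) : v ∈ ZZ o p v := by simp [ZZ]
lemma S4.cardZ (S : S4 G o l p) (v : V) : (ZZ o p v).card = 4 := by
  have aa := S.one v
  have af := S.one (p v)
  have ah := (S.ap v).ne
  have ag := (S.aop v).ne
  have aj := (S.oap v).ne
  have an := (S.oaop v).ne
  unfold ZZ
  rw [card_eq_of_equiv_fin]
  exact (equivFinOfCardEq (by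
    rw [card_insert_of_notMem (by simp [aa.symm, ah, ag]), card_insert_of_notMem (by simp [aj, an]),
      card_insert_of_notMem (by simp [af.symm]), card_singleton]))
lemma S4.Zsub (S : S4 G o l p) {v w : V} (h : w ∈ ZZ o p v) : ZZ o p w ⊆ ZZ o p v := by
  intro x hx
  simp only [ZZ, mem_insert, mem_singleton] at h hx ⊢
  have aa := S.po v
  have af := S.pp v
  have ah := S.po (p v)
  have ag := S.oo v
  have aj := S.oo (p v)
  rcases h with rfl | rfl | rfl | rfl
  · exact hx
  · rcases aa with aa | aa <;> simp only [aa, ag, aj] at hx <;> rcases hx with h | h | h | h <;> simp [h]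
  · rcases af with aa | aa <;> simp only [aa, ag, aj] at hx <;> rcases hx with h | h | h | h <;> simp [h]
  · rcases ah with aa | aa <;> rcases af with af | af <;> simp only [aa, af, ag, aj] at hx <;> rcases hx with h | h | h | h <;> simp [h]
lemma S4.Zeq (S : S4 G o l p) {v w : V} (h : w ∈ ZZ o p v) : ZZ o p w = ZZ o p v :=
  eq_of_subset_of_card_le (S.Zsub h) (by rw [S.cardZ, S.cardZ])
lemma S4.Zdisj (S : S4 G o l p) {v w : V} (h : w ∉ ZZ o p v) : Disjoint (ZZ o p v) (ZZ o p w) := by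
  rw [Finset.disjoint_left]
  intro a aa af
  apply h
  rw [← S.Zeq aa, S.Zeq af]; exact ZZ_self w
lemma S4.clZ (S : S4 G o l p) (v : V) : Cl o p (ZZ o p v) := by
  intro w
  constructor
  · constructor
    · intro h
      have := S.Zeq h
      rw [← this]; simp [ZZ, S.oo]
    · intro h; rw [← S.Zeq h]; simp [ZZ]
  · constructor
    · intro h
      have := S.Zeq h
      rw [← this]
      rcases S.pp w with h | h <;> simp [ZZ, S.oo, h]
    · intro h; rw [← S.Zeq h]; simp [ZZ]
lemma Cl.Zsub {D : Finset V} (h : Cl o p D) {v : V} (hv : v ∈ D) : ZZ o p v ⊆ D := by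
  intro w hw
  simp only [ZZ, mem_insert, mem_singleton] at hw
  rcases hw with rfl | rfl | rfl | rfl
  · exact hv
  · exact (h v).1.2 hv
  · exact (h v).2.2 hv
  · exact (h _).1.2 ((h v).2.2 hv)
lemma Cl.compl {D : Finset V} (h : Cl o p D) : Cl o p Dᶜ := by
  intro v; simp [(h v).1, (h v).2]
lemma Cl.inter {D E : Finset V} (h : Cl o p D) (h' : Cl o p E) : Cl o p (D ∩ E) := by
  intro v; simp [(h v).1, (h v).2, (h' v).1, (h' v).2]
lemma Cl.union {D E : Finset V} (h : Cl o p D) (h' : Cl o p E) : Cl o p (D ∪ E) := by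
  intro v; simp [(h v).1, (h v).2, (h' v).1, (h' v).2]
lemma Cl.sdiff {D E : Finset V} (h : Cl o p D) (h' : Cl o p E) : Cl o p (D \ E) := by
  intro v; simp [(h v).1, (h v).2, (h' v).1, (h' v).2]
lemma S4.eqp (S : S4 G o l p) (φ : G ≃g G) (v : V) : p (φ v) = φ (p v) ∨ p (φ v) = φ (o (p v)) := by
  obtain ⟨u, hu⟩ := φ.surjective (p (φ v))
  have h := S.ap (φ v)
  rw [← hu, φ.map_adj_iff, S.nb] at h
  rcases h with rfl | rfl | rfl
  · exact Or.inl hu.symm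
  · exact Or.inr hu.symm
  · exfalso; rw [S.eql] at hu; exact S.da _ hu.symm
lemma S4.clImage (S : S4 G o l p) {D : Finset V} (h : Cl o p D) (φ : G ≃g G) : Cl o p (D.image φ) := by
  have hm : ∀ u, φ u ∈ D.image φ ↔ u ∈ D := by intro u; simp [φ.injective.eq_iff]
  intro v
  obtain ⟨u, rfl⟩ := φ.surjective v
  rw [← S.eqo, hm, hm]
  refine ⟨(h u).1, ?_⟩
  rcases S.eqp φ u with e | e <;> rw [e, hm]
  · exact (h u).2
  · rw [(h _).1, (h u).2]
lemma S4.clCard (S : S4 G o l p) {D : Finset V} (h : Cl o p D) : D = ∅ ∨ (∃ v ∈ D, D = ZZ o p v) ∨ 8 ≤ D.card := by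
  rcases D.eq_empty_or_nonempty with am | ⟨v, hv⟩
  · exact Or.inl am
  right
  by_cases he : D = ZZ o p v
  · exact Or.inl ⟨v, hv, he⟩
  right
  have aa := h.Zsub hv
  obtain ⟨w, hw, hwn⟩ : ∃ w ∈ D, w ∉ ZZ o p v := by
    by_contra! hh
    exact he (Finset.Subset.antisymm hh aa)
  have af := h.Zsub hw
  have ah := card_le_card (union_subset aa af)
  rw [card_union_of_disjoint (S.Zdisj hwn), S.cardZ, S.cardZ] at ah
  omega
lemma S4.ddCl (S : S4 G o l p) {D : Finset V} (h : Cl o p D) : dd G D = (D.filter (fun u => l u ∉ D)).card := by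
  rw [dd_eq_sum, card_filter]
  refine sum_congr rfl fun u hu => ?_
  have aa := (h u).2.2 hu
  have af := (h _).1.2 aa
  split_ifs with hl
  swap
  · rw [card_eq_one]
    refine ⟨l u, ?_⟩
    ext e
    simp only [mem_sdiff, mem_neighborFinset, S.nb, mem_singleton]
    constructor
    · rintro ⟨rfl | rfl | rfl, aj⟩
      · exact absurd aa aj
      · exact absurd af aj
      · rfl
    · rintro rfl; exact ⟨by simp, hl⟩
  · rw [card_eq_zero, sdiff_eq_empty_iff_subset]
    intro e he
    rw [mem_neighborFinset, S.nb] at he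
    rcases he with rfl | rfl | rfl <;> assumption
lemma S4.lZ (S : S4 G o l p) (htf : TF G) (v : V) : l v ∉ ZZ o p v := by
  simp only [ZZ, mem_insert, mem_singleton, not_or]
  exact ⟨(S.al v).ne', S.lo htf v, (S.da v).symm, (S.db v).symm⟩
def NT (o l p : V → V) : Prop := ∀ v w, w ∈ ZZ o p v → w ≠ v → l w ∉ ZZ o p (l v)
lemma S4.dd4 (S : S4 G o l p) (h : CVT G) (htf : TF G) {D : Finset V} (hD : Cl o p D) (aa : D ≠ ∅) (af : Dᶜ ≠ ∅) : 4 ≤ dd G D := by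
  by_contra! hlt
  have ah := cut3 h htf D hlt
  have key : ∀ E : Finset V, Cl o p E → E ≠ ∅ → 4 ≤ E.card := by
    intro E hE hne
    rcases S.clCard hE with h | ⟨v, -, h⟩ | h
    · exact absurd h hne
    · rw [h, S.cardZ]
    · omega
  have := key D hD aa
  have := key _ hD.compl af
  omega
lemma S4.two (S : S4 G o l p) (htf : TF G) (nt : NT o l p) {v w : V} {D : Finset V} (hD : D = ZZ o p v ∪ ZZ o p w) :
    3 ≤ ((ZZ o p v).filter (fun u => l u ∉ D)).card := by
  have aa : ((ZZ o p v).filter (fun u => l u ∈ D)).card ≤ 1 := by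
    rw [card_le_one]
    intro a ha b hb
    simp only [mem_filter, hD, mem_union] at ha hb
    have key : ∀ u, u ∈ ZZ o p v → l u ∉ ZZ o p v := by
      intro u hu; rw [← S.Zeq hu]; exact S.lZ htf u
    have ha2 := ha.2.resolve_left (key a ha.1)
    have hb2 := hb.2.resolve_left (key b hb.1)
    by_contra hne
    refine nt b a ?_ hne ?_
    · rw [S.Zeq hb.1]; exact ha.1
    · rw [S.Zeq hb2]; exact ha2
  have af := card_filter_add_card_filter_not (s := ZZ o p v) (fun u => l u ∈ D)
  rw [S.cardZ] at af
  omega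
lemma S4.linkcut (S : S4 G o l p) (h : CVT G) (htf : TF G) (nt : NT o l p) {D : Finset V} (hD : Cl o p D) (hd : dd G D ≤ 4) :
    D = ∅ ∨ D = univ ∨ (∃ v, D = ZZ o p v) ∨ (∃ v, Dᶜ = ZZ o p v) := by
  classical
  let Bad : Finset V → Prop := fun D => Cl o p D ∧ dd G D ≤ 4 ∧ 8 ≤ D.card ∧ 8 ≤ Dᶜ.card
  suffices hno : ∀ D, ¬ Bad D by
    rcases S.clCard hD with aa | ⟨v, -, aa⟩ | aa
    · exact Or.inl aa
    · exact Or.inr (Or.inr (Or.inl ⟨v, aa⟩))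
    rcases S.clCard hD.compl with af | ⟨v, -, af⟩ | af
    · right; left; exact compl_eq_empty_iff _ |>.1 af
    · exact Or.inr (Or.inr (Or.inr ⟨v, af⟩))
    · exact (hno D ⟨hD, hd, aa, af⟩).elim
  clear hd hD D
  by_contra! hex
  obtain ⟨D0, hD0⟩ := hex
  obtain ⟨D, hDm, hmin⟩ := exists_min_image (univ.filter Bad) card ⟨D0, by simp [hD0]⟩
  simp only [mem_filter, mem_univ, true_and] at hDm hmin
  obtain ⟨hcl, hdd, hc1, hc2⟩ := hDm
  have hle : D.card ≤ Dᶜ.card := hmin _ ⟨hcl.compl, by rw [dd_compl]; exact hdd, hc2, by rwa [compl_compl]⟩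
  obtain ⟨t, ht⟩ := block_lemma (X := D) h (by
    intro φ
    by_contra! hh
    obtain ⟨hne, hnd⟩ := hh
    set E := D.image φ with hE
    have hEc : E.card = D.card := card_image_aut φ D
    have hEd : dd G E = dd G D := dd_image φ D
    have hEcl : Cl o p E := S.clImage hcl φ
    have hI : D ∩ E ≠ ∅ := by
      intro am; exact hnd (disjoint_iff_inter_eq_empty.2 am)
    have hDE : ¬ D ⊆ E := fun hs => hne (eq_of_subset_of_card_le hs (by omega)).symm
    have hED : ¬ E ⊆ D := fun hs => hne (eq_of_subset_of_card_le hs (by omega))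
    have hcc := card_add_card_compl D
    have hI1 : 0 < (D ∩ E).card := card_pos.2 (nonempty_iff_ne_empty.2 hI)
    have hIc := card_inter_add_card_sdiff D E
    have hS1 : D \ E ≠ ∅ := fun am => hDE (sdiff_eq_empty_iff_subset.1 am)
    have hS2 : E \ D ≠ ∅ := fun am => hED (sdiff_eq_empty_iff_subset.1 am)
    have hS1c : 0 < (D \ E).card := card_pos.2 (nonempty_iff_ne_empty.2 hS1)
    have hU := card_union_add_card_inter D E
    have hUc : (D ∪ E)ᶜ ≠ ∅ := by
      intro am
      have := card_add_card_compl (D ∪ E)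
      rw [am, card_empty] at this
      omega
    have sub1 : ∀ X, X ⊆ D → X.card < D.card → Xᶜ ≠ ∅ ∧ 8 ≤ Xᶜ.card := by
      intro X hX hlt
      have := card_le_card (compl_subset_compl.2 hX)
      refine ⟨?_, by omega⟩
      intro am; rw [am, card_empty] at this; omega
    have ib := sub1 (D ∩ E) inter_subset_left (by omega)
    have ia := sub1 (D \ E) sdiff_subset (by omega)
    have ai := S.dd4 h htf (hcl.inter hEcl) hI ib.1
    have ak := S.dd4 h htf (hcl.union hEcl) (by
      intro am
      have := union_eq_empty.1 am
      rw [this.1] at hc1; simp at hc1) hUc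
    have aq := S.dd4 h htf (hcl.sdiff hEcl) hS1 ia.1
    have ar := S.dd4 h htf (hEcl.sdiff hcl) hS2 (by
      intro am
      have af := card_le_card (compl_subset_compl.2 (show E \ D ⊆ E from sdiff_subset))
      have ah := card_add_card_compl E
      rw [am, card_empty] at af
      omega)
    have sa := dd_submod (G := G) D E
    have sb := dd_posimod (G := G) D E
    have bb : ∃ v, D ∩ E = ZZ o p v := by
      rcases S.clCard (hcl.inter hEcl) with aa | ⟨v, -, aa⟩ | aa
      · exact absurd aa hI
      · exact ⟨v, aa⟩
      · have := hmin (D ∩ E) ⟨hcl.inter hEcl, by omega, aa, ib.2⟩; omega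
    have ba : ∃ v, D \ E = ZZ o p v := by
      rcases S.clCard (hcl.sdiff hEcl) with aa | ⟨v, -, aa⟩ | aa
      · exact absurd aa hS1
      · exact ⟨v, aa⟩
      · have := hmin (D \ E) ⟨hcl.sdiff hEcl, by omega, aa, ia.2⟩; omega
    obtain ⟨v, hv⟩ := bb
    obtain ⟨w, hw⟩ := ba
    have hDu : D = ZZ o p v ∪ ZZ o p w := by
      rw [← hv, ← hw]; ext; simp only [mem_union, mem_inter, mem_sdiff]; tauto
    have tc := S.two htf nt hDu
    have ta := S.two htf nt (hDu.trans (union_comm _ _))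
    have hdj : Disjoint (ZZ o p v) (ZZ o p w) := by
      rw [← hv, ← hw]; exact disjoint_sdiff_inter D E |>.symm
    have tb : dd G D = ((ZZ o p v).filter (fun u => l u ∉ D)).card + ((ZZ o p w).filter (fun u => l u ∉ D)).card := by
      rw [S.ddCl hcl]
      conv_lhs => rw [show D.filter (fun u => l u ∉ D) = (ZZ o p v ∪ ZZ o p w).filter (fun u => l u ∉ D) by rw [← hDu]]
      rw [filter_union, card_union_of_disjoint (disjoint_filter_filter hdj)]
    omega)
  rcases Nat.eq_zero_or_pos t with am | am
  · rw [am, mul_zero] at ht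
    rcases dd_zero h.conn ht with aa | aa
    · rw [aa] at hc1; simp at hc1
    · rw [aa] at hc2; simp at hc2
  · have := Nat.mul_le_mul_left D.card am
    omega
lemma S4.n20 (S : S4 G o l p) (htf : TF G) (nt : NT o l p) (v : V) : 20 ≤ Fintype.card V := by
  have key : ∀ u, u ∈ ZZ o p v → l u ∉ ZZ o p v := by
    intro u hu; rw [← S.Zeq hu]; exact S.lZ htf u
  have aa : ((ZZ o p v).biUnion (fun u => ZZ o p (l u))).card = 16 := by
    rw [card_biUnion]
    · simp [S.cardZ]
    · intro a ha b hb hne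
      apply S.Zdisj
      refine nt a b ?_ hne.symm
      rw [S.Zeq ha]; exact hb
  have af : Disjoint (ZZ o p v) ((ZZ o p v).biUnion (fun u => ZZ o p (l u))) := by
    rw [disjoint_biUnion_right]
    intro u hu
    exact S.Zdisj (key u hu)
  have ah := card_le_univ (ZZ o p v ∪ (ZZ o p v).biUnion (fun u => ZZ o p (l u)))
  rw [card_union_of_disjoint af, aa, S.cardZ] at ah
  exact ah
lemma S4.twin (S : S4 G o l p) (h : CVT G) (htf : TF G) (nt : ¬ NT o l p) : ∀ v, l (o v) = o (l v) := by
  have cyc : ∀ v w, G.Adj v w → w ≠ l v → (w = p v ∨ w = o (p v)) := by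
    intro v w aa af
    rcases (S.nb v w).1 aa with h | h | h
    · exact Or.inl h
    · exact Or.inr h
    · exact absurd h af
  have cyc2 : ∀ v w, G.Adj v w → w ≠ l v → G.Adj (o v) w := by
    intro v w aa af
    rcases cyc v w aa af with rfl | rfl
    · exact S.oap v
    · exact S.oaop v
  have nosq : ∀ v w, G.Adj v w → w ≠ l v → ¬ G.Adj (l v) (l w) := by
    intro v w aa af ah
    have hne : l w ≠ v := by intro e; apply af; rw [← e, S.ll]
    exact (S.sq v (l w) w (l v) aa (S.al v) af hne (S.al w).symm ah.symm).2.2 rfl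
  have noadj : ∀ v w, G.Adj v w → w ≠ l v → l w ∉ ZZ o p (l v) := by
    intro v w aa af hm
    have hlw : l w = o (l v) := by
      simp only [ZZ, mem_insert, mem_singleton] at hm
      rcases hm with e | e | e | e
      · exfalso
        have := congrArg l e
        rw [S.ll, S.ll] at this; exact aa.ne this.symm
      · exact e
      · exact absurd (by rw [e]; exact S.ap _) (nosq v w aa af)
      · exact absurd (by rw [e]; exact S.aop _) (nosq v w aa af)
    obtain ⟨φ, hφ⟩ := h.vt (l v) v
    have ea : l (o v) = φ w := by
      rw [← hφ, ← S.eqo, ← S.eql, ← hlw, S.ll]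
    have eb : l v = φ v := by
      conv_lhs => rw [← hφ]
      rw [← S.eql, S.ll]
    have ai : G.Adj (l v) (l (o v)) := by rw [ea, eb]; exact φ.map_adj_iff.2 aa
    have ak : l (o v) ≠ l (l v) := by
      rw [S.ll]; intro e
      have := congrArg l e
      rw [S.ll] at this
      exact S.lo htf v this.symm
    have aq : G.Adj (o (l v)) (l (o v)) := cyc2 _ _ ai ak
    rw [← hlw] at aq
    have ar : G.Adj w (o v) := (cyc2 v w aa af).symm
    refine nosq w (o v) ar ?_ aq
    intro e
    have : l (o v) = w := by rw [e, S.ll]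
    have bb : G.Adj (o (o v)) w ∧ True := ⟨by rw [S.oo]; exact aa, trivial⟩
    rcases cyc v w aa af with ef | ef
    · rcases S.po v with eg | eg
      · exact S.da (o v) (by rw [eg, this, ef])
      · exact S.db (o v) (by rw [eg, this, ef, S.oo])
    · rcases S.po v with eg | eg
      · exact S.db (o v) (by rw [eg, this, ef])
      · exact S.da (o v) (by rw [eg, this, ef])
  unfold NT at nt
  push Not at nt
  obtain ⟨v, w, hw, hne, hm⟩ := nt
  have hwo : w = o v := by
    simp only [ZZ, mem_insert, mem_singleton] at hw
    rcases hw with e | e | e | e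
    · exact absurd e hne
    · exact e
    · exact absurd hm (noadj v w (e ▸ S.ap v) (e ▸ S.da v))
    · exact absurd hm (noadj v w (e ▸ S.aop v) (e ▸ S.db v))
  subst hwo
  have hfin : l (o v) = o (l v) := by
    have hback : l (l (o v)) ∈ ZZ o p (l (l v)) := by rw [S.ll, S.ll]; exact hw
    simp only [ZZ, mem_insert, mem_singleton] at hm
    rcases hm with e | e | e | e
    · have := congrArg l e
      rw [S.ll, S.ll] at this
      exact absurd this hne
    · exact e
    · exact absurd hback (noadj (l v) _ (e ▸ S.ap _) (e ▸ S.da _))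
    · exact absurd hback (noadj (l v) _ (e ▸ S.aop _) (e ▸ S.db _))
  intro u
  obtain ⟨φ, rfl⟩ := h.vt v u
  rw [← S.eqo, ← S.eql, hfin, S.eqo, S.eql]
lemma S4.alt_nt (S : S4 G o l p) (h : CVT G) (htf : TF G) (nt : NT o l p) {y : V → ℤ} (hy : ∀ v, y v = 1 ∨ y v = -1)
    (ho : ∀ v, y (o v) = y v) (hp : ∀ v, y (p v) = - y v) {B : Finset V} (hB : ∀ v, v ∈ B ↔ y (l v) = y v)
    (hBc : B.card ≤ 4) {a : V} (ha : a ∈ B) : False := by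
  classical
  set W : V → Finset V := fun w => ZZ o p w ∪ (ZZ o p w).image l with hW
  have li : Function.Injective l := Function.LeftInverse.injective S.ll
  have Wc : ∀ w, (W w).card = 8 := by
    intro w
    rw [hW]
    show (ZZ o p w ∪ (ZZ o p w).image l).card = 8
    rw [card_union_of_disjoint, card_image_of_injective _ li, S.cardZ]
    rw [Finset.disjoint_left]
    intro u hu hu2
    obtain ⟨t, ht, rfl⟩ := mem_image.1 hu2
    have := S.lZ htf t
    rw [S.Zeq ht] at this
    exact this hu
  have n20 := S.n20 htf nt a
  have hSc : (B.erase a ∪ (W a ∪ W (l a))).card ≤ 19 := by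
    have aa := card_union_le (B.erase a) (W a ∪ W (l a))
    have af := card_union_le (W a) (W (l a))
    rw [Wc, Wc] at af
    have ah := card_erase_of_mem ha
    omega
  obtain ⟨v, hv⟩ : ∃ v, v ∉ B.erase a ∪ (W a ∪ W (l a)) := by
    by_contra! hh
    have := eq_univ_iff_forall.2 hh
    rw [this, card_univ] at hSc
    omega
  simp only [mem_union, not_or, mem_erase, not_and] at hv
  obtain ⟨hv1, hv2, hv3⟩ := hv
  have hvB : v ∉ B := by
    apply hv1
    rintro rfl
    exact hv2 (mem_union_left _ (ZZ_self v))
  obtain ⟨φ, hφ⟩ := h.vt v a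
  set D := univ.filter (fun u => y u ≠ y (φ u)) with hD
  have mD : ∀ u, u ∈ D ↔ y u ≠ y (φ u) := by simp [hD]
  have hpφ : ∀ u, y (φ (p u)) = - y (φ u) := by
    intro u
    rcases S.eqp φ u with e | e
    · rw [← e, hp]
    · have := hp (φ u)
      rw [e, S.eqo, ho] at this; exact this
  have hcl : Cl o p D := by
    intro u
    constructor
    · rw [mD, mD, S.eqo, ho, ho]
    · rw [mD, mD, hpφ, hp]; simp
  have hX : ∀ u, ¬ (u ∈ D ↔ l u ∈ D) → u ∈ B ∪ B.image φ.symm := by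
    intro u hu
    by_contra hn
    simp only [mem_union, mem_image, not_or, not_exists, not_and] at hn
    have nc : y (l u) ≠ y u := fun e => hn.1 ((hB u).2 e)
    have nd : y (l (φ u)) ≠ y (φ u) := fun e => hn.2 (φ u) ((hB _).2 e) (by simp)
    apply hu
    rw [mD, mD, S.eql]
    have ai := hy u
    have ak := hy (l u)
    have aq := hy (φ u)
    have ar := hy (l (φ u))
    constructor
    · intro h; omega
    · intro h; omega
  have hUc : (B ∪ B.image φ.symm).card ≤ 8 := by
    have aa := card_union_le B (B.image φ.symm)
    have af := card_image_le (s := B) (f := φ.symm)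
    omega
  have hdd : dd G D ≤ 4 := by
    rw [S.ddCl hcl]
    set K := D.filter (fun u => l u ∉ D) with hK
    have aa : Disjoint K (K.image l) := by
      rw [Finset.disjoint_left]
      intro u hu hu2
      obtain ⟨t, ht, rfl⟩ := mem_image.1 hu2
      simp only [hK, mem_filter] at hu ht
      exact ht.2 hu.1
    have af : K ∪ K.image l ⊆ B ∪ B.image φ.symm := by
      intro u hu
      apply hX
      rcases mem_union.1 hu with h | h
      · simp only [hK, mem_filter] at h; simp [h]
      · obtain ⟨t, ht, rfl⟩ := mem_image.1 h
        simp only [hK, mem_filter] at ht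
        simp [S.ll, ht]
    have ah := card_le_card af
    rw [card_union_of_disjoint aa, card_image_of_injective _ li] at ah
    omega
  have hvX : ¬ (v ∈ D ↔ l v ∈ D) := by
    rw [mD, mD, S.eql, hφ]
    have ea := (hB a).1 ha
    have eb : y (l v) ≠ y v := fun e => hvB ((hB v).2 e)
    have ai := hy v
    have ak := hy (l v)
    have aq := hy a
    rw [ea]
    intro hh
    by_cases hc : y v = y a
    · rw [hc] at hh eb
      exact (hh.2 eb) rfl
    · have := hh.1 hc; omega
  have fin : ∀ w, (∀ u, u ∈ ZZ o p w → ¬ (u ∈ D ↔ l u ∈ D)) → (v ∈ ZZ o p w ∨ l v ∈ ZZ o p w) → False := by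
    intro w hw hvw
    have aa : W w ⊆ B ∪ B.image φ.symm := by
      intro u hu
      apply hX
      rcases mem_union.1 hu with h | h
      · exact hw u h
      · obtain ⟨t, ht, rfl⟩ := mem_image.1 h
        rw [S.ll]
        have := hw t ht
        exact fun e => this e.symm
    have af := eq_of_subset_of_card_le aa (by rw [Wc]; exact hUc)
    have ah : a ∈ W w := by rw [af]; exact mem_union_left _ ha
    have ag : v ∈ W w := by
      rcases hvw with h | h
      · exact mem_union_left _ h
      · exact mem_union_right _ (mem_image.2 ⟨_, h, S.ll v⟩)
    rcases mem_union.1 ah with h | h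
    · apply hv2
      show v ∈ ZZ o p a ∪ (ZZ o p a).image l
      rw [S.Zeq h]; exact ag
    · obtain ⟨t, ht, rfl⟩ := mem_image.1 h
      apply hv3
      rw [S.ll]
      show v ∈ ZZ o p t ∪ (ZZ o p t).image l
      rw [S.Zeq ht]; exact ag
  have lz : ∀ w u, u ∈ ZZ o p w → l u ∉ ZZ o p w := by
    intro w u hu; rw [← S.Zeq hu]; exact S.lZ htf u
  rcases S.linkcut h htf nt hcl hdd with e | e | ⟨w, e⟩ | ⟨w, e⟩
  · apply hvX; simp [e]
  · apply hvX; simp [e]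
  · apply fin w
    · intro u hu; rw [e]; simp [hu, lz w u hu]
    · rw [← e]; by_contra hh; push Not at hh; apply hvX; simp [hh]
  · apply fin w
    · intro u hu
      have aa := lz w u hu
      rw [← e] at hu aa
      simp only [mem_compl, not_not] at hu aa
      simp [hu, aa]
    · rw [← e]; by_contra hh; simp only [mem_compl, not_or, not_not] at hh; apply hvX; simp [hh]
lemma S4.sumZ (S : S4 G o l p) (x : V → ℤ) (v : V) : ∑ w ∈ ZZ o p v, x w = x v + x (o v) + x (p v) + x (o (p v)) := by
  have aa := S.one v
  have af := S.one (p v)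
  have ah := (S.ap v).ne
  have ag := (S.aop v).ne
  have aj := (S.oap v).ne
  have an := (S.oaop v).ne
  unfold ZZ
  rw [sum_insert (by simp [aa.symm, ah, ag]), sum_insert (by simp [aj, an]),
      sum_insert (by simp [af.symm]), sum_singleton]
  ring
lemma S4.sumZZ (S : S4 G o l p) (x : V → ℤ) : ∑ v, ∑ w ∈ ZZ o p v, x w = 4 * ∑ v, x v := by
  have aa : ∀ v, ∑ w ∈ ZZ o p v, x w = ∑ w, if w ∈ ZZ o p v then x w else 0 := by
    intro v; rw [← sum_filter]; congr 1; ext; simp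
  simp_rw [aa]
  rw [sum_comm, mul_sum]
  refine sum_congr rfl fun w _ => ?_
  have af : ∀ v, w ∈ ZZ o p v ↔ v ∈ ZZ o p w := by
    intro v
    constructor
    · intro h; rw [S.Zeq h]; exact ZZ_self v
    · intro h; rw [S.Zeq h]; exact ZZ_self w
  simp_rw [af]
  rw [← sum_filter, sum_const, filter_mem_eq_inter, univ_inter, S.cardZ]
  simp
lemma S4.suml (S : S4 G o l p) (x : V → ℤ) : ∑ v, (x v + x (l v)) = 2 * ∑ v, x v := by
  rw [sum_add_distrib]
  have : ∑ v, x (l v) = ∑ v, x v :=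
    Equiv.sum_comp (⟨l, l, S.ll, S.ll⟩ : V ≃ V) x
  rw [this]; ring
lemma S4.conZ (S : S4 G o l p) {f : V → ℤ} (hf : ∀ v, 0 ≤ f v) (hc : ∀ v w, w ∈ ZZ o p v → f w = f v) {u v w : V} (huv : u ∉ ZZ o p v)
    (huw : u ∉ ZZ o p w) (hvw : v ∉ ZZ o p w) : 4 * f u + 4 * f v + 4 * f w ≤ ∑ v, f v := by
  have aa : ∀ v, ∑ w ∈ ZZ o p v, f w = 4 * f v := by
    intro v; rw [sum_congr rfl (hc v), sum_const, S.cardZ]; simp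
  rw [← aa, ← aa, ← aa, ← sum_union (S.Zdisj huv).symm, ← sum_union]
  · exact sum_le_sum_of_subset_of_nonneg (subset_univ _) (fun _ _ _ => hf _)
  · rw [disjoint_union_left]
    exact ⟨(S.Zdisj huw).symm, (S.Zdisj hvw).symm⟩
lemma S4.conZ2 (S : S4 G o l p) {f : V → ℤ} (hf : ∀ v, 0 ≤ f v) (hc : ∀ v w, w ∈ ZZ o p v → f w = f v) {u v : V} (huv : u ∉ ZZ o p v) :
    4 * f u + 4 * f v ≤ ∑ v, f v := by
  have aa : ∀ v, ∑ w ∈ ZZ o p v, f w = 4 * f v := by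
    intro v; rw [sum_congr rfl (hc v), sum_const, S.cardZ]; simp
  rw [← aa, ← aa, ← sum_union (S.Zdisj huv).symm]
  exact sum_le_sum_of_subset_of_nonneg (subset_univ _) (fun _ _ _ => hf _)
lemma S4.conZ1 (S : S4 G o l p) {f : V → ℤ} (hf : ∀ v, 0 ≤ f v) (hc : ∀ v w, w ∈ ZZ o p v → f w = f v) {u : V} :
    4 * f u ≤ ∑ v, f v := by
  have aa : ∀ v, ∑ w ∈ ZZ o p v, f w = 4 * f v := by
    intro v; rw [sum_congr rfl (hc v), sum_const, S.cardZ]; simp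
  rw [← aa]
  exact sum_le_sum_of_subset_of_nonneg (subset_univ _) (fun _ _ _ => hf _)
lemma S4.conL (S : S4 G o l p) {x : V → ℤ} (hf : ∀ v, 0 ≤ x v + x (l v)) {u v w : V} (aa : u ≠ v) (af : u ≠ l v)
    (ah : u ≠ w) (ag : u ≠ l w) (aj : v ≠ w) (an : v ≠ l w) :
    (x u + x (l u)) + (x v + x (l v)) + (x w + x (l w)) ≤ ∑ v, x v := by
  have hs := S.suml x
  have hsub := sum_le_sum_of_subset_of_nonneg (subset_univ ({u, l u, v, l v, w, l w} : Finset V))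
    (f := fun v => x v + x (l v)) (fun i _ _ => hf i)
  have e : ∀ {a b}, a ≠ l b → l a ≠ b := by rintro a b h rfl; exact h (S.ll a).symm
  have f : ∀ {a b}, a ≠ b → l a ≠ l b := by
    intro a b h h'; apply h; rw [← S.ll a, h', S.ll]
  have n : ∀ a, a ≠ l a := fun a => (S.al a).ne
  rw [sum_insert (by simp [n, aa, af, ah, ag]), sum_insert (by simp [e af, f aa, e ag, f ah]),
    sum_insert (by simp [n, aj, an]), sum_insert (by simp [e an, f aj]),
    sum_insert (by simp [n]), sum_singleton] at hsub
  simp only [S.ll] at hsub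
  linarith
lemma S4.conL2 (S : S4 G o l p) {x : V → ℤ} (hf : ∀ v, 0 ≤ x v + x (l v)) {u v : V} (aa : u ≠ v) (af : u ≠ l v) :
    (x u + x (l u)) + (x v + x (l v)) ≤ ∑ v, x v := by
  have hs := S.suml x
  have hsub := sum_le_sum_of_subset_of_nonneg (subset_univ ({u, l u, v, l v} : Finset V))
    (f := fun v => x v + x (l v)) (fun i _ _ => hf i)
  have e : ∀ {a b}, a ≠ l b → l a ≠ b := by rintro a b h rfl; exact h (S.ll a).symm
  have f : ∀ {a b}, a ≠ b → l a ≠ l b := by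
    intro a b h h'; apply h; rw [← S.ll a, h', S.ll]
  have n : ∀ a, a ≠ l a := fun a => (S.al a).ne
  rw [sum_insert (by simp [n, aa, af]), sum_insert (by simp [e af, f aa]),
    sum_insert (by simp [n]), sum_singleton] at hsub
  simp only [S.ll] at hsub
  linarith
lemma pm_four {a b c d : ℤ} (ha : a = 1 ∨ a = -1) (hb : b = 1 ∨ b = -1) (hc : c = 1 ∨ c = -1) (hd : d = 1 ∨ d = -1)
    (h : a + b + c + d = 2) : (a = -1 ∧ b = 1 ∧ c = 1 ∧ d = 1) ∨ (a = 1 ∧ b = -1 ∧ c = 1 ∧ d = 1) ∨ (a = 1 ∧ b = 1 ∧ c = -1 ∧ d = 1) ∨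
    (a = 1 ∧ b = 1 ∧ c = 1 ∧ d = -1) := by omega
lemma S4.caseA (S : S4 G o l p) (h : CVT G) (hnb : ¬ G.Colorable 2) (htf : TF G) {x : V → ℤ} (hA : CaseA G x) : False := by
  classical
  have hcon : ∀ v w, w ∈ ZZ o p v → (∑ z ∈ ZZ o p w, x z) = ∑ z ∈ ZZ o p v, x z := by
    intro v w hw; rw [S.Zeq hw]
  have ea := fun v => hA.edge _ _ (S.ap v)
  have eb := fun v => hA.edge _ _ (S.oaop v)
  have ec := fun v => hA.edge _ _ (S.aop v)
  have ed := fun v => hA.edge _ _ (S.oap v)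
  have hpos : ∀ v, 0 ≤ ∑ z ∈ ZZ o p v, x z := by
    intro v; rw [S.sumZ]; linarith [ea v, eb v]
  have hsum := S.sumZZ x
  rw [hA.sum] at hsum
  obtain ⟨va, hv0⟩ : ∃ va, 0 < ∑ z ∈ ZZ o p va, x z := by
    by_contra! hh
    have := sum_nonpos (fun v (_ : v ∈ (univ : Finset V)) => hh v)
    omega
  have ev : ∀ v, (∑ z ∈ ZZ o p v, x z) % 2 = 0 := by
    intro v; rw [S.sumZ]
    have ai := hA.pm v
    have ak := hA.pm (o v)
    have aq := hA.pm (p v)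
    have ar := hA.pm (o (p v))
    omega
  have hv2 : ∑ z ∈ ZZ o p va, x z = 2 := by
    have := S.conZ1 hpos hcon (u := va)
    have := ev va
    omega
  have hother : ∀ u, u ∉ ZZ o p va → ∑ z ∈ ZZ o p u, x z = 0 := by
    intro u hu
    have := S.conZ2 hpos hcon hu
    have := hpos u
    omega
  obtain ⟨t, ht, xt, xot, xpt, xopt⟩ : ∃ t, ZZ o p t = ZZ o p va ∧ x t = -1 ∧ x (o t) = 1 ∧ x (p t) = 1 ∧ x (o (p t)) = 1 := by
    have aa : ∃ t ∈ ZZ o p va, x t = -1 := by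
      have ah := hv2
      rw [S.sumZ] at ah
      rcases pm_four (hA.pm va) (hA.pm (o va)) (hA.pm (p va)) (hA.pm (o (p va))) ah with h | h | h | h
      · exact ⟨va, ZZ_self _, h.1⟩
      · exact ⟨o va, by simp [ZZ], h.2.1⟩
      · exact ⟨p va, by simp [ZZ], h.2.2.1⟩
      · exact ⟨o (p va), by simp [ZZ], h.2.2.2⟩
    obtain ⟨t, ht, hxt⟩ := aa
    have ah := hcon _ _ ht
    rw [hv2, S.sumZ] at ah
    have ak := hA.pm (o t)
    have aq := hA.pm (p t)
    have ar := hA.pm (o (p t))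
    exact ⟨t, S.Zeq ht, hxt, by omega, by omega, by omega⟩
  set q := o t with hq
  set y : V → ℤ := fun v => if v = q then -1 else x v with hydef
  have yq : y q = -1 := by simp [hydef]
  have yne : ∀ v, v ≠ q → y v = x v := by intro v hv; simp [hydef, hv]
  have yt : y t = -1 := by rw [yne t (S.one t).symm, xt]
  have ypt : y (p t) = 1 := by rw [yne _ (S.oap t).ne', xpt]
  have yopt : y (o (p t)) = 1 := by rw [yne _ (S.oaop t).ne', xopt]
  have hy : ∀ v, y v = 1 ∨ y v = -1 := by
    intro v
    by_cases hv : v = q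
    · rw [hv, yq]; simp
    · rw [yne v hv]; exact hA.pm v
  have hqZ : q ∈ ZZ o p va := by rw [← ht]; simp [ZZ, hq]
  have halt : ∀ v, y (o v) = y v ∧ y (p v) = - y v := by
    intro v
    by_cases hv : v ∈ ZZ o p t
    · simp only [ZZ, mem_insert, mem_singleton] at hv
      rcases hv with rfl | rfl | rfl | rfl
      · rw [← hq, yq, yt, ypt]; simp
      · rw [S.oo, yt, ← hq, yq]
        rcases S.po t with e | e
        · rw [hq, e, ypt]; simp
        · rw [hq, e, yopt]; simp
      · rw [yopt, ypt]
        rcases S.pp t with e | e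
        · rw [e, yt]; simp
        · rw [e, ← hq, yq]; simp
      · rw [S.oo, yopt, ypt]
        rcases S.po (p t) with e | e <;> rcases S.pp t with e' | e' <;> rw [e, e'] <;> simp [yt, yq, ← hq, S.oo]
        rw [hq, S.oo, yt]
    · rw [ht] at hv
      have am := hother v hv
      have hvm : ∀ w ∈ ZZ o p v, w ≠ q := by
        rintro w hw rfl
        exact Finset.disjoint_left.1 (S.Zdisj hv) hqZ hw
      rw [S.sumZ] at am
      rw [yne v (hvm v (by simp [ZZ])), yne (o v) (hvm _ (by simp [ZZ])), yne (p v) (hvm _ (by simp [ZZ]))]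
      have bb := ea v
      have ba := eb v
      have bf := ec v
      have bg := ed v
      constructor <;> linarith
  set B := univ.filter (fun v => y (l v) = y v) with hBdef
  have hB : ∀ v, v ∈ B ↔ y (l v) = y v := by simp [hBdef]
  have hlpos : ∀ v, 0 ≤ x v + x (l v) := fun v => hA.edge _ _ (S.al v)
  have hls := S.suml x
  rw [hA.sum] at hls
  obtain ⟨a, ha⟩ : ∃ a, 0 < x a + x (l a) := by
    by_contra! hh
    have := sum_nonpos (fun v (_ : v ∈ (univ : Finset V)) => hh v)
    omega
  have ha2 : x a = 1 ∧ x (l a) = 1 := by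
    have ai := hA.pm a
    have ak := hA.pm (l a)
    omega
  have hlo : ∀ u, u ≠ a → u ≠ l a → x u + x (l u) = 0 := by
    intro u aa af
    have := S.conL2 hlpos aa af
    rw [hA.sum] at this
    have := hlpos u
    omega
  have hBsub : B ⊆ {a, l a, q, l q} := by
    intro u hu
    rw [hB] at hu
    by_contra hn
    simp only [mem_insert, mem_singleton, not_or] at hn
    obtain ⟨nc, nd, nf, ng⟩ := hn
    have := hlo u nc nd
    rw [yne u nf, yne (l u) (fun e => ng (by rw [← e, S.ll]))] at hu
    have := hA.pm u
    omega
  have hBc : B.card ≤ 4 := (card_le_card hBsub).trans card_le_four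
  obtain ⟨b, hb⟩ : ∃ b, b ∈ B := by
    by_contra! hh
    apply hnb
    refine ⟨Coloring.mk (fun v => if y v = 1 then (0 : Fin 2) else 1) ?_⟩
    intro u v huv heq
    have aa : y v = - y u := by
      rcases (S.nb u v).1 huv with rfl | rfl | rfl
      · exact (halt u).2
      · rw [(halt _).1]; exact (halt u).2
      · have := hh u
        rw [hB] at this
        have ai := hy u
        have ak := hy (l u)
        omega
    have ai := hy u
    have ak := hy v
    rcases ai with ai | ai <;> rcases ak with ak | ak <;> simp [ai, ak] at heq aa
  by_cases nt : NT o l p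
  · exact S.alt_nt h htf nt hy (fun v => (halt v).1) (fun v => (halt v).2) hB hBc hb
  · have tw := S.twin h htf nt
    have hb' := (hB b).1 hb
    have mb : o b ∈ B := by rw [hB, tw, (halt _).1, (halt _).1, hb']
    have md : l b ∈ B := by rw [hB, S.ll, hb']
    have me : o (l b) ∈ B := by rw [hB, tw, S.ll, (halt _).1, (halt _).1, hb']
    have cg : ({b, o b, l b, o (l b)} : Finset V).card = 4 := by
      have nc := S.one b
      have nd := (S.al b).ne
      have nf := S.lo htf b
      have ng := S.one (l b)
      have nh : b ≠ o (l b) := by intro e; apply S.lo htf b; rw [e, S.oo, ← e]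
      have ni : o b ≠ o (l b) := by intro e; apply nd; have eb := congrArg o e; rwa [S.oo, S.oo] at eb
      rw [card_insert_of_notMem (by simp [nc.symm, nd, nh]), card_insert_of_notMem (by simp [nf.symm, ni]),
        card_insert_of_notMem (by simp [ng.symm]), card_singleton]
    have sub : ({b, o b, l b, o (l b)} : Finset V) ⊆ B := by
      intro u hu
      simp only [mem_insert, mem_singleton] at hu
      rcases hu with rfl | rfl | rfl | rfl <;> assumption
    have hBe := eq_of_subset_of_card_le sub (by omega)
    have hBe2 := eq_of_subset_of_card_le hBsub (by rw [← hBe, cg]; exact card_le_four)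
    have hyB : ∀ u ∈ B, y u = y b := by
      intro u hu
      rw [← hBe] at hu
      simp only [mem_insert, mem_singleton] at hu
      rcases hu with rfl | rfl | rfl | rfl
      · rfl
      · exact (halt _).1
      · exact hb'
      · rw [(halt _).1, hb']
    have ya := hyB a (by rw [hBe2]; simp)
    have yb := hyB q (by rw [hBe2]; simp)
    by_cases haq : a = q
    · rw [hBe2] at hBe
      rw [hBe, haq] at cg
      have : ({q, l q, q, l q} : Finset V) ⊆ {q, l q} := by intro u; simp
      have := (card_le_card this).trans card_le_two
      omega
    · rw [yne a haq, ha2.1] at ya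
      rw [yq] at yb
      omega
variable {x : V → ℤ} {H : Finset V} {a b c d : V}
lemma CaseB.swap (hB : CaseB G x H a b c d) : CaseB G x H c d a b where
  memH := hB.memH
  pm := hB.pm
  edge := hB.edge
  sum := hB.sum
  dH := hB.dH
  cardH := hB.cardH
  oddH := hB.oddH
  hab := hB.hcd
  hcd := hB.hab
  xa := hB.xc
  xb := hB.xd
  xc := hB.xa
  xd := hB.xb
  ac := hB.ac.symm
  ad := hB.bc.symm
  bc := hB.ad.symm
  bd := hB.bd.symm
  only := by
    intro u v h aa af
    rcases hB.only u v h aa af with h | h | h | h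
    · exact Or.inr (Or.inr (Or.inl h))
    · exact Or.inr (Or.inr (Or.inr h))
    · exact Or.inl h
    · exact Or.inr (Or.inl h)
lemma S4.memc (S : S4 G o l p) (hd : d = p c ∨ d = o (p c)) (v : V) :
    v ∈ ZZ o p c ↔ v = c ∨ v = o c ∨ v = d ∨ v = o d := by
  simp only [ZZ, mem_insert, mem_singleton]
  rcases hd with rfl | rfl
  · rfl
  · rw [S.oo]; tauto
lemma S4.zc (S : S4 G o l p) (hB : CaseB G x H a b c d) (hd : d = p c ∨ d = o (p c)) :
    x (o c) = 0 ∧ x (o d) = 0 := by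
  have aa : G.Adj (o c) d := by
    rcases hd with rfl | rfl
    · exact S.oap c
    · exact S.oaop c
  have af : G.Adj c (o d) := by
    rcases hd with rfl | rfl
    · exact S.aop c
    · rw [S.oo]; exact S.ap c
  have ah : G.Adj (o c) (o d) := by
    rcases hd with rfl | rfl
    · exact S.oaop c
    · rw [S.oo]; exact S.oap c
  have nc : x (o c) ≠ 1 := by
    intro e
    rcases hB.only _ _ aa e hB.xd with h | h | h | h
    · exact hB.bd h.2.symm
    · exact hB.ad h.2.symm
    · exact S.one c h.1
    · exact hB.hcd.ne h.2.symm
  have nd : x (o d) ≠ 1 := by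
    intro e
    rcases hB.only _ _ af hB.xc e with h | h | h | h
    · exact hB.ac h.1.symm
    · exact hB.bc h.1.symm
    · exact S.one d h.2
    · exact hB.hcd.ne h.1
  have := hB.edge _ _ ah
  have := hB.pm (o c)
  have := hB.pm (o d)
  omega
lemma S4.anc (S : S4 G o l p) (hB : CaseB G x H a b c d) (hd : d = p c ∨ d = o (p c)) :
    a ∉ ZZ o p c ∧ b ∉ ZZ o p c := by
  obtain ⟨aa, af⟩ := S.zc hB hd
  rw [S.memc hd, S.memc hd]
  constructor
  · rintro (h | h | h | h)
    · exact hB.ac h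
    · have := hB.xa; rw [h, aa] at this; omega
    · exact hB.ad h
    · have := hB.xa; rw [h, af] at this; omega
  · rintro (h | h | h | h)
    · exact hB.bc h
    · have := hB.xb; rw [h, aa] at this; omega
    · exact hB.bd h
    · have := hB.xb; rw [h, af] at this; omega
lemma S4.sc (S : S4 G o l p) (hB : CaseB G x H a b c d) (hd : d = p c ∨ d = o (p c)) :
    ∑ z ∈ ZZ o p c, x z = 2 := by
  obtain ⟨aa, af⟩ := S.zc hB hd
  rw [S.sumZ, hB.xc, aa]
  have := hB.xd
  rcases hd with rfl | rfl
  · rw [this, af]; norm_num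
  · rw [S.oo] at af; rw [this, af]; norm_num
lemma S4.ddM (S : S4 G o l p) {E M K : Finset V} (hE : Cl o p E) (hM : ∀ v, v ∉ M → (v ∈ E ↔ x v = 0))
    (hK : ∀ v, x v = 0 → x (l v) ≠ 0 → v ∈ K) : dd G E ≤ M.card + K.card := by
  classical
  rw [S.ddCl hE]
  have sub : E.filter (fun u => l u ∉ E) ⊆ ((M ∩ E) ∪ (M \ E).image l) ∪ K := by
    intro u hu
    rw [mem_filter] at hu
    by_cases aa : u ∈ M
    · exact mem_union_left _ (mem_union_left _ (mem_inter.2 ⟨aa, hu.1⟩))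
    by_cases af : l u ∈ M
    · exact mem_union_left _ (mem_union_right _ (mem_image.2 ⟨l u, mem_sdiff.2 ⟨af, hu.2⟩, S.ll u⟩))
    · exact mem_union_right _ (hK u ((hM u aa).1 hu.1) (fun h => hu.2 ((hM _ af).2 h)))
  have aa := card_le_card sub
  have af := card_union_le ((M ∩ E) ∪ (M \ E).image l) K
  have ah := card_union_le (M ∩ E) ((M \ E).image l)
  have ag : ((M \ E).image l).card ≤ (M \ E).card := card_image_le
  have aj := card_inter_add_card_sdiff M E
  omega
lemma pat_int {a b c d : ℤ} (ha : a = 1 ∨ a = -1 ∨ a = 0) (hb : b = 1 ∨ b = -1 ∨ b = 0) (hc : c = 1 ∨ c = -1 ∨ c = 0)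
    (hd : d = 1 ∨ d = -1 ∨ d = 0) (h : a + b + c + d = 1) (aa : 0 ≤ a + c) (af : 0 ≤ a + d) (ah : 0 ≤ b + c) (ag : 0 ≤ b + d)
    (nc : ¬ (a = 1 ∧ c = 1)) (nd : ¬ (a = 1 ∧ d = 1)) (nf : ¬ (b = 1 ∧ c = 1)) (ng : ¬ (b = 1 ∧ d = 1)) :
    ((a = 0 ∧ b = -1) ∨ (a = 1 ∧ b = 0)) ∨ ((b = 0 ∧ a = -1) ∨ (b = 1 ∧ a = 0)) ∨ ((c = 0 ∧ d = -1) ∨ (c = 1 ∧ d = 0)) ∨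
    ((d = 0 ∧ c = -1) ∨ (d = 1 ∧ c = 0)) := by
  rcases ha with rfl | rfl | rfl <;> rcases hb with rfl | rfl | rfl <;> rcases hc with rfl | rfl | rfl <;>
    rcases hd with rfl | rfl | rfl <;> revert h aa af ah ag nc nd nf ng <;> decide
set_option maxHeartbeats 1000000 in
lemma S4.caseB_main (S : S4 G o l p) (h : CVT G) (htf : TF G) (hB : CaseB G x H a b c d) (hb : b = l a)
    (hd : d = p c ∨ d = o (p c)) : ∃ y, CaseA G y := by
  classical
  obtain ⟨zoc, zod⟩ := S.zc hB hd
  obtain ⟨anc, bnc⟩ := S.anc hB hd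
  have sc := S.sc hB hd
  have memc := S.memc (c := c) hd
  have hcon : ∀ v w, w ∈ ZZ o p v → (∑ z ∈ ZZ o p w, x z) = ∑ z ∈ ZZ o p v, x z := by
    intro v w hw; rw [S.Zeq hw]
  have ea := fun v => hB.edge _ _ (S.ap v)
  have eb := fun v => hB.edge _ _ (S.oaop v)
  have ec := fun v => hB.edge _ _ (S.aop v)
  have ed := fun v => hB.edge _ _ (S.oap v)
  have hpos : ∀ v, 0 ≤ ∑ z ∈ ZZ o p v, x z := by
    intro v; rw [S.sumZ]; linarith [ea v, eb v]
  have hsum := S.sumZZ x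
  rw [hB.sum] at hsum
  obtain ⟨va, v0c, hv0⟩ : ∃ va, va ∉ ZZ o p c ∧ 0 < ∑ z ∈ ZZ o p va, x z := by
    by_contra! hh
    have aa : ∑ v ∈ ZZ o p c, ∑ w ∈ ZZ o p v, x w = ∑ v, ∑ w ∈ ZZ o p v, x w :=
      sum_subset (subset_univ _) (fun v _ hv => le_antisymm (hh v hv) (hpos v))
    rw [sum_congr rfl (hcon c), sum_const, S.cardZ, sc, hsum] at aa
    norm_num at aa
  have hv1 : ∑ z ∈ ZZ o p va, x z = 1 := by
    have := S.conZ2 hpos hcon v0c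
    omega
  have hoth : ∀ u, u ∉ ZZ o p c → u ∉ ZZ o p va → x (o u) = x u ∧ x (p u) = - x u := by
    intro u aa af
    have ah := S.conZ hpos hcon af aa v0c
    have ag := hpos u
    have aj : ∑ z ∈ ZZ o p u, x z = 0 := by omega
    rw [S.sumZ] at aj
    have := ea u
    have := eb u
    have := ec u
    have := ed u
    constructor <;> omega
  have hl : ∀ v, 0 ≤ x v + x (l v) := fun v => hB.edge _ _ (S.al v)
  set K : Finset V := univ.filter (fun v => x v = 0 ∧ x (l v) ≠ 0) with hKdef
  have memK : ∀ v, v ∈ K ↔ x v = 0 ∧ x (l v) ≠ 0 := by intro v; simp [hKdef]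
  have hK : K.card ≤ 1 := by
    rw [card_le_one]
    intro u hu v hv
    rw [memK] at hu hv
    by_contra huv
    have fa : ∀ w, x w = 0 → w ≠ a ∧ w ≠ l a := by
      intro w hw
      constructor
      · rintro rfl; have := hB.xa; omega
      · rintro rfl; have := hB.xb; rw [hb] at this; omega
    have fd : u ≠ l v := by rintro rfl; exact hv.2 hu.1
    have g := S.conL hl huv fd (fa u hu.1).1 (fa u hu.1).2 (fa v hv.1).1 (fa v hv.1).2
    rw [hB.sum, hB.xa, ← hb, hB.xb] at g
    have := hl u
    have := hl v
    omega
  have nopp : ∀ u v, G.Adj u v → u ∉ ZZ o p c → v ≠ l u → ¬ (x u = 1 ∧ x v = 1) := by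
    rintro u v huv hu hv ⟨aa, af⟩
    rcases hB.only u v huv aa af with h | h | h | h
    · rw [h.1, h.2, hb] at hv; exact hv rfl
    · rw [h.1, h.2, hb, S.ll] at hv; exact hv rfl
    · rw [h.1] at hu; exact hu (ZZ_self _)
    · rw [h.1, memc] at hu; simp at hu
  have mc : ∀ m ∈ ZZ o p va, m ∉ ZZ o p c := by
    intro m hm hm2
    apply v0c
    rw [← S.Zeq hm2, S.Zeq hm]; exact ZZ_self _
  have nn : ∀ m ∈ ZZ o p va, ¬ (x m = 1 ∧ x (p m) = 1) ∧ ¬ (x m = 1 ∧ x (o (p m)) = 1) ∧ ¬ (x (o m) = 1 ∧ x (p m) = 1) ∧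
      ¬ (x (o m) = 1 ∧ x (o (p m)) = 1) := by
    intro m hm
    have aa := mc m hm
    have hm2 : o m ∈ ZZ o p va := ((S.clZ va m).1).2 hm
    have af := mc _ hm2
    have key : ∀ u ∈ ZZ o p va, l u ∉ ZZ o p va := by
      intro u hu; have := S.lZ htf u; rwa [S.Zeq hu] at this
    have hp : p m ∈ ZZ o p va := ((S.clZ va m).2).2 hm
    have hop : o (p m) ∈ ZZ o p va := ((S.clZ va _).1).2 hp
    refine ⟨nopp _ _ (S.ap m) aa ?_, nopp _ _ (S.aop m) aa ?_, nopp _ _ (S.oap m) af ?_, nopp _ _ (S.oaop m) af ?_⟩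
    · intro e; exact key m hm (e ▸ hp)
    · intro e; exact key m hm (e ▸ hop)
    · intro e; exact key _ hm2 (e ▸ hp)
    · intro e; exact key _ hm2 (e ▸ hop)
  have pat : ∃ m ∈ ZZ o p va, (x m = 0 ∧ x (o m) = -1 ∧ x (p m) = 1 ∧ x (o (p m)) = 1) ∨
      (x m = 1 ∧ x (o m) = 0 ∧ x (p m) = 0 ∧ x (o (p m)) = 0) := by
    have am : ∃ m ∈ ZZ o p va, (x m = 0 ∧ x (o m) = -1) ∨ (x m = 1 ∧ x (o m) = 0) := by
      obtain ⟨qg, qf, qh, qi⟩ := nn va (ZZ_self _)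
      have ah := hv1
      rw [S.sumZ] at ah
      rcases pat_int (hB.pm va) (hB.pm (o va)) (hB.pm (p va)) (hB.pm (o (p va))) ah (ea _) (ec _) (ed _) (eb _) qg qf qh qi with h | h | h | h
      · exact ⟨va, ZZ_self _, h⟩
      · exact ⟨o va, by simp [ZZ], by rw [S.oo]; exact h⟩
      · exact ⟨p va, by simp [ZZ], h⟩
      · exact ⟨o (p va), by simp [ZZ], by rw [S.oo]; exact h⟩
    obtain ⟨m, hm, hx⟩ := am
    refine ⟨m, hm, ?_⟩
    have ah := hcon _ _ hm
    rw [hv1, S.sumZ] at ah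
    obtain ⟨qg, qf, qh, qi⟩ := nn m hm
    have aq := hB.pm (p m)
    have ar := hB.pm (o (p m))
    have bb := ea m
    have ba := eb m
    have bf := ec m
    have bg := ed m
    rcases hx with hx | hx
    · left; omega
    · right; omega
  obtain ⟨m, hm, hpat⟩ := pat
  have hmZ := S.Zeq hm
  by_cases nt : NT o l p
  ·
    have hD : ∃ D : Finset V, Cl o p D ∧ (∀ v ∈ D, v ∉ ZZ o p c) ∧ ∀ v, v ∉ ({o c, o d, m} : Finset V) → (v ∈ D ↔ x v = 0) := by
      set D0 : Finset V := univ.filter (fun v => v ∉ ZZ o p c ∧ v ∉ ZZ o p va ∧ x v = 0) with hD0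
      have mD0 : ∀ v, v ∈ D0 ↔ v ∉ ZZ o p c ∧ v ∉ ZZ o p va ∧ x v = 0 := by intro v; simp [hD0]
      have cD0 : Cl o p D0 := by
        intro v
        rw [mD0, mD0, mD0, (S.clZ c v).1, (S.clZ va v).1, (S.clZ c v).2, (S.clZ va v).2]
        constructor
        · constructor
          · rintro ⟨aa, af, ah⟩; exact ⟨aa, af, by rw [← (hoth v aa af).1]; exact ah⟩
          · rintro ⟨aa, af, ah⟩; exact ⟨aa, af, by rw [(hoth v aa af).1]; exact ah⟩
        · constructor
          · rintro ⟨aa, af, ah⟩; exact ⟨aa, af, by have := (hoth v aa af).2; omega⟩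
          · rintro ⟨aa, af, ah⟩; exact ⟨aa, af, by have := (hoth v aa af).2; omega⟩
      have cc : ∀ v, v ∈ ZZ o p c → v ≠ o c → v ≠ o d → x v = 1 := by
        intro v hv aa af
        rcases (memc v).1 hv with rfl | h | rfl | h
        · exact hB.xc
        · exact absurd h aa
        · exact hB.xd
        · exact absurd h af
      have mf : ∀ v, v ∈ ZZ o p va ↔ v = m ∨ v = o m ∨ v = p m ∨ v = o (p m) := by
        intro v; rw [← hmZ]; simp [ZZ]
      rcases hpat with hp | hp
      · refine ⟨D0, cD0, fun v hv => ((mD0 v).1 hv).1, ?_⟩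
        intro v hv
        simp only [mem_insert, mem_singleton, not_or] at hv
        rw [mD0]
        constructor
        · exact fun h => h.2.2
        · intro am
          refine ⟨?_, ?_, am⟩
          · intro aa; have := cc v aa hv.1 hv.2.1; omega
          · intro aa
            rcases (mf v).1 aa with rfl | rfl | rfl | rfl
            · exact hv.2.2 rfl
            · omega
            · omega
            · omega
      · refine ⟨D0 ∪ ZZ o p va, cD0.union (S.clZ va), ?_, ?_⟩
        · intro v hv
          rcases mem_union.1 hv with hv | hv
          · exact ((mD0 v).1 hv).1
          · exact mc v hv
        · intro v hv
          simp only [mem_insert, mem_singleton, not_or] at hv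
          rw [mem_union, mD0]
          constructor
          · rintro (h | h)
            · exact h.2.2
            · rcases (mf v).1 h with rfl | rfl | rfl | rfl
              · exact absurd rfl hv.2.2
              · exact hp.2.1
              · exact hp.2.2.1
              · exact hp.2.2.2
          · intro am
            by_cases af : v ∈ ZZ o p va
            · exact Or.inr af
            · refine Or.inl ⟨?_, af, am⟩
              intro aa; have := cc v aa hv.1 hv.2.1; omega
    obtain ⟨D, clD, Dc, hDx⟩ := hD
    have hKm : ∀ v, x v = 0 → x (l v) ≠ 0 → v ∈ K := fun v aa af => (memK v).2 ⟨aa, af⟩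
    have hd1 : dd G D ≤ 4 := by
      have aa := S.ddM clD hDx hKm
      have af : ({o c, o d, m} : Finset V).card ≤ 3 := card_le_three
      omega
    rcases S.linkcut h htf nt clD hd1 with am | am | ⟨w, am⟩ | ⟨w, am⟩
    · have sub : H ⊆ {o c, o d, m} := by
        intro v hv
        by_contra hv2
        have := (hDx v hv2).2 ((hB.memH v).1 hv)
        rw [am] at this
        exact absurd this (notMem_empty v)
      have aa := card_le_card sub
      have af : ({o c, o d, m} : Finset V).card ≤ 3 := card_le_three
      have ah := hB.cardH
      exact caseB_three htf hB (by omega)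
    · exact absurd (ZZ_self c) (Dc c (by rw [am]; exact mem_univ c))
    · exfalso
      have hd2 : dd G (D ∪ ZZ o p c) ≤ 4 := by
        have aa := S.ddM (M := {c, d, m}) (x := x) (clD.union (S.clZ c)) (by
          intro v hv
          simp only [mem_insert, mem_singleton, not_or] at hv
          rw [mem_union]
          by_cases aa : v ∈ ZZ o p c
          · refine ⟨fun _ => ?_, fun _ => Or.inr aa⟩
            rcases (memc v).1 aa with h | h | h | h
            · exact absurd h hv.1
            · rw [h]; exact zoc
            · exact absurd h hv.2.1
            · rw [h]; exact zod
          · have af : v ∉ ({o c, o d, m} : Finset V) := by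
              rw [memc] at aa
              simp only [not_or] at aa
              simp only [mem_insert, mem_singleton, not_or]
              exact ⟨aa.2.1, aa.2.2.2, hv.2.2⟩
            rw [← hDx v af]
            exact ⟨fun h => h.resolve_right aa, Or.inl⟩) hKm
        have af : ({c, d, m} : Finset V).card ≤ 3 := card_le_three
        omega
      have cf : (D ∪ ZZ o p c).card = 8 := by
        rw [card_union_of_disjoint, am, S.cardZ, S.cardZ]
        rw [Finset.disjoint_left]; exact Dc
      have n20 := S.n20 htf nt c
      rcases S.linkcut h htf nt (clD.union (S.clZ c)) hd2 with aa | aa | ⟨u, aa⟩ | ⟨u, aa⟩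
      · rw [aa] at cf; simp at cf
      · rw [aa, card_univ] at cf; omega
      · rw [aa, S.cardZ] at cf; omega
      · have := card_compl (D ∪ ZZ o p c)
        rw [aa, S.cardZ, cf] at this; omega
    · exfalso
      have hc1 : c ∈ Dᶜ := by rw [mem_compl]; intro hh; exact Dc c hh (ZZ_self c)
      rw [am] at hc1
      have hw := S.Zeq hc1
      have key : ∀ v, v ∉ ZZ o p c → x v = 1 → v = m := by
        intro v hv aa
        by_contra hvm
        have af : v ∉ ({o c, o d, m} : Finset V) := by
          rw [memc] at hv
          simp only [not_or] at hv
          simp only [mem_insert, mem_singleton, not_or]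
          exact ⟨hv.2.1, hv.2.2.2, hvm⟩
        have ah : v ∈ D := by
          by_contra ag
          rw [← mem_compl, am, ← hw] at ag
          exact hv ag
        have := (hDx v af).1 ah
        omega
      exact hB.hab.ne ((key a anc hB.xa).trans (key b bnc hB.xb).symm)
  ·
    exfalso
    have tw := S.twin h htf nt
    have mf : ∀ v, v ∈ ZZ o p va ↔ v = m ∨ v = o m ∨ v = p m ∨ v = o (p m) := by
      intro v; rw [← hmZ]; simp [ZZ]
    have lneq : l c ≠ l d := by
      intro e; apply hB.hcd.ne; rw [← S.ll c, e, S.ll]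
    have dZ : d ∈ ZZ o p c := by rw [memc]; simp
    have tc : ∀ t, t ∈ ZZ o p c → x t = 1 → x (l t) ≠ 1 := by
      intro t ht aa af
      have ah : l t ∉ ZZ o p c := by have := S.lZ htf t; rwa [S.Zeq ht] at this
      rcases hB.only _ _ (S.al t) aa af with h | h | h | h
      · rw [h.1] at ht; exact anc ht
      · rw [h.1] at ht; exact bnc ht
      · rw [h.2] at ah; exact ah dZ
      · rw [h.2] at ah; exact ah (ZZ_self c)
    have ta : ∀ t, t ∈ ZZ o p c → x t = 1 → x (o t) = 0 → x (l t) ≠ 0 →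
        (x m = 0 ∧ x (o m) = -1 ∧ x (p m) = 1 ∧ x (o (p m)) = 1) ∧ l t = o m := by
      intro t ht aa af ah
      have ag : x (l t) = -1 := by
        have := tc t ht aa
        have := hB.pm (l t)
        omega
      have aj := hB.edge _ _ (S.al (o t))
      rw [tw, af] at aj
      have an : l t ∉ ZZ o p c := by have := S.lZ htf t; rwa [S.Zeq ht] at this
      have ao : l t ∈ ZZ o p va := by
        by_contra ao
        have := (hoth _ an ao).1
        omega
      rcases hpat with hp | hp
      · refine ⟨hp, ?_⟩
        rcases (mf _).1 ao with e | e | e | e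
        · rw [e] at ag; omega
        · exact e
        · rw [e] at ag; omega
        · rw [e] at ag; omega
      · rcases (mf _).1 ao with e | e | e | e <;> rw [e] at ag <;> omega
    have P1 : (x m = 0 ∧ x (o m) = -1 ∧ x (p m) = 1 ∧ x (o (p m)) = 1) := by
      by_cases hc0 : x (l c) = 0
      · by_cases hd0 : x (l d) = 0
        · exfalso
          apply lneq
          apply card_le_one.1 hK
          · rw [memK, S.ll, hB.xc]; exact ⟨hc0, by norm_num⟩
          · rw [memK, S.ll, hB.xd]; exact ⟨hd0, by norm_num⟩
        · exact (ta d dZ hB.xd zod hd0).1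
      · exact (ta c (ZZ_self c) hB.xc zoc hc0).1
    have tb : ∀ v, v ∉ ZZ o p c → x v = 1 → x (o v) = 1 := by
      intro v hv aa
      by_cases af : v ∈ ZZ o p va
      · rcases (mf v).1 af with rfl | rfl | rfl | rfl
        · omega
        · omega
        · exact P1.2.2.2
        · rw [S.oo]; exact P1.2.2.1
      · rw [(hoth v hv af).1]; exact aa
    have ob : l (o a) = o b := by rw [tw, hb]
    have aa := tb a anc hB.xa
    have af := tb b bnc hB.xb
    have ah := S.al (o a)
    rw [ob] at ah
    rcases hB.only _ _ ah aa af with e | e | e | e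
    · exact S.one a e.1
    · have := S.lo htf a; rw [← hb] at this; exact this e.1.symm
    · have eb := e.1; have := hB.xa
      rw [← S.oo a, eb, zoc] at this; omega
    · have eb := e.1; have := hB.xa
      rw [← S.oo a, eb, zod] at this; omega
lemma S4.caseB (S : S4 G o l p) (h : CVT G) (htf : TF G) (hB : CaseB G x H a b c d) : ∃ y, CaseA G y := by
  classical
  have eb := fun v => hB.edge _ _ (S.oaop v)
  have ea := fun v => hB.edge _ _ (S.ap v)
  have hpos : ∀ v, 0 ≤ ∑ z ∈ ZZ o p v, x z := by
    intro v; rw [S.sumZ]; linarith [ea v, eb v]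
  have hcon : ∀ v w, w ∈ ZZ o p v → (∑ z ∈ ZZ o p w, x z) = ∑ z ∈ ZZ o p v, x z := by
    intro v w hw; rw [S.Zeq hw]
  have hl : ∀ v, 0 ≤ x v + x (l v) := fun v => hB.edge _ _ (S.al v)
  have ha : b = l a ∨ (b = p a ∨ b = o (p a)) := by
    rcases (S.nb a b).1 hB.hab with h | h | h
    · exact Or.inr (Or.inl h)
    · exact Or.inr (Or.inr h)
    · exact Or.inl h
  have hc : d = l c ∨ (d = p c ∨ d = o (p c)) := by
    rcases (S.nb c d).1 hB.hcd with h | h | h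
    · exact Or.inr (Or.inl h)
    · exact Or.inr (Or.inr h)
    · exact Or.inl h
  rcases ha with ha | ha
  · rcases hc with hc | hc
    · exfalso
      have := S.conL2 hl hB.ac (by rw [← hc]; exact hB.ad)
      rw [← ha, ← hc, hB.xa, hB.xb, hB.xc, hB.xd, hB.sum] at this
      omega
    · exact S.caseB_main h htf hB ha hc
  · rcases hc with hc | hc
    · exact S.caseB_main h htf hB.swap hc ha
    · exfalso
      have sa := S.sc hB hc
      have sb := S.sc hB.swap ha
      have := S.conZ2 hpos hcon (S.anc hB hc).1
      rw [sa, sb, S.sumZZ, hB.sum] at this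
      omega
lemma main_back (h : CVT G) (hnb : ¬ G.Colorable 2) (heven : Even (Fintype.card V)) (htf : TF G)
    (hm : ∀ n : ℕ, 2 ≤ n → ¬ Nonempty (G ≃g circThree (4 * n) 1 (4 * n - 1) (2 * n)))
    (hp : ∀ n : ℕ, 2 ≤ n → ¬ Nonempty (G ≃g circThree (4 * n + 2) 2 (4 * n) (2 * n + 1)))
    (hP : ¬ Nonempty (G ≃g genPetersen 5 2)) : IsNExtendable G 2 := by
  obtain ⟨au⟩ := h.conn.nonempty
  obtain ⟨b, c, d, hab, hac, had, hbc, hbd, hcd, hall⟩ := nbr3 h.cub au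
  rw [ext_iff]
  refine ⟨?_, ?_, ?_⟩
  · have hdis : Disjoint (G.neighborFinset au) (G.neighborFinset b) := by
      rw [Finset.disjoint_left]
      intro u aa af
      rw [mem_neighborFinset] at aa af
      exact htf _ _ _ hab af aa.symm
    have aa := card_union_of_disjoint hdis
    rw [h.cub, h.cub] at aa
    have af := card_le_univ (G.neighborFinset au ∪ G.neighborFinset b)
    omega
  · obtain ⟨e, f, g, aa, af, ah, ag, aj, an, ao⟩ := nbr3 h.cub b
    obtain ⟨t, ht, hta⟩ : ∃ t, G.Adj b t ∧ au ≠ t := by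
      by_cases he : au = e
      · exact ⟨f, af, fun h => ag (he.symm.trans h)⟩
      · exact ⟨e, aa, he⟩
    refine ⟨au, c, b, t, hac, ht, hab.ne, hta, hbc.symm, ?_⟩
    rintro rfl
    exact htf _ _ _ hab ht hac.symm
  · intro a b c d hab hcd aa af ah ag
    by_contra hno
    have hAB := caseAB h htf heven hab hcd aa af ah ag hno
    by_cases hF : F4 G
    · have hA : ∃ y, CaseA G y := by
        rcases hAB with hA | ⟨x, H, hB⟩
        · exact hA
        · exact caseB_girth5 h htf hF heven hB
      obtain ⟨y, hA⟩ := hA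
      exact hP (caseA_petersen h hnb htf hF hA)
    · by_cases hR : ∃ v p, Rung G v p
      · obtain ⟨v, p, hR⟩ := hR
        rcases rung_main h hnb htf hR with ⟨n, hn, hi⟩ | ⟨n, hn, hi⟩
        · exact hm n hn hi
        · exact hp n hn hi
      · have hR' : ∀ v p, ¬ Rung G v p := fun v p hh => hR ⟨v, p, hh⟩
        obtain ⟨o, l, p, S⟩ := exists_S4 h hnb htf hR' hF
        have hA : ∃ y, CaseA G y := by
          rcases hAB with hA | ⟨x, H, hB⟩
          · exact hA
          · exact S.caseB h htf hB
        obtain ⟨y, hA⟩ := hA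
        exact S.caseA h hnb htf hA
end P

/-- A finite connected cubic non-bipartite vertex-transitive graph of even order is
2-extendable iff its girth is at least 4 and it is not isomorphic to
`Z_{4n}(1,4n-1,2n)` (`n ≥ 2`), `Z_{4n+2}(2,4n,2n+1)` (`n ≥ 2`), or the Petersen graph. -/
theorem cubic_nonbipartite_vertexTransitive_two_extendable_iff {V : Type*} [Fintype V]
    (G : SimpleGraph V) [DecidableRel G.Adj] (hconn : G.Connected)
    (hcubic : G.IsRegularOfDegree 3) (hnb : ¬ G.Colorable 2)
    (hvt : IsVertexTransitive G) (heven : Even (Fintype.card V)) :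
    IsNExtendable G 2 ↔
      (4 ≤ G.girth ∧
        (∀ n : ℕ, 2 ≤ n → ¬ Nonempty (G ≃g circThree (4 * n) 1 (4 * n - 1) (2 * n))) ∧
        (∀ n : ℕ, 2 ≤ n → ¬ Nonempty (G ≃g circThree (4 * n + 2) 2 (4 * n) (2 * n + 1))) ∧
        ¬ Nonempty (G ≃g genPetersen 5 2)) := by
  classical
  have hc : ∀ v, (G.neighborFinset v).card = 3 := fun v => hcubic v
  have h : CVT G := ⟨hconn, hc, hvt⟩
  constructor
  · intro he
    refine ⟨girth_of_tf hconn hc (tri_not_ext hconn hc he), ?_, ?_, ?_⟩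
    · rintro n hn ⟨f⟩
      haveI : NeZero (4 * n) := ⟨by omega⟩
      haveI : Fintype (ZMod (4 * n)) := ZMod.fintype (4 * n)
      exact mobius_not_ext hn (ext_iso f he)
    · rintro n hn ⟨f⟩
      haveI : Fintype (ZMod (4 * n + 2)) := ZMod.fintype (4 * n + 2)
      exact prism_not_ext hn (ext_iso f he)
    · rintro ⟨f⟩
      exact petersen_not_ext (ext_iso f he)
  · rintro ⟨hg, hm, hp, hP⟩
    exact main_back h hnb heven (tf_of_girth hg) hm hp hP
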